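/- arXiv:1806.02250 — 4 statements merged into one kernel-verified Lean document; each statement's English description precedes it below -/
import Mathlib

section
/- Let A be a primitive set, i.e., a set of integers greater than 1 in which no element divides another. Then f(A) := ∑_{a∈A} 1/(a·log a) < e^γ, where γ is Euler's constant. -/
open scoped BigOperators

/-- A set of positive integers is *primitive* if every element exceeds 1 and
no element divides another element. -/
def IsPrimitive (A : Set ℕ) : Prop :=
  (∀ a ∈ A, 1 < a) ∧ ∀ a ∈ A, ∀ b ∈ A, a ≠ b → ¬ a ∣ b

/-- `f A = ∑_{a ∈ A} 1/(a log a)`. -/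
noncomputable def f (A : Set ℕ) : ℝ :=
  ∑' a : A, 1 / ((a : ℕ) * Real.log (a : ℕ))

open Finset
open ArithmeticFunction (vonMangoldt_nonneg vonMangoldt_sum vonMangoldt_le_log)
open scoped ArithmeticFunction.vonMangoldt

/-- Dirichlet's rearrangement of a sum over the factorisations of the integers up to `N`. -/
lemma sum_Ioc_divisorsAntidiagonal (F : ℕ → ℕ → ℝ) (N : ℕ) :
    ∑ n ∈ Ioc 0 N, ∑ x ∈ n.divisorsAntidiagonal, F x.1 x.2 =
      ∑ d ∈ Ioc 0 N, ∑ q ∈ Ioc 0 (N / d), F d q := by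
  trans ∑ n ∈ Ioc 0 N, ∑ x ∈ Ioc 0 N ×ˢ Ioc 0 N with x.1 * x.2 = n, F x.1 x.2
  · refine sum_congr rfl fun n hn ↦ ?_
    simp only [mem_Ioc] at hn
    rw [Nat.divisorsAntidiagonal_eq_prod_filter_of_le hn.1.ne' hn.2]
  trans ∑ x ∈ Ioc 0 N ×ˢ Ioc 0 N with x.1 * x.2 ≤ N, F x.1 x.2
  · simp_rw [sum_filter]
    rw [sum_comm]
    exact sum_congr rfl fun _ _ ↦ (by simp_all)
  rw [sum_filter, sum_product]
  refine sum_congr rfl fun n hn ↦ ?_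
  rw [← sum_filter]
  congr 1
  ext q
  simp only [mem_filter, mem_Ioc] at hn ⊢
  rw [Nat.le_div_iff_mul_le hn.1, mul_comm q n]
  constructor
  · rintro ⟨⟨h1, _⟩, h3⟩
    exact ⟨h1, h3⟩
  · rintro ⟨h1, h3⟩
    exact ⟨⟨h1, by nlinarith⟩, h3⟩

lemma sum_divisorsAntidiagonal_vonMangoldt (n : ℕ) :
    ∑ x ∈ n.divisorsAntidiagonal, Λ x.1 = Real.log n := by
  rw [Nat.sum_divisorsAntidiagonal (fun d _ ↦ Λ d), vonMangoldt_sum]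

/-- Each block of `k` consecutive terms is at most `k` times its first term. -/
lemma sum_Icc_rpow_le {u : ℝ} (hu : 0 < u) {k M : ℕ} (hk : 0 < k) :
    ∑ n ∈ Icc k M, (n : ℝ) ^ (-(1 + u)) ≤
      (k : ℝ) ^ (-u) * ∑ n ∈ Ioc 0 (M / k), (n : ℝ) ^ (-(1 + u)) := by
  have hmap : ∀ n ∈ Icc k M, n / k ∈ Ioc 0 (M / k) := by
    intro n hn
    rw [mem_Icc] at hn
    exact mem_Ioc.2 ⟨Nat.div_pos hn.1 hk, Nat.div_le_div_right hn.2⟩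
  rw [← sum_fiberwise_of_maps_to hmap, mul_sum]
  refine sum_le_sum fun j hj ↦ ?_
  have hj0 : 0 < j := (mem_Ioc.1 hj).1
  have hjr : (0 : ℝ) < j := by exact_mod_cast hj0
  have hkr : (0 : ℝ) < k := by exact_mod_cast hk
  have hsub : (Icc k M).filter (fun n ↦ n / k = j) ⊆ Ico (j * k) (j * k + k) := by
    intro n hn
    obtain ⟨-, h⟩ := mem_filter.1 hn
    rw [Nat.div_eq_iff hk] at h
    rw [mem_Ico]
    omega
  calc ∑ n ∈ (Icc k M).filter (fun n ↦ n / k = j), (n : ℝ) ^ (-(1 + u))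
      ≤ ∑ n ∈ (Icc k M).filter (fun n ↦ n / k = j), ((j * k : ℕ) : ℝ) ^ (-(1 + u)) := by
        refine sum_le_sum fun n hn ↦ ?_
        have h := (mem_Ico.1 (hsub hn)).1
        refine Real.rpow_le_rpow_of_nonpos ?_ (by exact_mod_cast h) (by linarith)
        exact_mod_cast Nat.mul_pos hj0 hk
    _ ≤ k * ((j * k : ℕ) : ℝ) ^ (-(1 + u)) := by
        rw [sum_const, nsmul_eq_mul]
        refine mul_le_mul_of_nonneg_right ?_ (by positivity)
        have := card_le_card hsub
        rw [Nat.card_Ico] at this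
        exact_mod_cast (by omega)
    _ = (k : ℝ) ^ (-u) * (j : ℝ) ^ (-(1 + u)) := by
        rw [Nat.cast_mul, Real.mul_rpow hjr.le hkr.le]
        have : (k : ℝ) ^ (-u) = k * (k : ℝ) ^ (-(1 + u)) := by
          rw [← Real.rpow_one_add' hkr.le (by linarith)]
          ring_nf
        rw [this]
        ring

lemma sum_log_sub_log_mul_rpow_le {u : ℝ} (hu : 0 < u) {M : ℕ} (hM : 2 ≤ M) :
    ∑ k ∈ Ioc 1 M, (Real.log k - Real.log (k - 1 : ℕ)) * (k : ℝ) ^ (-u) ≤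
      2 ^ (-u) * (Real.log 2 + 1 / u) - (M : ℝ) ^ (-u) / u := by
  induction M, hM using Nat.le_induction with
  | base =>
    rw [show Ioc 1 2 = {2} from rfl, sum_singleton]
    norm_num
    exact le_of_eq (by ring)
  | succ n hn ih =>
    rw [sum_Ioc_succ_top (by omega)]
    have hn0 : (0 : ℝ) < n := by exact_mod_cast (by omega)
    have hn1 : (0 : ℝ) < (n + 1 : ℕ) := by positivity
    have key : u * (Real.log (n + 1 : ℕ) - Real.log n) * ((n + 1 : ℕ) : ℝ) ^ (-u) ≤
        (n : ℝ) ^ (-u) - ((n + 1 : ℕ) : ℝ) ^ (-u) := by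
      rw [Real.rpow_def_of_pos hn0, Real.rpow_def_of_pos hn1]
      have h := Real.add_one_le_exp (u * (Real.log (n + 1 : ℕ) - Real.log n))
      have e : Real.exp (Real.log n * -u) =
          Real.exp (u * (Real.log (n + 1 : ℕ) - Real.log n)) *
            Real.exp (Real.log (n + 1 : ℕ) * -u) := by
        rw [← Real.exp_add]
        ring_nf
      rw [e]
      nlinarith [Real.exp_pos (Real.log (n + 1 : ℕ) * -u)]
    have h2 : (Real.log (n + 1 : ℕ) - Real.log n) * ((n + 1 : ℕ) : ℝ) ^ (-u) ≤
        (n : ℝ) ^ (-u) / u - ((n + 1 : ℕ) : ℝ) ^ (-u) / u := by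
      rw [← sub_div, le_div_iff₀ hu]
      linarith
    simp only [Nat.add_sub_cancel]
    linarith

lemma sum_log_mul_rpow_le {u : ℝ} (hu : 0 < u) {M : ℕ} (hM : 2 ≤ M) :
    ∑ n ∈ Ioc 0 M, Real.log n * (n : ℝ) ^ (-(1 + u)) ≤
      2 ^ (-u) * (Real.log 2 + 1 / u) * ∑ n ∈ Ioc 0 M, (n : ℝ) ^ (-(1 + u)) := by
  have hlog : ∀ n ∈ Ioc 0 M, Real.log n =
      ∑ k ∈ Ioc 1 n, (Real.log k - Real.log (k - 1 : ℕ)) := by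
    intro n hn
    obtain ⟨h0, -⟩ := mem_Ioc.1 hn
    clear hn
    induction n, h0 using Nat.le_induction with
    | base => simp
    | succ n hn ih => rw [sum_Ioc_succ_top (by omega), ← ih]; simp
  have hZ : 0 ≤ ∑ n ∈ Ioc 0 M, (n : ℝ) ^ (-(1 + u)) := sum_nonneg fun n _ ↦ by positivity
  calc ∑ n ∈ Ioc 0 M, Real.log n * (n : ℝ) ^ (-(1 + u))
      = ∑ n ∈ Ioc 0 M, ∑ k ∈ Ioc 1 n,
          (Real.log k - Real.log (k - 1 : ℕ)) * (n : ℝ) ^ (-(1 + u)) := by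
        refine sum_congr rfl fun n hn ↦ ?_
        rw [hlog n hn, sum_mul]
    _ = ∑ k ∈ Ioc 1 M, ∑ n ∈ Icc k M,
          (Real.log k - Real.log (k - 1 : ℕ)) * (n : ℝ) ^ (-(1 + u)) := by
        refine sum_comm' fun n k ↦ ?_
        simp only [mem_Ioc, mem_Icc]
        omega
    _ ≤ ∑ k ∈ Ioc 1 M, (Real.log k - Real.log (k - 1 : ℕ)) * (k : ℝ) ^ (-u) *
          ∑ n ∈ Ioc 0 M, (n : ℝ) ^ (-(1 + u)) := by
        refine sum_le_sum fun k hk ↦ ?_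
        obtain ⟨hk1, -⟩ := mem_Ioc.1 hk
        rw [← mul_sum, mul_assoc]
        refine mul_le_mul_of_nonneg_left ((sum_Icc_rpow_le hu (by omega)).trans ?_) ?_
        · refine mul_le_mul_of_nonneg_left ?_ (by positivity)
          refine sum_le_sum_of_subset_of_nonneg ?_ fun n _ _ ↦ by positivity
          exact Ioc_subset_Ioc_right (Nat.div_le_self _ _)
        · refine sub_nonneg.2 (Real.log_le_log ?_ ?_)
          · exact_mod_cast (by omega)
          · exact_mod_cast (by omega)
    _ = (∑ k ∈ Ioc 1 M, (Real.log k - Real.log (k - 1 : ℕ)) * (k : ℝ) ^ (-u)) *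
          ∑ n ∈ Ioc 0 M, (n : ℝ) ^ (-(1 + u)) := by rw [sum_mul]
    _ ≤ _ := by
        refine mul_le_mul_of_nonneg_right ((sum_log_sub_log_mul_rpow_le hu hM).trans ?_) hZ
        have : 0 ≤ (M : ℝ) ^ (-u) / u := by positivity
        linarith

/-- An elementary strengthening of `-ζ'(1 + u) / ζ(1 + u) ≤ 1 / u`. -/
lemma sum_vonMangoldt_mul_rpow_le {u : ℝ} (hu : 0 < u) (N : ℕ) :
    ∑ q ∈ Ioc 0 N, Λ q * (q : ℝ) ^ (-(1 + u)) ≤ 2 ^ (-u) * (Real.log 2 + 1 / u) := by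
  rcases Nat.eq_zero_or_pos N with rfl | hN
  · simpa using by positivity
  have hsum : Summable fun n : ℕ ↦ (n : ℝ) ^ (-(1 + u)) :=
    Real.summable_nat_rpow.2 (by linarith)
  set Z := ∑' n : ℕ, (n : ℝ) ^ (-(1 + u)) with hZdef
  have hZle (M : ℕ) : ∑ n ∈ Ioc 0 M, (n : ℝ) ^ (-(1 + u)) ≤ Z :=
    hsum.sum_le_tsum _ fun n _ ↦ by positivity
  have hZpos : 0 < Z := lt_of_lt_of_le (by simp) (hZle 1)
  set R := ∑ q ∈ Ioc 0 N, Λ q * (q : ℝ) ^ (-(1 + u)) with hR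
  set B := (2 : ℝ) ^ (-u) * (Real.log 2 + 1 / u) with hB
  have hB0 : 0 ≤ B := by positivity
  have hK (K : ℕ) (hK2 : 2 ≤ K) : R * ∑ n ∈ Ioc 0 K, (n : ℝ) ^ (-(1 + u)) ≤ B * Z := by
    have hconv : ∑ n ∈ Ioc 0 (N * K), Real.log n * (n : ℝ) ^ (-(1 + u)) =
        ∑ q ∈ Ioc 0 (N * K), Λ q * (q : ℝ) ^ (-(1 + u)) *
          ∑ d ∈ Ioc 0 (N * K / q), (d : ℝ) ^ (-(1 + u)) := by
      simp_rw [mul_sum]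
      rw [← sum_Ioc_divisorsAntidiagonal
        (fun q d ↦ Λ q * (q : ℝ) ^ (-(1 + u)) * (d : ℝ) ^ (-(1 + u)))]
      refine sum_congr rfl fun n _ ↦ ?_
      rw [← sum_divisorsAntidiagonal_vonMangoldt, sum_mul]
      refine sum_congr rfl fun x hx ↦ ?_
      rw [← (Nat.mem_divisorsAntidiagonal.1 hx).1, Nat.cast_mul,
        Real.mul_rpow (by positivity) (by positivity), mul_assoc]
    calc R * ∑ n ∈ Ioc 0 K, (n : ℝ) ^ (-(1 + u))
        ≤ ∑ q ∈ Ioc 0 N, Λ q * (q : ℝ) ^ (-(1 + u)) *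
          ∑ d ∈ Ioc 0 (N * K / q), (d : ℝ) ^ (-(1 + u)) := by
          rw [hR, sum_mul]
          refine sum_le_sum fun q hq ↦ ?_
          obtain ⟨hq0, hqN⟩ := mem_Ioc.1 hq
          refine mul_le_mul_of_nonneg_left ?_ (mul_nonneg vonMangoldt_nonneg (by positivity))
          refine sum_le_sum_of_subset_of_nonneg ?_ fun n _ _ ↦ by positivity
          refine Ioc_subset_Ioc_right ((Nat.le_div_iff_mul_le hq0).2 ?_)
          rw [mul_comm]
          exact Nat.mul_le_mul_right _ hqN
      _ ≤ ∑ q ∈ Ioc 0 (N * K), Λ q * (q : ℝ) ^ (-(1 + u)) *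
          ∑ d ∈ Ioc 0 (N * K / q), (d : ℝ) ^ (-(1 + u)) := by
          refine sum_le_sum_of_subset_of_nonneg
            (Ioc_subset_Ioc_right (Nat.le_mul_of_pos_right _ (by omega))) fun q _ _ ↦ ?_
          exact mul_nonneg (mul_nonneg vonMangoldt_nonneg (by positivity))
            (sum_nonneg fun n _ ↦ by positivity)
      _ ≤ B * ∑ n ∈ Ioc 0 (N * K), (n : ℝ) ^ (-(1 + u)) :=
          hconv ▸ sum_log_mul_rpow_le hu (by nlinarith)
      _ ≤ B * Z := mul_le_mul_of_nonneg_left (hZle _) hB0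
  have hlim : Filter.Tendsto (fun K : ℕ ↦ R * ∑ n ∈ Ioc 0 K, (n : ℝ) ^ (-(1 + u)))
      Filter.atTop (nhds (R * Z)) := by
    refine Filter.Tendsto.const_mul _ ?_
    refine ((Filter.tendsto_add_atTop_iff_nat 1).2 hsum.hasSum.tendsto_sum_nat).congr fun K ↦ ?_
    rw [range_eq_Ico, sum_eq_sum_Ico_succ_bot (by omega)]
    rw [Nat.cast_zero, Real.zero_rpow (by linarith), zero_add]
    congr 1
  have := le_of_tendsto hlim (Filter.eventually_atTop.2 ⟨2, hK⟩)
  exact le_of_mul_le_mul_right this hZpos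

/-- The Mellin transform of `sum_vonMangoldt_mul_rpow_le`. -/
lemma sum_vonMangoldt_div_mul_log_sq_le {m : ℕ} (hm : 2 ≤ m) (N : ℕ) :
    ∑ q ∈ Ioc 0 N, Λ q / (q * Real.log (m * q) ^ 2) ≤
      Real.log 2 / Real.log (2 * m) ^ 2 + 1 / Real.log (2 * m) := by
  have hmellin {L : ℝ} (hL : 0 < L) :
      (∫ u in Set.Ioi (0 : ℝ), u * Real.exp (-(L * u))) = 1 / L ^ 2 ∧
      (∫ u in Set.Ioi (0 : ℝ), Real.exp (-(L * u))) = 1 / L := by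
    have h2 := Real.integral_rpow_mul_exp_neg_mul_Ioi (a := 2) (by norm_num) hL
    have h1 := Real.integral_rpow_mul_exp_neg_mul_Ioi (a := 1) (by norm_num) hL
    constructor
    · norm_num at h2
      simpa using h2
    · norm_num at h1
      simpa using h1
  have hpos1 {L : ℝ} (hL : 0 < L) : MeasureTheory.IntegrableOn
      (fun u : ℝ ↦ u * Real.exp (-(L * u))) (Set.Ioi 0) := by
    refine MeasureTheory.Integrable.of_integral_ne_zero ?_
    rw [(hmellin hL).1]
    positivity
  have hpos2 {L : ℝ} (hL : 0 < L) : MeasureTheory.IntegrableOn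
      (fun u : ℝ ↦ Real.exp (-(L * u))) (Set.Ioi 0) := by
    refine MeasureTheory.Integrable.of_integral_ne_zero ?_
    rw [(hmellin hL).2]
    positivity
  have hm2 : (2 : ℝ) ≤ m := by exact_mod_cast hm
  have hL2 : 0 < Real.log (2 * m) := Real.log_pos (by linarith)
  have hq (q : ℕ) (hq : q ∈ Ioc 0 N) : 0 < Real.log (m * q) := by
    have : (1 : ℝ) ≤ q := by exact_mod_cast (mem_Ioc.1 hq).1
    exact Real.log_pos (by nlinarith)
  calc ∑ q ∈ Ioc 0 N, Λ q / (q * Real.log (m * q) ^ 2)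
      = ∑ q ∈ Ioc 0 N, ∫ u in Set.Ioi (0 : ℝ),
          Λ q / q * (u * Real.exp (-(Real.log (m * q) * u))) := by
        refine sum_congr rfl fun q hq' ↦ ?_
        rw [MeasureTheory.integral_const_mul, (hmellin (hq q hq')).1, div_mul_div_comm, mul_one]
    _ = ∫ u in Set.Ioi (0 : ℝ), ∑ q ∈ Ioc 0 N,
          Λ q / q * (u * Real.exp (-(Real.log (m * q) * u))) := by
        rw [MeasureTheory.integral_finsetSum]
        exact fun q hq' ↦ (hpos1 (hq q hq')).const_mul _
    _ ≤ ∫ u in Set.Ioi (0 : ℝ), (Real.log 2 * (u * Real.exp (-(Real.log (2 * m) * u))) +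
          Real.exp (-(Real.log (2 * m) * u))) := by
        refine MeasureTheory.setIntegral_mono_on ?_ ?_ measurableSet_Ioi ?_
        · exact MeasureTheory.integrable_finsetSum _
            fun q hq' ↦ (hpos1 (hq q hq')).const_mul _
        · exact ((hpos1 hL2).const_mul _).add (hpos2 hL2)
        · intro u hu
          have hu : 0 < u := hu
          have e (x : ℝ) (hx : 0 < x) : Real.exp (-(Real.log (m * x) * u)) =
              (m : ℝ) ^ (-u) * x ^ (-u) := by
            rw [← Real.mul_rpow (by positivity) hx.le, Real.rpow_def_of_pos (by positivity)]
            ring_nf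
          have h := sum_vonMangoldt_mul_rpow_le hu N
          calc ∑ q ∈ Ioc 0 N, Λ q / q * (u * Real.exp (-(Real.log (m * q) * u)))
              = u * (m : ℝ) ^ (-u) * ∑ q ∈ Ioc 0 N, Λ q * (q : ℝ) ^ (-(1 + u)) := by
                rw [mul_sum]
                refine sum_congr rfl fun q hq' ↦ ?_
                have hq0 : (0 : ℝ) < q := by exact_mod_cast (mem_Ioc.1 hq').1
                rw [e q hq0, neg_add, Real.rpow_add hq0, Real.rpow_neg_one]
                ring
            _ ≤ u * (m : ℝ) ^ (-u) * (2 ^ (-u) * (Real.log 2 + 1 / u)) :=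
                mul_le_mul_of_nonneg_left h (by positivity)
            _ = _ := by
                rw [mul_comm (2 : ℝ) m, e 2 two_pos]
                field_simp
    _ = _ := by
        rw [MeasureTheory.integral_add ((hpos1 hL2).const_mul _) (hpos2 hL2),
          MeasureTheory.integral_const_mul, (hmellin hL2).1, (hmellin hL2).2]
        ring

/-- The expected number of visits to `A` of the Markov chain which jumps from `n` to its divisor `d`
with probability `Λ (n / d) / log n`, when started at `n`. -/
noncomputable def expectedHits (A : Finset ℕ) (n : ℕ) : ℝ :=
  (if n ∈ A then 1 else 0) +
    (∑ d ∈ n.properDivisors.attach, expectedHits A d * Λ (n / d)) / Real.log n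
termination_by n
decreasing_by exact (Nat.mem_properDivisors.1 d.2).2

lemma expectedHits_eq (A : Finset ℕ) (n : ℕ) : expectedHits A n =
    (if n ∈ A then 1 else 0) +
      (∑ d ∈ n.properDivisors, expectedHits A d * Λ (n / d)) / Real.log n := by
  rw [expectedHits, sum_attach n.properDivisors fun d ↦ expectedHits A d * Λ (n / d)]

lemma sum_properDivisors_mul_vonMangoldt (g : ℕ → ℝ) (n : ℕ) :
    ∑ d ∈ n.properDivisors, g d * Λ (n / d) =
      ∑ x ∈ n.divisorsAntidiagonal, g x.1 * Λ x.2 := by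
  rw [Nat.sum_divisorsAntidiagonal (fun d q ↦ g d * Λ q)]
  rcases Nat.eq_zero_or_pos n with rfl | hn
  · simp
  · rw [← Nat.insert_self_properDivisors hn.ne', sum_insert Nat.self_notMem_properDivisors,
      Nat.div_self hn, ArithmeticFunction.vonMangoldt_apply_one, mul_zero, zero_add]

lemma sum_properDivisors_vonMangoldt (n : ℕ) :
    ∑ d ∈ n.properDivisors, Λ (n / d) = Real.log n := by
  have h := sum_properDivisors_mul_vonMangoldt (fun _ ↦ 1) n
  simp only [one_mul] at h
  rw [h, Nat.sum_divisorsAntidiagonal' (fun _ q ↦ Λ q), vonMangoldt_sum]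

lemma expectedHits_eq_zero {A : Finset ℕ} {n : ℕ} (hn : 0 < n) (h : ∀ a ∈ A, ¬a ∣ n) :
    expectedHits A n = 0 := by
  induction n using Nat.strong_induction_on with
  | _ n ih =>
    rw [expectedHits_eq, if_neg fun hA ↦ h n hA dvd_rfl, zero_add, sum_eq_zero, zero_div]
    intro d hd
    obtain ⟨hdvd, hlt⟩ := Nat.mem_properDivisors.1 hd
    rw [ih d hlt (Nat.pos_of_dvd_of_pos hdvd hn) fun a ha had ↦ h a ha (had.trans hdvd), zero_mul]

lemma expectedHits_le_one {A : Finset ℕ} (hA : ∀ a ∈ A, ∀ b ∈ A, a ≠ b → ¬a ∣ b) {n : ℕ}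
    (hn : 0 < n) : expectedHits A n ≤ 1 := by
  induction n using Nat.strong_induction_on with
  | _ n ih =>
    rw [expectedHits_eq]
    split_ifs with h
    · rw [sum_eq_zero, zero_div, add_zero]
      intro d hd
      obtain ⟨hdvd, hlt⟩ := Nat.mem_properDivisors.1 hd
      have hd0 := Nat.pos_of_dvd_of_pos hdvd hn
      rw [expectedHits_eq_zero hd0, zero_mul]
      intro a ha had
      refine hA a ha n h ?_ (had.trans hdvd)
      have := Nat.le_of_dvd hd0 had
      omega
    · rw [zero_add]
      refine div_le_one_of_le₀ ?_ (Real.log_natCast_nonneg n)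
      rw [← sum_properDivisors_vonMangoldt]
      refine sum_le_sum fun d hd ↦ mul_le_of_le_one_left vonMangoldt_nonneg ?_
      obtain ⟨hdvd, hlt⟩ := Nat.mem_properDivisors.1 hd
      exact ih d hlt (Nat.pos_of_dvd_of_pos hdvd hn)

/-- The excess of the weight `w n` over the mass that the weights `w m`, `m ≤ N`, send to `n`. -/
noncomputable def sourceMass (w : ℕ → ℝ) (N n : ℕ) : ℝ :=
  w n - ∑ q ∈ Ioc 0 (N / n), Λ q * (w (n * q) / Real.log (n * q : ℕ))

lemma sum_mul_inflow (w g : ℕ → ℝ) (N : ℕ) :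
    ∑ n ∈ Ioc 0 N, g n * ∑ q ∈ Ioc 0 (N / n), Λ q * (w (n * q) / Real.log (n * q : ℕ)) =
      ∑ n ∈ Ioc 0 N, w n / Real.log n * ∑ d ∈ n.properDivisors, g d * Λ (n / d) := by
  simp_rw [sum_properDivisors_mul_vonMangoldt, mul_sum]
  rw [← sum_Ioc_divisorsAntidiagonal
    (fun n q ↦ g n * (Λ q * (w (n * q) / Real.log (n * q : ℕ))))]
  refine sum_congr rfl fun n _ ↦ sum_congr rfl fun x hx ↦ ?_
  rw [(Nat.mem_divisorsAntidiagonal.1 hx).1]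
  ring

lemma sum_sourceMass_mul_expectedHits {A : Finset ℕ} {N : ℕ} (hA : A ⊆ Ioc 1 N) (w : ℕ → ℝ) :
    ∑ n ∈ Ioc 1 N, sourceMass w N n * expectedHits A n = ∑ a ∈ A, w a := by
  have h1 : expectedHits A 1 = 0 := by
    refine expectedHits_eq_zero one_pos fun a ha h ↦ ?_
    have := (mem_Ioc.1 (hA ha)).1
    have := Nat.le_of_dvd one_pos h
    omega
  rcases Nat.eq_zero_or_pos N with rfl | hN
  · have : A = ∅ := subset_empty.1 (by simpa using hA)
    simp [this]
  have hins (F : ℕ → ℝ) : ∑ n ∈ Ioc 0 N, F n = F 1 + ∑ n ∈ Ioc 1 N, F n := by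
    rw [← insert_Ioc_succ_left_eq_Ioc hN, sum_insert (by simp)]
    rfl
  have hflow := sum_mul_inflow w (expectedHits A) N
  rw [hins, hins, h1, zero_mul, zero_add, Nat.properDivisors_one, sum_empty, mul_zero,
    zero_add] at hflow
  have hw : ∑ n ∈ Ioc 1 N, w n / Real.log n *
      ∑ d ∈ n.properDivisors, expectedHits A d * Λ (n / d) =
      ∑ n ∈ Ioc 1 N, (w n * expectedHits A n - if n ∈ A then w n else 0) := by
    refine sum_congr rfl fun n hn ↦ ?_
    have hlog : Real.log n ≠ 0 :=
      (Real.log_pos (by exact_mod_cast (mem_Ioc.1 hn).1)).ne'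
    rw [expectedHits_eq A n]
    split_ifs <;> field_simp <;> ring
  have hAw : ∑ n ∈ Ioc 1 N, (if n ∈ A then w n else 0) = ∑ a ∈ A, w a := by
    rw [← sum_filter, filter_mem_eq_inter, inter_eq_right.2 hA]
  rw [hw, sum_sub_distrib, hAw] at hflow
  simp_rw [sourceMass, sub_mul, sum_sub_distrib]
  simp_rw [mul_comm _ (expectedHits A _)] at hflow ⊢
  linarith

lemma sum_sourceMass (w : ℕ → ℝ) (N : ℕ) :
    ∑ n ∈ Ioc 1 N, sourceMass w N n = ∑ q ∈ Ioc 0 N, Λ q * (w q / Real.log q) := by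
  rcases Nat.eq_zero_or_pos N with rfl | hN
  · simp
  have hins (F : ℕ → ℝ) : ∑ n ∈ Ioc 0 N, F n = F 1 + ∑ n ∈ Ioc 1 N, F n := by
    rw [← insert_Ioc_succ_left_eq_Ioc hN, sum_insert (by simp)]
    rfl
  have hflow := sum_mul_inflow w (fun _ ↦ 1) N
  simp only [one_mul, sum_properDivisors_vonMangoldt] at hflow
  rw [hins, hins (fun n ↦ w n / Real.log n * Real.log n), Nat.div_one, Nat.cast_one, Real.log_one,
    mul_zero, zero_add] at hflow
  have hw : ∑ n ∈ Ioc 1 N, w n / Real.log n * Real.log n = ∑ n ∈ Ioc 1 N, w n := by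
    refine sum_congr rfl fun n hn ↦ div_mul_cancel₀ _ ?_
    exact (Real.log_pos (by exact_mod_cast (mem_Ioc.1 hn).1)).ne'
  simp only [one_mul] at hflow
  simp_rw [sourceMass, sum_sub_distrib]
  linarith

/-- The Erdős weight `1 / (n log n)` restricted to the integers satisfying `P`. -/
noncomputable def erdosWeight (P : ℕ → Prop) [DecidablePred P] (n : ℕ) : ℝ :=
  if P n then 1 / (n * Real.log n) else 0

lemma inflow_erdosWeight_le (P : ℕ → Prop) [DecidablePred P] (N : ℕ) {n : ℕ} (hn : 2 ≤ n) :
    ∑ q ∈ Ioc 0 (N / n), Λ q * (erdosWeight P (n * q) / Real.log (n * q : ℕ)) ≤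
      1 / n * (Real.log 2 / Real.log (2 * n) ^ 2 + 1 / Real.log (2 * n)) := by
  refine le_trans ?_ (mul_le_mul_of_nonneg_left
    (sum_vonMangoldt_div_mul_log_sq_le hn (N / n)) (by positivity))
  rw [mul_sum]
  refine sum_le_sum fun q _ ↦ ?_
  have h0 : (0 : ℝ) ≤ Real.log (n * q : ℕ) := Real.log_natCast_nonneg _
  calc Λ q * (erdosWeight P (n * q) / Real.log (n * q : ℕ))
      ≤ Λ q * (1 / ((n * q : ℕ) * Real.log (n * q : ℕ)) / Real.log (n * q : ℕ)) := by
        refine mul_le_mul_of_nonneg_left (div_le_div_of_nonneg_right ?_ h0) vonMangoldt_nonneg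
        rw [erdosWeight]
        split_ifs
        · exact le_rfl
        · positivity
    _ = _ := by
        push_cast
        simp only [div_eq_mul_inv, mul_inv, one_mul, ← inv_pow]
        ring

lemma sourceMass_erdosWeight_nonneg {P : ℕ → Prop} [DecidablePred P]
    (hP : ∀ n q, P (n * q) → P n) (N : ℕ) {n : ℕ} (hn : 2 ≤ n) :
    0 ≤ sourceMass (erdosWeight P) N n := by
  rw [sourceMass, sub_nonneg]
  by_cases h : P n
  · refine (inflow_erdosWeight_le P N hn).trans ?_
    rw [erdosWeight, if_pos h, ← one_div_mul_one_div]
    refine mul_le_mul_of_nonneg_left ?_ (by positivity)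
    have hn0 : (n : ℝ) ≠ 0 := by positivity
    have hl : 0 < Real.log n := Real.log_pos (by exact_mod_cast hn)
    have h2 : 0 < Real.log 2 := Real.log_pos one_lt_two
    rw [Real.log_mul two_ne_zero hn0, ← sub_nonneg]
    have : 1 / Real.log n - (Real.log 2 / (Real.log 2 + Real.log n) ^ 2 +
        1 / (Real.log 2 + Real.log n)) =
        Real.log 2 ^ 2 / (Real.log n * (Real.log 2 + Real.log n) ^ 2) := by
      field_simp
      ring
    rw [this]
    positivity
  · rw [erdosWeight, if_neg h]
    refine (sum_eq_zero fun q _ ↦ ?_).le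
    rw [erdosWeight, if_neg fun h' ↦ h (hP n q h'), zero_div, mul_zero]

lemma sum_sourceMass_erdosWeight (P : ℕ → Prop) [DecidablePred P] (N : ℕ) :
    ∑ n ∈ Ioc 1 N, sourceMass (erdosWeight P) N n =
      ∑ q ∈ Ioc 0 N with P q, Λ q / (q * Real.log q ^ 2) := by
  rw [sum_sourceMass, sum_filter]
  refine sum_congr rfl fun q _ ↦ ?_
  rw [erdosWeight]
  split_ifs
  · rw [div_div, pow_two, mul_one_div, mul_assoc]
  · simp

/-- A LYM-type inequality for finite primitive sets. -/
lemma sum_erdosWeight_le {P : ℕ → Prop} [DecidablePred P] (hP : ∀ n q, P (n * q) → P n)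
    {A : Finset ℕ} {N : ℕ} (hAN : A ⊆ Ioc 1 N) (hA : ∀ a ∈ A, ∀ b ∈ A, a ≠ b → ¬a ∣ b) :
    ∑ a ∈ A, erdosWeight P a ≤ ∑ q ∈ Ioc 0 N with P q, Λ q / (q * Real.log q ^ 2) := by
  rw [← sum_sourceMass_mul_expectedHits hAN, ← sum_sourceMass_erdosWeight]
  refine sum_le_sum fun n hn ↦ mul_le_of_le_one_right ?_ ?_
  · exact sourceMass_erdosWeight_nonneg hP N (mem_Ioc.1 hn).1
  · exact expectedHits_le_one hA (by have := (mem_Ioc.1 hn).1; omega)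

lemma sum_le_of_forall_odd {A : Finset ℕ} {N : ℕ} (hAN : A ⊆ Ioc 1 N)
    (hA : ∀ a ∈ A, ∀ b ∈ A, a ≠ b → ¬a ∣ b) (hodd : ∀ a ∈ A, Odd a) :
    ∑ a ∈ A, 1 / (a * Real.log a) ≤ ∑ q ∈ Ioc 0 N with Odd q, Λ q / (q * Real.log q ^ 2) := by
  refine le_trans (le_of_eq ?_) (sum_erdosWeight_le (P := Odd)
    (fun n q h ↦ (Nat.odd_mul.1 h).1) hAN hA)
  exact sum_congr rfl fun a ha ↦ by rw [erdosWeight, if_pos (hodd a ha)]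

lemma sum_le_of_two_notMem {A : Finset ℕ} {N : ℕ} (hN : 2 ≤ N) (hAN : A ⊆ Ioc 1 N)
    (hA : ∀ a ∈ A, ∀ b ∈ A, a ≠ b → ¬a ∣ b) (h2 : 2 ∉ A) :
    ∑ a ∈ A, 1 / (a * Real.log a) ≤
      ∑ q ∈ Ioc 0 N, Λ q / (q * Real.log q ^ 2) - 1 / (8 * Real.log 2) := by
  have hw : ∑ a ∈ A, 1 / (a * Real.log a) = ∑ a ∈ A, erdosWeight (fun _ ↦ True) a :=
    sum_congr rfl fun a _ ↦ by rw [erdosWeight, if_pos trivial]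
  have htot := sum_sourceMass_erdosWeight (fun _ ↦ True) N
  rw [filter_true] at htot
  have hmem : 2 ∈ Ioc 1 N := mem_Ioc.2 ⟨one_lt_two, hN⟩
  rw [hw, ← sum_sourceMass_mul_expectedHits hAN, ← htot, ← add_sum_erase _ _ hmem,
    ← add_sum_erase _ _ hmem, expectedHits_eq_zero two_pos, mul_zero, zero_add]
  · have h8 : 1 / (8 * Real.log 2) ≤ sourceMass (erdosWeight fun _ ↦ True) N 2 := by
      have h := inflow_erdosWeight_le (fun _ ↦ True) N le_rfl
      rw [sourceMass, erdosWeight, if_pos trivial]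
      have hlog : 0 < Real.log 2 := Real.log_pos one_lt_two
      have e : 1 / ((2 : ℕ) * Real.log (2 : ℕ)) - 1 / ((2 : ℕ) : ℝ) *
          (Real.log 2 / Real.log (2 * (2 : ℕ)) ^ 2 + 1 / Real.log (2 * (2 : ℕ))) =
          1 / (8 * Real.log 2) := by
        rw [Nat.cast_ofNat, Real.log_mul two_ne_zero two_ne_zero]
        field_simp
        norm_num
      linarith
    have hle : ∑ n ∈ (Ioc 1 N).erase 2, sourceMass (erdosWeight fun _ ↦ True) N n *
        expectedHits A n ≤ ∑ n ∈ (Ioc 1 N).erase 2, sourceMass (erdosWeight fun _ ↦ True) N n := by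
      refine sum_le_sum fun n hn ↦ ?_
      have hn1 := (mem_Ioc.1 (mem_of_mem_erase hn)).1
      exact mul_le_of_le_one_right (sourceMass_erdosWeight_nonneg (fun _ _ h ↦ h) N hn1)
        (expectedHits_le_one hA (by omega))
    linarith
  · intro a ha hdvd
    have h1 := (mem_Ioc.1 (hAN ha)).1
    have h3 := Nat.le_of_dvd two_pos hdvd
    exact h2 (by rwa [show a = 2 by omega] at ha)

lemma sum_log_le {N : ℕ} (hN : 1 ≤ N) :
    ∑ n ∈ Ioc 0 N, Real.log n ≤ N * Real.log N - N + Real.log N + 1 := by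
  induction N, hN using Nat.le_induction with
  | base => simp
  | succ N hN ih =>
    have hN' : (0 : ℝ) < N := by exact_mod_cast hN
    have h : Real.log (N / (N + 1)) ≤ N / (N + 1) - 1 :=
      Real.log_le_sub_one_of_pos (by positivity)
    rw [Real.log_div (by positivity) (by positivity)] at h
    have h' : (N + 1 : ℝ) * (Real.log N - Real.log (N + 1)) ≤ -1 := by
      calc (N + 1 : ℝ) * (Real.log N - Real.log (N + 1))
          ≤ (N + 1) * (N / (N + 1) - 1) := by gcongr
        _ = -1 := by field_simp; ring
    rw [sum_Ioc_succ_top (Nat.zero_le N)]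
    push_cast
    linarith

lemma sum_vonMangoldt_mul_div (N : ℕ) :
    ∑ d ∈ Ioc 0 N, Λ d * (N / d : ℕ) = ∑ n ∈ Ioc 0 N, Real.log n := by
  have h := sum_Ioc_divisorsAntidiagonal (fun d _ ↦ Λ d) N
  simp only [sum_divisorsAntidiagonal_vonMangoldt, sum_const, Nat.card_Ioc, nsmul_eq_mul] at h
  rw [h]
  exact sum_congr rfl fun d _ ↦ by simp [mul_comm]

lemma log_256 : Real.log 256 = 8 * Real.log 2 := by
  rw [show (256 : ℝ) = 2 ^ 8 by norm_num, Real.log_pow]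
  norm_num

/-- A one-sided Mertens estimate. -/
lemma sum_vonMangoldt_div_le {N : ℕ} (hN : 256 ≤ N) :
    ∑ n ∈ Ioc 0 N, Λ n / n ≤ Real.log N + 1.11 := by
  have hNR : (256 : ℝ) ≤ N := by exact_mod_cast hN
  have hN0 : (0 : ℝ) < N := by linarith
  have hpsi := Chebyshev.psi_le (x := N) (by linarith)
  have hmul : N * ∑ n ∈ Ioc 0 N, Λ n / n ≤ ∑ n ∈ Ioc 0 N, Real.log n + Chebyshev.psi N := by
    rw [← sum_vonMangoldt_mul_div, Chebyshev.psi, Nat.floor_natCast, mul_sum, ← sum_add_distrib]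
    refine sum_le_sum fun d hd ↦ ?_
    have hd' : 0 < d := (mem_Ioc.1 hd).1
    have hdR : (0 : ℝ) < d := by exact_mod_cast hd'
    have hq : (N : ℝ) / d ≤ (N / d : ℕ) + 1 := by
      rw [div_le_iff₀ hdR]
      have := Nat.div_add_mod N d
      have := Nat.mod_lt N hd'
      have h : N ≤ (N / d + 1) * d := by nlinarith
      exact_mod_cast h
    calc (N : ℝ) * (Λ d / d) = Λ d * (N / d) := by ring
      _ ≤ Λ d * ((N / d : ℕ) + 1) := by
        gcongr
      _ = _ := by ring
  have hlog := sum_log_le (N := N) (by omega)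
  have hs256 : √(256 : ℝ) = 16 := by
    rw [show (256 : ℝ) = 16 ^ 2 by norm_num, Real.sqrt_sq (by norm_num)]
  have hexp : Real.exp 2 ≤ 256 := by
    rw [show (2 : ℝ) = 1 + 1 by norm_num, Real.exp_add]
    have := Real.exp_one_lt_d9
    have := Real.exp_pos 1
    nlinarith
  have hanti := Real.log_div_sqrt_antitoneOn (a := 256) (b := N) hexp (hexp.trans hNR) hNR
  simp only [log_256, hs256] at hanti
  have hsq : √(N : ℝ) * √(N : ℝ) = N := Real.mul_self_sqrt hN0.le
  have hspos : 0 < √(N : ℝ) := Real.sqrt_pos.2 hN0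
  have h16 : 16 ≤ √(N : ℝ) := by rw [← hs256]; exact Real.sqrt_le_sqrt hNR
  have hlogN : Real.log N ≤ Real.log 2 / 2 * √(N : ℝ) := by
    rw [div_le_iff₀ hspos] at hanti
    linarith
  have hl2 := Real.log_two_lt_d9
  have hl2' := Real.log_two_gt_d9
  have hl4 : Real.log 4 = 2 * Real.log 2 := by
    rw [show (4 : ℝ) = 2 ^ 2 by norm_num, Real.log_pow]; norm_num
  have h1 : √(N : ℝ) * Real.log N ≤ Real.log 2 / 2 * N := by
    calc _ ≤ √(N : ℝ) * (Real.log 2 / 2 * √(N : ℝ)) := by gcongr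
      _ = Real.log 2 / 2 * (√(N : ℝ) * √(N : ℝ)) := by ring
      _ = _ := by rw [hsq]
  have h2 : Real.log N ≤ Real.log 2 / 32 * N := by nlinarith
  rw [hl4] at hpsi
  have : N * ∑ n ∈ Ioc 0 N, Λ n / n ≤ N * (Real.log N + 1.11) := by nlinarith
  exact le_of_mul_le_mul_left this hN0

/-- Abel summation against `1 / log ^ 2`, as a monotone potential. -/
lemma sum_Ioc_div_log_sq_add_le {a : ℕ → ℝ} {c : ℝ} {M N : ℕ} (hM : 2 ≤ M)
    (h : ∀ n, M ≤ n → ∑ k ∈ Ioc 0 n, a k ≤ Real.log n + c) (hMN : M ≤ N) :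
    ∑ n ∈ Ioc M N, a n / Real.log n ^ 2 + (Real.log N + c - ∑ k ∈ Ioc 0 N, a k) / Real.log N ^ 2
      + 1 / Real.log N ≤
    (Real.log M + c - ∑ k ∈ Ioc 0 M, a k) / Real.log M ^ 2 + 1 / Real.log M := by
  induction N, hMN using Nat.le_induction with
  | base => simp
  | succ N hN ih =>
    refine le_trans ?_ ih
    rw [sum_Ioc_succ_top hN, sum_Ioc_succ_top (Nat.zero_le N)]
    have hD := h N hN
    have hl : 0 < Real.log N := Real.log_pos (by exact_mod_cast (by omega : 1 < N))
    have hll : Real.log N ≤ Real.log (N + 1 : ℕ) :=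
      Real.log_le_log (by exact_mod_cast (by omega : 0 < N)) (by exact_mod_cast N.le_succ)
    set l := Real.log N
    set l' := Real.log (N + 1 : ℕ)
    set S := ∑ k ∈ Ioc 0 N, a k
    have hl' : 0 < l' := hl.trans_le hll
    have h1 : (l + c - S) / l' ^ 2 ≤ (l + c - S) / l ^ 2 := by
      have : 0 ≤ l + c - S := by linarith
      gcongr
    have h2 : (l' - l) / l' ^ 2 ≤ 1 / l - 1 / l' := by
      calc (l' - l) / l' ^ 2 ≤ (l' - l) / (l * l') := by
            have : 0 ≤ l' - l := by linarith
            gcongr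
            nlinarith
        _ = 1 / l - 1 / l' := by field_simp
    have h3 : a (N + 1) / l' ^ 2 + (l' + c - (S + a (N + 1))) / l' ^ 2 =
        (l + c - S) / l' ^ 2 + (l' - l) / l' ^ 2 := by ring
    linarith

lemma sum_filter_le_sum_small {P : ℕ → Prop} [DecidablePred P] {N : ℕ} (hN : 256 ≤ N) :
    ∑ q ∈ Ioc 0 N with P q, Λ q / (q * Real.log q ^ 2) ≤
      ∑ q ∈ Ioc 0 256 with P q, (Λ q / (q * Real.log q ^ 2) - Λ q / (q * Real.log 256 ^ 2))
        + 2 / Real.log 256 + 1.11 / Real.log 256 ^ 2 := by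
  have hL : 0 < Real.log 256 := Real.log_pos (by norm_num)
  have habel := sum_Ioc_div_log_sq_add_le (a := fun n ↦ Λ n / n) (c := 1.11) (M := 256)
    (by norm_num) (fun n hn ↦ sum_vonMangoldt_div_le hn) hN
  have hD : 0 ≤ (Real.log N + 1.11 - ∑ k ∈ Ioc 0 N, Λ k / k) / Real.log N ^ 2 :=
    div_nonneg (by linarith [sum_vonMangoldt_div_le hN]) (sq_nonneg _)
  have hlN : 0 ≤ 1 / Real.log N := one_div_nonneg.2 (Real.log_natCast_nonneg N)
  have hS : ∑ q ∈ Ioc 0 256 with P q, Λ q / q ≤ ∑ q ∈ Ioc 0 256, Λ q / q :=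
    sum_le_sum_of_subset_of_nonneg (filter_subset _ _)
      fun _ _ _ ↦ div_nonneg vonMangoldt_nonneg (Nat.cast_nonneg _)
  have hsplit : ∑ q ∈ Ioc 0 N with P q, Λ q / (q * Real.log q ^ 2) ≤
      ∑ q ∈ Ioc 0 256 with P q, Λ q / (q * Real.log q ^ 2)
        + ∑ q ∈ Ioc 256 N, Λ q / q / Real.log q ^ 2 := by
    rw [sum_filter, sum_filter, ← sum_Ioc_consecutive _ (Nat.zero_le 256) hN]
    gcongr with q
    have : 0 ≤ Λ q / (q * Real.log q ^ 2) := by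
      have := vonMangoldt_nonneg (n := q)
      positivity
    rw [div_div]
    split_ifs <;> simp_all
  have hsub : ∑ q ∈ Ioc 0 256 with P q, Λ q / (q * Real.log 256 ^ 2) =
      (∑ q ∈ Ioc 0 256 with P q, Λ q / q) / Real.log 256 ^ 2 := by
    rw [sum_div]
    exact sum_congr rfl fun q _ ↦ by rw [div_div]
  rw [sum_sub_distrib, hsub]
  push_cast at habel
  have hS' := div_le_div_of_nonneg_right hS (sq_nonneg (Real.log 256))
  have hsplitL : (Real.log 256 + 1.11 - ∑ k ∈ Ioc 0 256, Λ k / k) / Real.log 256 ^ 2 =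
      1 / Real.log 256 + 1.11 / Real.log 256 ^ 2
        - (∑ k ∈ Ioc 0 256, Λ k / k) / Real.log 256 ^ 2 := by
    field_simp
  rw [hsplitL] at habel
  have : 2 / Real.log 256 = 1 / Real.log 256 + 1 / Real.log 256 := by ring
  linarith

/-- An upper bound for `Λ n / log n`, found by trial division by the primes of the list. -/
def vonMangoldtRatio (n : ℕ) : List ℕ → ℚ
  | [] => 1
  | p :: ps =>
    if p ∣ n then if p ^ Nat.log p n = n then 1 / Nat.log p n else 0 else vonMangoldtRatio n ps

lemma vonMangoldtRatio_nonneg (n : ℕ) (ps : List ℕ) : 0 ≤ vonMangoldtRatio n ps := by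
  induction ps with
  | nil => simp [vonMangoldtRatio]
  | cons p ps ih =>
    rw [vonMangoldtRatio]
    split_ifs
    · positivity
    · rfl
    · exact ih

lemma vonMangoldt_le_vonMangoldtRatio_mul_log {n : ℕ} (hn : 2 ≤ n) {ps : List ℕ}
    (hps : ∀ p ∈ ps, p.Prime) : Λ n ≤ vonMangoldtRatio n ps * Real.log n := by
  induction ps with
  | nil => simpa [vonMangoldtRatio] using vonMangoldt_le_log
  | cons p ps ih =>
    have hp : p.Prime := hps p List.mem_cons_self
    rw [vonMangoldtRatio]
    split_ifs with hpn hpow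
    · have hk : Nat.log p n ≠ 0 := by
        intro h0
        rw [h0, pow_zero] at hpow
        omega
      have hk' : (Nat.log p n : ℝ) ≠ 0 := by exact_mod_cast hk
      have h1 : Λ n = Real.log p := by
        rw [← hpow, ArithmeticFunction.vonMangoldt_apply_pow hk,
          ArithmeticFunction.vonMangoldt_apply_prime hp]
      have h2 : Real.log n = Nat.log p n * Real.log p := by
        rw [← Real.log_pow]
        exact_mod_cast congrArg (fun m : ℕ ↦ Real.log m) hpow.symm
      rw [h1, h2]
      push_cast
      field_simp
      rfl
    · have : Λ n = 0 := by
        rw [ArithmeticFunction.vonMangoldt_eq_zero_iff]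
        intro hpp
        obtain ⟨q, k, hq, -, rfl⟩ := (isPrimePow_nat_iff n).1 hpp
        obtain rfl := (Nat.prime_dvd_prime_iff_eq hp hq).1 (hp.dvd_of_dvd_pow hpn)
        exact hpow (by rw [Nat.log_pow hp.one_lt])
      simp [this]
    · exact ih fun q hq ↦ hps q (List.mem_cons_of_mem _ hq)

/-- A rational lower bound for the binary logarithm of `n`. -/
def lowerLog (n : ℕ) : ℚ := Nat.log2 (n ^ 50) / 50

lemma lowerLog_mul_log_two_le {n : ℕ} (hn : 0 < n) : lowerLog n * Real.log 2 ≤ Real.log n := by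
  have h : 2 ^ Nat.log2 (n ^ 50) ≤ n ^ 50 := by
    rw [Nat.log2_eq_log_two]
    exact Nat.pow_log_le_self 2 (by positivity)
  have h' : Real.log ((2 : ℝ) ^ Nat.log2 (n ^ 50)) ≤ Real.log ((n : ℝ) ^ 50) :=
    Real.log_le_log (by positivity) (by exact_mod_cast h)
  rw [Real.log_pow, Real.log_pow] at h'
  rw [lowerLog]
  push_cast at h' ⊢
  linarith

lemma one_le_lowerLog {n : ℕ} (hn : 2 ≤ n) : 1 ≤ lowerLog n := by
  have h : 50 ≤ Nat.log2 (n ^ 50) := by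
    rw [Nat.le_log2 (by positivity)]
    exact Nat.pow_le_pow_left hn 50
  rw [lowerLog, le_div_iff₀ (by norm_num)]
  exact_mod_cast (by omega : 1 * 50 ≤ Nat.log2 (n ^ 50))

/-- A rational upper bound for `log 2` times the `n`-th term of `sum_filter_le_sum_small`. -/
def termBound (n : ℕ) : ℚ :=
  vonMangoldtRatio n [2, 3, 5, 7, 11, 13] * (1 / (n * lowerLog n) - lowerLog n / (64 * n))

lemma sub_le_termBound {n : ℕ} (hn : 2 ≤ n) (hn' : n ≤ 256) :
    Λ n / (n * Real.log n ^ 2) - Λ n / (n * Real.log 256 ^ 2) ≤ termBound n / Real.log 2 := by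
  have hb : 0 < Real.log 2 := Real.log_pos (by norm_num)
  have hnR : (0 : ℝ) < n := by exact_mod_cast (by omega : 0 < n)
  have ht : 0 < Real.log n := Real.log_pos (by exact_mod_cast hn)
  have htL : Real.log n ≤ Real.log 256 := Real.log_le_log hnR (by exact_mod_cast hn')
  have hz := lowerLog_mul_log_two_le (n := n) (by omega)
  have hz1 : (1 : ℝ) ≤ lowerLog n := by exact_mod_cast one_le_lowerLog hn
  have hΛ := vonMangoldt_le_vonMangoldtRatio_mul_log (ps := [2, 3, 5, 7, 11, 13]) hn
    (by simp only [List.mem_cons, List.not_mem_nil, or_false, forall_eq_or_imp, forall_eq]; norm_num)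
  have hκ : (0 : ℝ) ≤ vonMangoldtRatio n [2, 3, 5, 7, 11, 13] := by
    exact_mod_cast vonMangoldtRatio_nonneg n _
  rw [termBound]
  push_cast
  set κ : ℝ := (vonMangoldtRatio n [2, 3, 5, 7, 11, 13] : ℝ)
  set z : ℝ := (lowerLog n : ℝ)
  set t := Real.log n
  have hz0 : 0 < z := by linarith
  have hfac : 0 ≤ 1 / (n * t ^ 2) - 1 / (n * Real.log 256 ^ 2) := by
    rw [sub_nonneg]
    gcongr
  calc Λ n / (n * t ^ 2) - Λ n / (n * Real.log 256 ^ 2)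
      = Λ n * (1 / (n * t ^ 2) - 1 / (n * Real.log 256 ^ 2)) := by ring
    _ ≤ κ * t * (1 / (n * t ^ 2) - 1 / (n * Real.log 256 ^ 2)) := by gcongr
    _ = κ * (1 / (n * t) - t / (64 * n * Real.log 2 ^ 2)) := by
      rw [log_256]
      field_simp
      ring
    _ ≤ κ * (1 / (n * (z * Real.log 2)) - z * Real.log 2 / (64 * n * Real.log 2 ^ 2)) := by
      gcongr
    _ = _ := by
      field_simp

lemma sum_filter_le {P : ℕ → Prop} [DecidablePred P] {N : ℕ} (hN : 256 ≤ N) {s : ℚ}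
    (hs0 : 0 ≤ s) (hs : ∑ n ∈ Ioc 1 256 with P n, termBound n ≤ s) :
    ∑ q ∈ Ioc 0 N with P q, Λ q / (q * Real.log q ^ 2) ≤ (s + 1 / 4) / 0.6931 + 0.0362 := by
  have hb := Real.log_two_gt_d9
  have hs' : (∑ n ∈ Ioc 1 256 with P n, termBound n : ℝ) ≤ s := by exact_mod_cast hs
  have hs0' : (0 : ℝ) ≤ s := by exact_mod_cast hs0
  have hsmall : ∑ q ∈ Ioc 0 256 with P q,
      (Λ q / (q * Real.log q ^ 2) - Λ q / (q * Real.log 256 ^ 2)) ≤ s / Real.log 2 := by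
    calc _ ≤ ∑ q ∈ Ioc 1 256 with P q, (termBound q : ℝ) / Real.log 2 := by
          rw [sum_filter, sum_filter, ← sum_Ioc_consecutive _ zero_le_one (by norm_num : 1 ≤ 256)]
          have h1 : Ioc 0 1 = {1} := rfl
          simp only [h1, sum_singleton, ArithmeticFunction.vonMangoldt_apply_one, zero_div,
            sub_zero, ite_self, zero_add]
          refine sum_le_sum fun q hq ↦ ?_
          rw [mem_Ioc] at hq
          split_ifs
          · exact sub_le_termBound hq.1 hq.2
          · rfl
      _ ≤ _ := by
        rw [← sum_div]
        gcongr
  have h := sum_filter_le_sum_small (P := P) hN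
  rw [log_256] at h
  rw [log_256] at hsmall
  have h2 : 2 / (8 * Real.log 2) = (1 / 4) / Real.log 2 := by field_simp; norm_num
  have h3 : 1.11 / (8 * Real.log 2) ^ 2 ≤ 0.0362 := by
    rw [div_le_iff₀ (by positivity)]
    nlinarith
  have h4 : (s + 1 / 4) / Real.log 2 ≤ (s + 1 / 4) / 0.6931 := by
    gcongr
    linarith
  rw [add_div] at h4
  linarith

lemma sum_odd_termBound_le : ∑ n ∈ Ioc 1 256 with Odd n, termBound n ≤ 4439 / 10000 := by
  decide +kernel

lemma sum_termBound_le : ∑ n ∈ Ioc 1 256 with True, termBound n ≤ 10106 / 10000 := by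
  decide +kernel

lemma lt_exp_eulerMascheroniConstant :
    1.76 < Real.exp Real.eulerMascheroniConstant := by
  have h := Real.eulerMascheroniSeq_lt_eulerMascheroniConstant 63
  have hl : Real.log ((63 : ℕ) + 1) = 6 * Real.log 2 := by
    rw [show (((63 : ℕ) : ℝ) + 1) = 2 ^ 6 by norm_num, Real.log_pow]
    norm_num
  have hh : (4.728 : ℝ) ≤ harmonic 63 := by
    have : (4.728 : ℚ) ≤ harmonic 63 := by decide +kernel
    have := (Rat.cast_le (K := ℝ)).2 this
    push_cast at this
    exact this
  rw [Real.eulerMascheroniSeq, hl] at h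
  have hb := Real.log_two_lt_d9
  have hγ : (0.569 : ℝ) ≤ Real.eulerMascheroniConstant := by linarith
  calc (1.76 : ℝ) < ∑ i ∈ range 5, (0.569 : ℝ) ^ i / i.factorial := by
        norm_num [sum_range_succ, Nat.factorial]
    _ ≤ Real.exp 0.569 := Real.sum_le_exp_of_nonneg (by norm_num) 5
    _ ≤ _ := Real.exp_le_exp.2 hγ

lemma sum_le_of_primitive {A : Finset ℕ} (h1 : ∀ a ∈ A, 1 < a)
    (hA : ∀ a ∈ A, ∀ b ∈ A, a ≠ b → ¬a ∣ b) :
    ∑ a ∈ A, 1 / (a * Real.log a) ≤ 1.76 := by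
  have hb := Real.log_two_gt_d9
  have hb' := Real.log_two_lt_d9
  set N := max 256 (A.sup id)
  have hN : 256 ≤ N := le_max_left _ _
  have hAN : A ⊆ Ioc 1 N := fun a ha ↦
    mem_Ioc.2 ⟨h1 a ha, (le_sup (f := id) ha).trans (le_max_right _ _)⟩
  by_cases h2 : 2 ∈ A
  · have hodd := sum_le_of_forall_odd (A := A.erase 2) ((erase_subset _ _).trans hAN)
      (fun a ha b hb ↦ hA a (mem_of_mem_erase ha) b (mem_of_mem_erase hb))
      (fun a ha ↦ by
        rw [← Nat.not_even_iff_odd, even_iff_two_dvd]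
        exact hA 2 h2 a (mem_of_mem_erase ha) (ne_of_mem_erase ha).symm)
    have hbound := sum_filter_le hN (by norm_num) sum_odd_termBound_le
    rw [← add_sum_erase A _ h2]
    have : 1 / (((2 : ℕ) : ℝ) * Real.log (2 : ℕ)) ≤ 0.7215 := by
      push_cast
      rw [div_le_iff₀ (by positivity)]
      linarith
    norm_num at hbound ⊢
    norm_num at this hodd
    linarith
  · have hbound := sum_filter_le hN (by norm_num) sum_termBound_le
    have h := sum_le_of_two_notMem (by omega) hAN hA h2
    rw [filter_true] at hbound
    have : (0.18 : ℝ) ≤ 1 / (8 * Real.log 2) := by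
      rw [le_div_iff₀ (by positivity)]
      linarith
    push_cast at hbound
    linarith

theorem erdos_sum_lt_exp_gamma (A : Set ℕ) (hA : IsPrimitive A) :
    f A < Real.exp Real.eulerMascheroniConstant := by
  refine lt_of_le_of_lt ?_ lt_exp_eulerMascheroniConstant
  refine Real.tsum_le_of_sum_le (fun a ↦ ?_) fun u ↦ ?_
  · have := Real.log_natCast_nonneg (a : ℕ)
    simp only [Pi.zero_apply]
    positivity
  · have hmem : ∀ a ∈ u.map (Function.Embedding.subtype (· ∈ A)), a ∈ A := by
      intro a ha
      obtain ⟨b, -, rfl⟩ := mem_map.1 ha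
      exact b.2
    have h := sum_le_of_primitive (A := u.map (Function.Embedding.subtype (· ∈ A)))
      (fun a ha ↦ hA.1 a (hmem a ha)) fun a ha b hb ↦ hA.2 a (hmem a ha) b (hmem b hb)
    rwa [sum_map] at h
end

section
/- Let A be a primitive set containing no element divisible by 8. Then f(A) < C + 2.37×10^{-7}, where C = ∑_{p prime} 1/(p·log p). -/
open scoped BigOperators

/-- `C = ∑_{p prime} 1/(p log p)`. -/
noncomputable def C : ℝ :=
  ∑' p : {p : ℕ // p.Prime}, 1 / ((p : ℕ) * Real.log (p : ℕ))

section

open ArithmeticFunction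

theorem sum_range_mul_le_of_partial_sums_le {a b g : ℕ → ℝ} (hg : Antitone g) (n : ℕ)
    (hg0 : 0 ≤ g n)
    (h : ∀ k ≤ n, ∑ i ∈ Finset.range k, a i ≤ ∑ i ∈ Finset.range k, b i) :
    ∑ i ∈ Finset.range n, a i * g i ≤ ∑ i ∈ Finset.range n, b i * g i := by
  have key : ∀ k ≤ n, (∑ i ∈ Finset.range k, b i - ∑ i ∈ Finset.range k, a i) * g k ≤
      ∑ i ∈ Finset.range k, b i * g i - ∑ i ∈ Finset.range k, a i * g i := by
    intro k
    induction k with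
    | zero => simp
    | succ k ih =>
      intro hk
      have h1 := ih (by omega)
      have h2 := h (k + 1) hk
      have h3 := mul_le_mul_of_nonneg_left (hg (Nat.le_succ k)) (sub_nonneg.2 h2)
      simp only [Finset.sum_range_succ] at h2 h3 ⊢
      nlinarith
  have h1 := key n le_rfl
  have h2 := mul_nonneg (sub_nonneg.2 (h n le_rfl)) hg0
  linarith

/-- The mass that the downward chain `n ↦ n / d` (chosen with probability `Λ d / log n`), started
from the weight `w` on `B`, deposits at `m`; only multiples of `m` up to `N` are followed. -/
noncomputable def chainMass (w : ℕ → ℝ) (B : Finset ℕ) (N m : ℕ) : ℝ :=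
  if m ∈ B then w m else
    ∑ d ∈ Finset.Icc 2 N, if _h : 0 < m ∧ 2 ≤ d ∧ m * d ≤ N then
      Λ d / Real.log ((m * d : ℕ) : ℝ) * chainMass w B N (m * d) else 0
termination_by N + 1 - m
decreasing_by
  have : m * 2 ≤ m * d := Nat.mul_le_mul_left _ _h.2.1
  omega

theorem chainMass_eq_zero {w : ℕ → ℝ} {B : Finset ℕ} {N : ℕ} (m : ℕ)
    (hm : ∀ b ∈ B, ¬ m ∣ b) : chainMass w B N m = 0 := by
  induction m using chainMass.induct B N with
  | case1 m hmB => exact absurd dvd_rfl (hm m hmB)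
  | case2 m hmB ih =>
    rw [chainMass, if_neg hmB]
    refine Finset.sum_eq_zero fun d _ => ?_
    split_ifs with h
    · rw [ih d h fun b hb hd => hm b hb (dvd_of_mul_right_dvd hd), mul_zero]
    · rfl

theorem chainMass_le {w : ℕ → ℝ} (hw : ∀ m, 0 ≤ w m) {S : Set ℕ} {N : ℕ}
    (hout : ∀ m ∈ S, 0 < m → ∀ F ⊆ Finset.Icc 2 N, (∀ d ∈ F, m * d ∈ S) →
      ∑ d ∈ F, Λ d / Real.log ((m * d : ℕ) : ℝ) * w (m * d) ≤ w m)
    {B : Finset ℕ} (hS : ∀ m, ∀ b ∈ B, m ∣ b → m ∈ S) (m : ℕ) :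
    chainMass w B N m ≤ w m := by
  classical
  induction m using chainMass.induct B N with
  | case1 m hmB => rw [chainMass, if_pos hmB]
  | case2 m hmB ih =>
    by_cases hm : ∀ b ∈ B, ¬ m ∣ b
    · rw [chainMass_eq_zero m hm]; exact hw m
    push Not at hm
    obtain ⟨b, hb, hmb⟩ := hm
    rw [chainMass, if_neg hmB]
    rcases Nat.eq_zero_or_pos m with rfl | hm0
    · simpa using hw 0
    refine le_trans ?_ (hout m (hS m b hb hmb) hm0
      {d ∈ Finset.Icc 2 N | m * d ∈ S} (Finset.filter_subset _ _)
      (fun d hd => (Finset.mem_filter.1 hd).2))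
    rw [Finset.sum_filter]
    refine Finset.sum_le_sum fun d _ => ?_
    have hc : 0 ≤ Λ d / Real.log ((m * d : ℕ) : ℝ) :=
      div_nonneg vonMangoldt_nonneg (Real.log_natCast_nonneg _)
    split_ifs with h h1 h1
    · exact mul_le_mul_of_nonneg_left (ih d h) hc
    · rw [chainMass_eq_zero (m * d) fun b hb hd => h1 (hS _ b hb hd), mul_zero]
    · exact mul_nonneg hc (hw _)
    · exact le_rfl

theorem sum_Icc_chainMass (w : ℕ → ℝ) (B : Finset ℕ) (N : ℕ) :
    ∑ n ∈ Finset.Icc 2 N, chainMass w B N n =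
      ∑ m ∈ Finset.Icc 1 N, ∑ d ∈ Finset.Icc 2 N, if 0 < m ∧ 2 ≤ d ∧ m * d ≤ N then
      Λ d / Real.log ((m * d : ℕ) : ℝ) * chainMass w B N (m * d) else 0 := by
  have h1 : ∀ n ∈ Finset.Icc 2 N, chainMass w B N n =
      ∑ x ∈ n.divisorsAntidiagonal, Λ x.2 / Real.log ((x.1 * x.2 : ℕ) : ℝ) *
        chainMass w B N (x.1 * x.2) := by
    intro n hn
    have hn2 := (Finset.mem_Icc.1 hn).1
    have hlog : Real.log n ≠ 0 := (Real.log_pos (by exact_mod_cast hn2)).ne'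
    rw [Finset.sum_congr rfl (g := fun x => Λ x.2 * (chainMass w B N n / Real.log n)),
      ← Finset.sum_mul, Nat.sum_divisorsAntidiagonal' (f := fun _ j => Λ j), vonMangoldt_sum]
    swap
    · intro x hx
      rw [(Nat.mem_divisorsAntidiagonal.1 hx).1]; ring
    field_simp
  rw [Finset.sum_congr rfl h1, Finset.sum_sigma', ← Finset.sum_product', ← Finset.sum_filter]
  symm
  refine Finset.sum_bij_ne_zero (fun x _ _ => ⟨x.1 * x.2, x⟩) ?_ ?_ ?_ ?_
  · rintro ⟨m, d⟩ hx _
    simp only [Finset.mem_filter, Finset.mem_product, Finset.mem_Icc] at hx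
    simp only [Finset.mem_sigma, Finset.mem_Icc, Nat.mem_divisorsAntidiagonal]
    obtain ⟨-, h1, h2, h3⟩ := hx
    refine ⟨⟨by nlinarith, h3⟩, trivial, by positivity⟩
  · rintro x _ _ y _ _ h
    simpa using (Sigma.mk.inj_iff.1 h).2
  · rintro ⟨n, m, d⟩ hx hne
    simp only [Finset.mem_sigma, Finset.mem_Icc, Nat.mem_divisorsAntidiagonal] at hx
    obtain ⟨⟨h1, h2⟩, rfl, h3⟩ := hx
    have hd : 2 ≤ d := by
      rcases d with _ | _ | d
      · simp at h3
      · simp at hne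
      · omega
    have hm : 0 < m := Nat.pos_of_ne_zero (by rintro rfl; simp at h3)
    refine ⟨(m, d), ?_, hne, rfl⟩
    simp only [Finset.mem_filter, Finset.mem_product, Finset.mem_Icc]
    exact ⟨⟨⟨hm, by nlinarith⟩, hd, by nlinarith⟩, hm, hd, h2⟩
  · intro x _ _; rfl

theorem sum_le_of_chain_superharmonic {w : ℕ → ℝ} (hw : ∀ m, 0 ≤ w m) {S : Set ℕ}
    (hout : ∀ m ∈ S, 0 < m → ∀ N, ∀ F ⊆ Finset.Icc 2 N, (∀ d ∈ F, m * d ∈ S) →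
      ∑ d ∈ F, Λ d / Real.log ((m * d : ℕ) : ℝ) * w (m * d) ≤ w m)
    {B : Finset ℕ} (hS : ∀ m, ∀ b ∈ B, m ∣ b → m ∈ S) (hB0 : ∀ b ∈ B, 0 < b)
    (hB : ∀ a ∈ B, ∀ b ∈ B, a ≠ b → ¬ a ∣ b) : ∑ b ∈ B, w b ≤ w 1 := by
  classical
  set N := B.sup id + 1 with hN
  have hBN : B ⊆ Finset.Icc 1 N := fun b hb =>
    Finset.mem_Icc.2 ⟨hB0 b hb, (Finset.le_sup (f := id) hb).trans (Nat.le_succ _)⟩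
  have h1 := sum_Icc_chainMass w B N
  have h2 : ∀ m ∈ Finset.Icc 1 N, (∑ d ∈ Finset.Icc 2 N, if 0 < m ∧ 2 ≤ d ∧ m * d ≤ N then
      Λ d / Real.log ((m * d : ℕ) : ℝ) * chainMass w B N (m * d) else 0) =
      chainMass w B N m - if m ∈ B then w m else 0 := by
    intro m hm
    by_cases hmB : m ∈ B
    · rw [chainMass, if_pos hmB, if_pos hmB, sub_self]
      refine Finset.sum_eq_zero fun d _ => ?_
      split_ifs with h
      · rw [chainMass_eq_zero, mul_zero]
        intro b hb hd
        refine hB m hmB b hb ?_ (dvd_of_mul_right_dvd hd)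
        rintro rfl
        have := Nat.le_of_dvd h.1 hd
        nlinarith
      · rfl
    · conv_rhs => rw [chainMass, if_neg hmB]
      simp [hmB]
  rw [Finset.sum_congr rfl h2, Finset.sum_sub_distrib, Finset.sum_ite_mem,
    Finset.inter_eq_right.2 hBN, ← Finset.add_sum_Ioc_eq_sum_Icc (by omega : 1 ≤ N)] at h1
  have h3 : Finset.Ioc 1 N = Finset.Icc 2 N := by ext; simp; omega
  rw [h3] at h1
  have h4 := chainMass_le hw (fun m hm h0 => hout m hm h0 N) hS 1
  linarith

theorem log_one_add_add_le {x : ℝ} (hx : 0 ≤ x) :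
    Real.log (1 + x) + x ^ 2 / (2 * (1 + x)) ≤ x := by
  have h1 : 0 < 1 + x := by linarith
  have h2 := Real.self_le_sinh_iff.2 (Real.log_nonneg (by linarith : (1 : ℝ) ≤ 1 + x))
  rw [Real.sinh_log h1] at h2
  have h3 : (1 + x - (1 + x)⁻¹) / 2 + x ^ 2 / (2 * (1 + x)) = x := by
    field_simp; ring
  linarith

theorem sub_div_le_log_div {Q z₁ z₂ : ℝ} (hQ : 0 < Q) (h₁ : 0 < z₁) (h : z₁ ≤ z₂) :
    (z₂ - z₁) / ((Q + z₂) * z₂) ≤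
      (Real.log ((Q + z₁) / z₁) - Real.log ((Q + z₂) / z₂)) / Q := by
  have h₂ : 0 < z₂ := h₁.trans_le h
  have h3 := Real.one_sub_inv_le_log_of_pos
    (show 0 < (Q + z₁) / z₁ / ((Q + z₂) / z₂) by positivity)
  rw [Real.log_div (by positivity) (by positivity)] at h3
  have h4 : (z₂ - z₁) / ((Q + z₂) * z₂) ≤ (z₂ - z₁) / ((Q + z₁) * z₂) := by
    have := sub_nonneg.2 h
    gcongr
  have h5 : (z₂ - z₁) / ((Q + z₁) * z₂) = (1 - ((Q + z₁) / z₁ / ((Q + z₂) / z₂))⁻¹) / Q := by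
    field_simp; ring
  rw [h5] at h4
  exact h4.trans (by gcongr)

theorem sum_mul_div_log_le {q : ℕ} (hq : 2 ≤ q) {a : ℕ → ℝ} (ha : ∀ d < q, a d = 0)
    (hS : ∀ X ≥ q, ∑ d ∈ Finset.range (X + 1), a d ≤ Real.log X - Real.log q / 2)
    {u : ℝ} (hu : 0 ≤ u) (N : ℕ) :
    ∑ d ∈ Finset.range N, a d * (1 / ((Real.log q + u + Real.log d) * (u + Real.log d))) ≤
      1 / (Real.log q + u) := by
  have hQ : 0 < Real.log q := Real.log_pos (by exact_mod_cast hq)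
  set Q := Real.log q with hQdef
  rcases le_total N q with hN | hN
  · rw [Finset.sum_eq_zero fun d hd => by
      rw [ha d ((Finset.mem_range.1 hd).trans_le hN), zero_mul]]
    positivity
  obtain ⟨n, rfl⟩ := Nat.exists_eq_add_of_le hN
  rw [Finset.sum_range_add, Finset.sum_eq_zero fun d hd => by
      rw [ha d (Finset.mem_range.1 hd), zero_mul], zero_add]
  have hlog : ∀ i, Q ≤ Real.log ((q + i : ℕ) : ℝ) := fun i =>
    Real.log_le_log (by positivity) (by push_cast; linarith [Nat.cast_nonneg (α := ℝ) i])
  have hmono : ∀ i j, i ≤ j → Real.log ((q + i : ℕ) : ℝ) ≤ Real.log ((q + j : ℕ) : ℝ) :=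
    fun i j hij => Real.log_le_log (by positivity) (by exact_mod_cast by omega)
  set g : ℕ → ℝ := fun i =>
    1 / ((Q + u + Real.log ((q + i : ℕ) : ℝ)) * (u + Real.log ((q + i : ℕ) : ℝ))) with hg
  set t : ℕ → ℝ := fun i => if i = 0 then Q / 2 else Real.log ((q + i - 1 : ℕ) : ℝ) with ht
  have hg_anti : Antitone g := by
    intro i j hij
    have := hmono i j hij
    have := hlog i
    have : 0 < (Q + u + Real.log ((q + i : ℕ) : ℝ)) * (u + Real.log ((q + i : ℕ) : ℝ)) := by
      apply mul_pos <;> linarith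
    simp only [hg]
    gcongr
  have hg0 : ∀ i, 0 ≤ g i := fun i => by
    have := hlog i
    simp only [hg]
    positivity
  have h1 := sum_range_mul_le_of_partial_sums_le (a := fun i => a (q + i))
    (b := fun i => Real.log ((q + i : ℕ) : ℝ) - t i) hg_anti n (hg0 n) (by
      intro k _
      have h2 : ∀ k, ∑ i ∈ Finset.range (k + 1), (Real.log ((q + i : ℕ) : ℝ) - t i) =
          Real.log ((q + k : ℕ) : ℝ) - Q / 2 := by
        intro k
        induction k with
        | zero => simp [ht]
        | succ k ih => rw [Finset.sum_range_succ, ih]; simp [ht, ← add_assoc]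
      rcases k with _ | k
      · simp
      · rw [h2]
        have h3 := hS (q + k) (by omega)
        rwa [add_assoc, Finset.sum_range_add, Finset.sum_eq_zero fun d hd =>
          ha d (Finset.mem_range.1 hd), zero_add] at h3)
  refine h1.trans ?_
  have h4 : ∀ n, ∑ i ∈ Finset.range (n + 1), (Real.log ((q + i : ℕ) : ℝ) - t i) * g i ≤
      Q / 2 / ((Q + u + Q) * (u + Q)) + (Real.log ((Q + (u + Q)) / (u + Q)) -
        Real.log ((Q + (u + Real.log ((q + n : ℕ) : ℝ))) /
          (u + Real.log ((q + n : ℕ) : ℝ)))) / Q := by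
    intro n
    induction n with
    | zero =>
      simp only [zero_add, Finset.sum_range_one, ht, hg, if_true, add_zero, ← hQdef, sub_self,
        zero_div]
      apply le_of_eq; ring
    | succ n ih =>
      rw [Finset.sum_range_succ]
      have h5 := sub_div_le_log_div hQ (by linarith [hlog n] :
        0 < u + Real.log ((q + n : ℕ) : ℝ)) (by linarith [hmono n (n + 1) (by omega)] :
          u + Real.log ((q + n : ℕ) : ℝ) ≤ u + Real.log ((q + (n + 1) : ℕ) : ℝ))
      have h6 : (Real.log ((q + (n + 1) : ℕ) : ℝ) - t (n + 1)) * g (n + 1) =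
          (u + Real.log ((q + (n + 1) : ℕ) : ℝ) - (u + Real.log ((q + n : ℕ) : ℝ))) /
          ((Q + (u + Real.log ((q + (n + 1) : ℕ) : ℝ))) *
            (u + Real.log ((q + (n + 1) : ℕ) : ℝ))) := by
        simp only [ht, hg, if_neg (Nat.succ_ne_zero n), ← add_assoc, Nat.add_sub_cancel]
        ring
      rw [h6]
      have h7 := add_le_add ih h5
      refine h7.trans (le_of_eq ?_)
      ring
  have h8 : Q / 2 / ((Q + u + Q) * (u + Q)) + Real.log ((Q + (u + Q)) / (u + Q)) / Q ≤
      1 / (Q + u) := by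
    have h9 := log_one_add_add_le (x := Q / (u + Q)) (by positivity)
    have h10 : (Q + (u + Q)) / (u + Q) = 1 + Q / (u + Q) := by field_simp; ring
    have h11 : Q / 2 / ((Q + u + Q) * (u + Q)) =
        (Q / (u + Q)) ^ 2 / (2 * (1 + Q / (u + Q))) / Q := by
      field_simp
      ring
    rw [h10, h11, ← add_div, div_le_iff₀ hQ]
    have h12 : 1 / (Q + u) * Q = Q / (u + Q) := by field_simp; ring
    rw [h12]
    linarith
  rcases n with _ | n
  · simp only [Finset.range_zero, Finset.sum_empty]
    positivity
  · refine (h4 n).trans (le_trans ?_ h8)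
    have h9 : 0 ≤ Real.log ((Q + (u + Real.log ((q + n : ℕ) : ℝ))) /
        (u + Real.log ((q + n : ℕ) : ℝ))) := by
      have := hlog n
      apply Real.log_nonneg
      rw [le_div_iff₀ (by linarith)]
      linarith
    gcongr
    linarith

theorem log_factorial_eq_sum_vonMangoldt (N : ℕ) :
    Real.log (N.factorial : ℝ) = ∑ d ∈ Finset.range (N + 1), Λ d * ((N / d : ℕ) : ℝ) := by
  have h := sum_Ioc_mul_zeta_eq_sum (vonMangoldt : ArithmeticFunction ℝ) N
  rw [vonMangoldt_mul_zeta] at h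
  have h1 : ∑ n ∈ Finset.Ioc 0 N, ArithmeticFunction.log n = Real.log (N.factorial : ℝ) := by
    induction N with
    | zero => simp
    | succ N ih =>
      have h2 := sum_Ioc_mul_zeta_eq_sum (vonMangoldt : ArithmeticFunction ℝ) N
      rw [vonMangoldt_mul_zeta] at h2
      rw [Finset.sum_Ioc_succ_top (Nat.zero_le N), ih h2, Nat.factorial_succ, Nat.cast_mul,
        Real.log_mul (by positivity) (by positivity), log_apply, add_comm]
  rw [← h1, h]
  refine Finset.sum_subset ?_ ?_
  · intro x; simp
  · intro x hx hx'
    have : x = 0 := by simp at hx hx'; omega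
    simp [this]

theorem log_factorial_le {N : ℕ} (hN : 0 < N) :
    Real.log (N.factorial : ℝ) ≤ N * Real.log N - N + Real.log N + 1 := by
  induction N, hN using Nat.le_induction with
  | base => simp
  | succ n hn ih =>
    have hn0 : (0 : ℝ) < n := by exact_mod_cast hn
    rw [Nat.factorial_succ, Nat.cast_mul, Real.log_mul (by positivity) (by positivity)]
    push_cast
    have h1 := Real.one_sub_inv_le_log_of_pos (show (0 : ℝ) < (n + 1) / n by positivity)
    rw [Real.log_div (by positivity) (by positivity)] at h1
    have h2 : 1 - (((n : ℝ) + 1) / n)⁻¹ = 1 / (n + 1) := by field_simp; ring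
    rw [h2, div_le_iff₀ (by positivity)] at h1
    nlinarith

theorem le_log_factorial (N : ℕ) : N * Real.log N - N ≤ Real.log (N.factorial : ℝ) := by
  induction N with
  | zero => simp
  | succ n ih =>
    rw [Nat.factorial_succ, Nat.cast_mul, Real.log_mul (by positivity) (by positivity)]
    push_cast
    rcases Nat.eq_zero_or_pos n with rfl | hn
    · simp
    have hn0 : (0 : ℝ) < n := by exact_mod_cast hn
    have h1 := Real.log_le_sub_one_of_pos (show (0 : ℝ) < (n + 1) / n by positivity)
    rw [Real.log_div (by positivity) (by positivity)] at h1
    have h2 : ((n : ℝ) + 1) / n - 1 = 1 / n := by field_simp; ring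
    rw [h2, le_div_iff₀ hn0] at h1
    nlinarith

/-- The von Mangoldt function restricted to odd arguments. -/
noncomputable def oddVonMangoldt (d : ℕ) : ℝ := if Even d then 0 else Λ d

theorem oddVonMangoldt_nonneg (d : ℕ) : 0 ≤ oddVonMangoldt d := by
  unfold oddVonMangoldt
  split_ifs
  · exact le_rfl
  · exact vonMangoldt_nonneg

theorem oddVonMangoldt_le (d : ℕ) : oddVonMangoldt d ≤ Λ d := by
  unfold oddVonMangoldt
  split_ifs
  · exact vonMangoldt_nonneg
  · exact le_rfl

theorem oddVonMangoldt_of_even {d : ℕ} (h : Even d) : oddVonMangoldt d = 0 := if_pos h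

theorem exists_two_pow_of_even {d : ℕ} (hd : Even d) (h : Λ d ≠ 0) : ∃ k, 0 < k ∧ 2 ^ k = d := by
  obtain ⟨p, k, hp, hk, rfl⟩ := (isPrimePow_nat_iff d).1 (vonMangoldt_ne_zero_iff.1 h)
  have : 2 ∣ p := Nat.prime_two.dvd_of_dvd_pow hd.two_dvd
  rw [← (Nat.prime_dvd_prime_iff_eq Nat.prime_two hp).1 this]
  exact ⟨k, hk, rfl⟩

theorem sum_vonMangoldt_sub_oddVonMangoldt (N : ℕ) (g : ℕ → ℝ) :
    ∑ d ∈ Finset.range (N + 1), Λ d * g d = ∑ d ∈ Finset.range (N + 1), oddVonMangoldt d * g d +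
      Real.log 2 * ∑ k ∈ Finset.Icc 1 (Nat.log 2 N), g (2 ^ k) := by
  rcases Nat.eq_zero_or_pos N with rfl | hN
  · simp [oddVonMangoldt]
  rw [← sub_eq_iff_eq_add', ← Finset.sum_sub_distrib, Finset.mul_sum]
  symm
  refine Finset.sum_bij_ne_zero (fun k _ _ => 2 ^ k) ?_ ?_ ?_ ?_
  · intro k hk _
    rw [Finset.mem_Icc] at hk
    exact Finset.mem_range_succ_iff.2 (Nat.pow_le_of_le_log hN.ne' hk.2)
  · intro k _ _ l _ _ h
    exact Nat.pow_right_injective le_rfl h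
  · intro d hd hne
    have hev : Even d := by
      by_contra h
      exact hne (by simp [oddVonMangoldt, h])
    have hΛ : Λ d ≠ 0 := by
      intro h
      exact hne (by simp [oddVonMangoldt, hev, h])
    obtain ⟨k, hk, rfl⟩ := exists_two_pow_of_even hev hΛ
    have hkN : k ≤ Nat.log 2 N :=
      Nat.le_log_of_pow_le (by norm_num) (Finset.mem_range_succ_iff.1 hd)
    refine ⟨k, Finset.mem_Icc.2 ⟨hk, hkN⟩, ?_, rfl⟩
    rw [oddVonMangoldt_of_even hev, zero_mul, sub_zero, vonMangoldt_apply_pow hk.ne',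
      vonMangoldt_apply_prime Nat.prime_two] at hne
    simpa using hne
  · intro k hk _
    have hk0 : k ≠ 0 := by have := (Finset.mem_Icc.1 hk).1; omega
    rw [oddVonMangoldt_of_even ((even_two).pow_of_ne_zero hk0), vonMangoldt_apply_pow hk0,
      vonMangoldt_apply_prime Nat.prime_two]
    simp

theorem sum_Icc_inv_two_pow (K : ℕ) :
    ∑ k ∈ Finset.Icc 1 K, (1 / 2 : ℝ) ^ k = 1 - (1 / 2) ^ K := by
  induction K with
  | zero => simp
  | succ K ih => rw [Finset.sum_Icc_succ_top (by omega), ih]; ring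

theorem sum_oddVonMangoldt_mul_div_le {N : ℕ} (hN : 0 < N) :
    ∑ d ∈ Finset.range (N + 1), oddVonMangoldt d * ((N / d : ℕ) : ℝ) ≤
      N * Real.log N - N - N * Real.log 2 + 2 * Real.log N + 1 + 2 * Real.log 2 := by
  have h1 := sum_vonMangoldt_sub_oddVonMangoldt N (fun d => ((N / d : ℕ) : ℝ))
  rw [← log_factorial_eq_sum_vonMangoldt] at h1
  have h2 := log_factorial_le hN
  set K := Nat.log 2 N with hK
  have hlog2 : 0 < Real.log 2 := Real.log_pos (by norm_num)
  have h3 : (N : ℝ) - 2 - K ≤ ∑ k ∈ Finset.Icc 1 K, ((N / 2 ^ k : ℕ) : ℝ) := by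
    have h4 : ∀ k ∈ Finset.Icc 1 K, (N : ℝ) * (1 / 2) ^ k - 1 ≤ ((N / 2 ^ k : ℕ) : ℝ) := by
      intro k _
      have := Nat.lt_div_mul_add (a := N) (b := 2 ^ k) (by positivity)
      have h5 : (N : ℝ) < ((N / 2 ^ k : ℕ) : ℝ) * 2 ^ k + 2 ^ k := by exact_mod_cast this
      rw [one_div, inv_pow, ← div_eq_mul_inv, sub_le_iff_le_add, div_le_iff₀ (by positivity)]
      linarith
    have h5 := Finset.sum_le_sum h4
    rw [Finset.sum_sub_distrib, ← Finset.mul_sum, sum_Icc_inv_two_pow] at h5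
    have h6 : (N : ℝ) < 2 * 2 ^ K := by
      have := Nat.lt_pow_succ_log_self (b := 2) (by norm_num) N
      rw [pow_succ'] at this
      exact_mod_cast this
    have h7 : (N : ℝ) * (1 / 2) ^ K ≤ 2 := by
      rw [one_div, inv_pow, ← div_eq_mul_inv, div_le_iff₀ (by positivity)]
      exact h6.le
    simp only [Finset.sum_const, Nat.card_Icc, Nat.add_sub_cancel, nsmul_eq_mul, mul_one] at h5
    linarith
  have h8 : K * Real.log 2 ≤ Real.log N := by
    rw [← Real.log_pow]
    exact Real.log_le_log (by positivity) (by exact_mod_cast Nat.pow_log_le_self 2 hN.ne')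
  nlinarith

theorem sum_oddVonMangoldt_div_ge {N : ℕ} (hN : 0 < N) :
    Real.log N - 1 - Real.log 2 ≤ ∑ d ∈ Finset.range (N + 1), oddVonMangoldt d / d := by
  have hN0 : (0 : ℝ) < N := by exact_mod_cast hN
  have h1 := sum_vonMangoldt_sub_oddVonMangoldt N (fun d => (N : ℝ) / d)
  have h2 := le_log_factorial N
  rw [log_factorial_eq_sum_vonMangoldt] at h2
  have h3 : ∑ d ∈ Finset.range (N + 1), Λ d * ((N / d : ℕ) : ℝ) ≤
      ∑ d ∈ Finset.range (N + 1), Λ d * ((N : ℝ) / d) :=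
    Finset.sum_le_sum fun d _ => mul_le_mul_of_nonneg_left Nat.cast_div_le vonMangoldt_nonneg
  have h4 : ∑ k ∈ Finset.Icc 1 (Nat.log 2 N), (N : ℝ) / ((2 ^ k : ℕ) : ℝ) ≤ N := by
    have : ∀ k ∈ Finset.Icc 1 (Nat.log 2 N), (N : ℝ) / ((2 ^ k : ℕ) : ℝ) = N * (1 / 2) ^ k := by
      intro k _
      push_cast
      rw [one_div, inv_pow, ← div_eq_mul_inv]
    rw [Finset.sum_congr rfl this, ← Finset.mul_sum, sum_Icc_inv_two_pow]
    have : (0 : ℝ) ≤ (1 / 2) ^ (Nat.log 2 N) := by positivity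
    nlinarith
  have h5 : ∑ d ∈ Finset.range (N + 1), oddVonMangoldt d * ((N : ℝ) / d) =
      N * ∑ d ∈ Finset.range (N + 1), oddVonMangoldt d / d := by
    rw [Finset.mul_sum]
    exact Finset.sum_congr rfl fun d _ => by ring
  rw [h5] at h1
  have h6 := mul_le_mul_of_nonneg_left h4 (Real.log_nonneg (by norm_num : (1 : ℝ) ≤ 2))
  have h7 : N * (Real.log N - 1 - Real.log 2) ≤
      N * ∑ d ∈ Finset.range (N + 1), oddVonMangoldt d / d := by linarith
  exact le_of_mul_le_mul_left h7 hN0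

theorem factorial_mul_le (n : ℕ) :
    (6 * n).factorial * n.factorial ≤
      108 ^ n * ((3 * n).factorial * (2 * n).factorial ^ 2) := by
  induction n with
  | zero => simp
  | succ n ih =>
    have e6 : (6 * (n + 1)).factorial = (6 * n + 6) * ((6 * n + 5) * ((6 * n + 4) *
        ((6 * n + 3) * ((6 * n + 2) * ((6 * n + 1) * (6 * n).factorial))))) := by
      rw [show 6 * (n + 1) = 6 * n + 5 + 1 by ring]; simp only [Nat.factorial_succ]
    have e3 : (3 * (n + 1)).factorial =
        (3 * n + 3) * ((3 * n + 2) * ((3 * n + 1) * (3 * n).factorial)) := by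
      rw [show 3 * (n + 1) = 3 * n + 2 + 1 by ring]; simp only [Nat.factorial_succ]
    have e2 : (2 * (n + 1)).factorial = (2 * n + 2) * ((2 * n + 1) * (2 * n).factorial) := by
      rw [show 2 * (n + 1) = 2 * n + 1 + 1 by ring]; simp only [Nat.factorial_succ]
    have h : 24 * ((6 * n + 5) * (6 * n + 1)) ≤ 432 * ((n + 1) * (2 * n + 1)) := by nlinarith
    rw [e6, e3, e2, Nat.factorial_succ]
    calc _ = ((3 * n + 3) * (3 * n + 2) * (3 * n + 1) * (n + 1) * (2 * n + 1)) *
          (24 * ((6 * n + 5) * (6 * n + 1))) * ((6 * n).factorial * n.factorial) := by ring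
      _ ≤ ((3 * n + 3) * (3 * n + 2) * (3 * n + 1) * (n + 1) * (2 * n + 1)) *
          (432 * ((n + 1) * (2 * n + 1))) *
          (108 ^ n * ((3 * n).factorial * (2 * n).factorial ^ 2)) := by gcongr
      _ = _ := by ring

theorem sum_Ioc_vonMangoldt_le (n : ℕ) :
    ∑ d ∈ Finset.Ioc (2 * n) (6 * n), Λ d ≤ n * Real.log 108 := by
  have key : Real.log ((6 * n).factorial : ℝ) + Real.log (n.factorial : ℝ) ≤
      n * Real.log 108 +
        (Real.log ((3 * n).factorial : ℝ) + 2 * Real.log ((2 * n).factorial : ℝ)) := by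
    have h := Real.log_le_log (by positivity) (Nat.cast_le (α := ℝ).2 (factorial_mul_le n))
    push_cast at h
    rwa [Real.log_mul (by positivity) (by positivity), Real.log_mul (by positivity) (by positivity),
      Real.log_mul (by positivity) (by positivity), Real.log_pow, Real.log_pow] at h
  have ext : ∀ m ≤ 6 * n, Real.log (m.factorial : ℝ) =
      ∑ d ∈ Finset.range (6 * n + 1), Λ d * ((m / d : ℕ) : ℝ) := by
    intro m hm
    rw [log_factorial_eq_sum_vonMangoldt]
    refine Finset.sum_subset (Finset.range_mono (by omega)) fun d _ hd => ?_
    rw [Nat.div_eq_of_lt (by simpa using hd), Nat.cast_zero, mul_zero]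
  rw [ext _ le_rfl, ext n (by omega), ext (3 * n) (by omega), ext (2 * n) (by omega),
    Finset.mul_sum, ← Finset.sum_add_distrib, ← Finset.sum_add_distrib] at key
  have h1 : ∑ d ∈ Finset.Ioc (2 * n) (6 * n), Λ d ≤ ∑ d ∈ Finset.range (6 * n + 1),
      Λ d * (((6 * n / d : ℕ) : ℝ) + ((n / d : ℕ) : ℝ) - ((3 * n / d : ℕ) : ℝ) -
        2 * ((2 * n / d : ℕ) : ℝ)) := by
    rw [← Finset.inter_eq_right.2 (show Finset.Ioc (2 * n) (6 * n) ⊆ Finset.range (6 * n + 1) from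
      fun x => by simp only [Finset.mem_Ioc, Finset.mem_range]; omega), ← Finset.sum_ite_mem]
    refine Finset.sum_le_sum fun d _ => ?_
    rcases Nat.eq_zero_or_pos d with rfl | hd
    · simp
    have e1 : n / d = 6 * n / d / 6 := by
      rw [Nat.div_div_eq_div_mul, mul_comm d, Nat.mul_div_mul_left _ _ (by norm_num)]
    have e2 : 2 * n / d = 6 * n / d / 3 := by
      rw [Nat.div_div_eq_div_mul, mul_comm d, show 6 * n = 3 * (2 * n) by ring,
        Nat.mul_div_mul_left _ _ (by norm_num)]
    have e3 : 3 * n / d = 6 * n / d / 2 := by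
      rw [Nat.div_div_eq_div_mul, mul_comm d, show 6 * n = 2 * (3 * n) by ring,
        Nat.mul_div_mul_left _ _ (by norm_num)]
    rw [e1, e2, e3]
    set y := 6 * n / d with hy
    have hnn : y / 2 + 2 * (y / 3) ≤ y + y / 6 := by omega
    have hnn' : ((y / 2 : ℕ) : ℝ) + 2 * ((y / 3 : ℕ) : ℝ) ≤ y + ((y / 6 : ℕ) : ℝ) := by
      exact_mod_cast hnn
    split_ifs with hm
    · rw [Finset.mem_Ioc] at hm
      have hy1 : 1 ≤ y := (Nat.one_le_div_iff hd).2 hm.2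
      have hy2 : y < 3 := by rw [hy, Nat.div_lt_iff_lt_mul hd]; omega
      have hge : 1 + (y / 2 + 2 * (y / 3)) ≤ y + y / 6 := by interval_cases y <;> simp
      have hge' : 1 + (((y / 2 : ℕ) : ℝ) + 2 * ((y / 3 : ℕ) : ℝ)) ≤ y + ((y / 6 : ℕ) : ℝ) := by
        exact_mod_cast hge
      exact le_mul_of_one_le_right vonMangoldt_nonneg (by linarith)
    · exact mul_nonneg vonMangoldt_nonneg (by linarith)
  refine h1.trans ?_
  rw [← sub_nonneg] at key ⊢
  refine key.trans (le_of_eq ?_)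
  rw [add_sub_assoc, ← Finset.sum_sub_distrib, sub_eq_add_neg, ← Finset.sum_neg_distrib]
  congr 1
  exact Finset.sum_congr rfl fun d _ => by ring

/-- The first divisor of `d` among `k, …, k + s - 1`, or `d` itself if there is none. -/
def findDivisor : ℕ → ℕ → ℕ → ℕ
  | 0, _, d => d
  | s + 1, k, d => if k ∣ d then k else findDivisor s (k + 1) d

theorem findDivisor_dvd (s k d : ℕ) : findDivisor s k d ∣ d := by
  induction s generalizing k with
  | zero => exact dvd_rfl
  | succ s ih =>
    rw [findDivisor]
    split_ifs with h
    · exact h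
    · exact ih _

theorem two_le_findDivisor {s k d : ℕ} (hk : 2 ≤ k) (hd : 2 ≤ d) : 2 ≤ findDivisor s k d := by
  induction s generalizing k with
  | zero => exact hd
  | succ s ih =>
    rw [findDivisor]
    split_ifs with h
    · exact hk
    · exact ih (by omega)

/-- A computable upper bound, in units of `log 2 / 64`, for `oddVonMangoldt d` when `d < 256`. -/
def oddLogBound (d : ℕ) : ℕ :=
  if d % 2 = 0 ∨ d = 1 then 0
  else if d ∣ findDivisor 12 3 d ^ 8 then (findDivisor 12 3 d ^ 64).log2 + 1 else 0

theorem oddVonMangoldt_le_oddLogBound {d : ℕ} (hd : d < 256) :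
    oddVonMangoldt d ≤ oddLogBound d * (Real.log 2 / 64) := by
  have hlog2 : 0 < Real.log 2 := Real.log_pos (by norm_num)
  have hnn : 0 ≤ (oddLogBound d : ℝ) * (Real.log 2 / 64) := by positivity
  by_cases h0 : d % 2 = 0
  · rwa [oddVonMangoldt_of_even (Nat.even_iff.2 h0)]
  by_cases h1 : d = 1
  · subst h1
    simpa [oddVonMangoldt] using hnn
  by_cases hΛ : Λ d = 0
  · exact ((oddVonMangoldt_le d).trans hΛ.le).trans hnn
  refine (oddVonMangoldt_le d).trans ?_
  have hr2 : 2 ≤ findDivisor 12 3 d := two_le_findDivisor (by norm_num) (by omega)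
  have hrd := findDivisor_dvd 12 3 d
  rw [oddLogBound, if_neg (by tauto)]
  set r := findDivisor 12 3 d
  obtain ⟨p, k, hp, hk, rfl⟩ := (isPrimePow_nat_iff d).1 (vonMangoldt_ne_zero_iff.1 hΛ)
  have hpr : p ∣ r := by
    obtain ⟨j, _, hj⟩ := (Nat.dvd_prime_pow hp).1 hrd
    rw [hj]
    exact dvd_pow_self p (by rintro rfl; rw [pow_zero] at hj; omega)
  have hk8 : k ≤ 8 := by
    have : 2 ^ k < 2 ^ 8 := (Nat.pow_le_pow_left hp.two_le k).trans_lt hd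
    exact ((Nat.pow_lt_pow_iff_right (by norm_num)).1 this).le
  rw [if_pos ((pow_dvd_pow p hk8).trans (pow_dvd_pow_of_dvd hpr 8)),
    vonMangoldt_apply_pow hk.ne', vonMangoldt_apply_prime hp]
  have hr0 : 0 < r := by omega
  have h2 : (r : ℝ) ^ 64 ≤ 2 ^ ((r ^ 64).log2 + 1) := by
    exact_mod_cast (Nat.lt_log2_self (n := r ^ 64)).le
  have h3 := Real.log_le_log (by positivity) h2
  rw [Real.log_pow, Real.log_pow] at h3
  have h4 : Real.log p ≤ Real.log r :=
    Real.log_le_log (by exact_mod_cast hp.pos) (by exact_mod_cast Nat.le_of_dvd hr0 hpr)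
  push_cast at h3 ⊢
  linarith

theorem sum_oddLogBound_le : ∀ n < 160, ∑ d ∈ Finset.range (n + 1), oddLogBound d ≤ 120 * n := by
  decide +kernel

theorem sum_oddLogBound_div_le : ∀ n < 160, 3 ≤ n →
    ∑ d ∈ Finset.range (n + 1), (10000 * oddLogBound d / d + 1) + 640000 ≤
      10000 * (n ^ 64).log2 := by
  decide +kernel

theorem log_bounds_for_chebyshev {m : ℕ} (hm : 24 ≤ m) :
    m * Real.log 108 + 2 * Real.log (6 * m + 5) + Real.log 3 ≤ 4 * m * (15 / 8 * Real.log 2) := by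
  have hm' : (24 : ℝ) ≤ m := by exact_mod_cast hm
  have h2 := Real.log_two_gt_d9
  have h2' := Real.log_two_lt_d9
  have h3 : Real.log 3 ≤ 8 / 5 * Real.log 2 := by
    have := Real.log_le_log (by norm_num) (show (3 : ℝ) ^ 5 ≤ 2 ^ 8 by norm_num)
    rw [Real.log_pow, Real.log_pow] at this
    push_cast at this
    linarith
  have h108 : Real.log 108 ≤ 169 / 25 * Real.log 2 := by
    have := Real.log_le_log (by norm_num) (show (108 : ℝ) ^ 25 ≤ 2 ^ 169 by norm_num)
    rw [Real.log_pow, Real.log_pow] at this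
    push_cast at this
    linarith
  have h5 : Real.log (6 * m + 5) ≤ (6 * m + 5) / 128 - 1 + 7 * Real.log 2 := by
    have := Real.log_le_sub_one_of_pos (show (0 : ℝ) < (6 * m + 5) / 2 ^ 7 by positivity)
    rw [Real.log_div (by positivity) (by positivity), Real.log_pow] at this
    push_cast at this
    norm_num at this ⊢
    linarith
  have : 0 ≤ (4 * (15 / 8) - 169 / 25) * Real.log 2 * ((m : ℝ) - 24) := by
    apply mul_nonneg <;> nlinarith
  nlinarith

theorem oddVonMangoldt_le_log_three {d : ℕ} (hd : 3 ∣ d) : oddVonMangoldt d ≤ Real.log 3 := by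
  refine (oddVonMangoldt_le d).trans ?_
  by_cases hΛ : Λ d = 0
  · rw [hΛ]; exact Real.log_nonneg (by norm_num)
  obtain ⟨p, k, hp, hk, rfl⟩ := (isPrimePow_nat_iff d).1 (vonMangoldt_ne_zero_iff.1 hΛ)
  rw [← (Nat.prime_dvd_prime_iff_eq Nat.prime_three hp).1 (Nat.prime_three.dvd_of_dvd_pow hd),
    vonMangoldt_apply_pow hk.ne', vonMangoldt_apply_prime Nat.prime_three]
  norm_num

theorem sum_oddVonMangoldt_le (n : ℕ) :
    ∑ d ∈ Finset.range (n + 1), oddVonMangoldt d ≤ 15 / 8 * Real.log 2 * n := by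
  induction n using Nat.strong_induction_on with
  | _ n ih =>
  have hlog2 : 0 < Real.log 2 := Real.log_pos (by norm_num)
  rcases lt_or_ge n 160 with hn | hn
  · have h1 : ∑ d ∈ Finset.range (n + 1), oddVonMangoldt d ≤
        ∑ d ∈ Finset.range (n + 1), oddLogBound d * (Real.log 2 / 64) :=
      Finset.sum_le_sum fun d hd =>
        oddVonMangoldt_le_oddLogBound (by have := Finset.mem_range.1 hd; omega)
    have h2 : ∑ d ∈ Finset.range (n + 1), (oddLogBound d : ℝ) ≤ 120 * n := by
      exact_mod_cast sum_oddLogBound_le n hn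
    rw [← Finset.sum_mul] at h1
    nlinarith
  obtain ⟨m, r, hr, rfl⟩ : ∃ m r, r < 6 ∧ n = 6 * m + r :=
    ⟨n / 6, n % 6, Nat.mod_lt _ (by norm_num), (Nat.div_add_mod n 6).symm⟩
  have hm : 24 ≤ m := by omega
  have h1 : ∑ d ∈ Finset.range (6 * m + r + 1), oddVonMangoldt d ≤
      ∑ d ∈ Finset.range (6 * m + 6), oddVonMangoldt d :=
    Finset.sum_le_sum_of_subset_of_nonneg (Finset.range_mono (by omega))
      fun d _ _ => oddVonMangoldt_nonneg d
  have hlog : ∀ d, 0 < d → d ≤ 6 * m + 5 → oddVonMangoldt d ≤ Real.log (6 * m + 5) :=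
    fun d h0 hd => ((oddVonMangoldt_le d).trans vonMangoldt_le_log).trans
      (Real.log_le_log (by exact_mod_cast h0) (by exact_mod_cast hd))
  have h2 : ∑ d ∈ Finset.range (6 * m + 1), oddVonMangoldt d =
      ∑ d ∈ Finset.range (2 * m + 1), oddVonMangoldt d +
        ∑ d ∈ Finset.Ioc (2 * m) (6 * m), oddVonMangoldt d := by
    rw [Finset.range_eq_Ico, Finset.range_eq_Ico,
      ← Finset.sum_Ico_consecutive _ (Nat.zero_le (2 * m + 1)) (by omega : 2 * m + 1 ≤ 6 * m + 1)]
    congr 1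
    exact Finset.sum_congr (by ext; simp) fun _ _ => rfl
  have h3 := (Finset.sum_le_sum fun d (_ : d ∈ Finset.Ioc (2 * m) (6 * m)) =>
    oddVonMangoldt_le d).trans (sum_Ioc_vonMangoldt_le m)
  have h4 := ih (2 * m) (by omega)
  have e2 : oddVonMangoldt (6 * m + 2) = 0 :=
    oddVonMangoldt_of_even (by rw [Nat.even_iff]; omega)
  have e4 : oddVonMangoldt (6 * m + 4) = 0 :=
    oddVonMangoldt_of_even (by rw [Nat.even_iff]; omega)
  have e3 : oddVonMangoldt (6 * m + 3) ≤ Real.log 3 := oddVonMangoldt_le_log_three (by omega)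
  have e1 := hlog (6 * m + 1) (by omega) (by omega)
  have e5 := hlog (6 * m + 5) (by omega) (by omega)
  have h5 := log_bounds_for_chebyshev hm
  simp only [Finset.sum_range_succ _ (6 * m + 1), Finset.sum_range_succ _ (6 * m + 2),
    Finset.sum_range_succ _ (6 * m + 3), Finset.sum_range_succ _ (6 * m + 4),
    Finset.sum_range_succ _ (6 * m + 5), h2, e2, e4] at h1
  have hr0 : (0 : ℝ) ≤ 15 / 8 * Real.log 2 * r := by positivity
  push_cast at h4 ⊢
  linarith

theorem sum_Ico_one_div_le {M N : ℕ} (hM : 0 < M) (h : M ≤ N) :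
    ∑ i ∈ Finset.Ico M N, (1 : ℝ) / (i + 1) ≤ Real.log N - Real.log M := by
  induction N, h using Nat.le_induction with
  | base => simp
  | succ n hn ih =>
    have hn0 : (0 : ℝ) < n := by exact_mod_cast hM.trans_le hn
    rw [Finset.sum_Ico_succ_top hn]
    have h1 := Real.one_sub_inv_le_log_of_pos (show (0 : ℝ) < (n + 1) / n by positivity)
    rw [Real.log_div (by positivity) (by positivity)] at h1
    have h2 : 1 - (((n : ℝ) + 1) / n)⁻¹ = 1 / (n + 1) := by field_simp; ring
    push_cast
    linarith

theorem sum_range_clamp_le {N : ℕ} (hN : 2 ≤ N) :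
    ∑ i ∈ Finset.range N, max 0 (min 1 ((N : ℝ) / (i + 1) - 1)) ≤ N * Real.log 2 + 1 := by
  set M := N / 2 with hM
  have hM0 : 0 < M := by omega
  have hMN : M ≤ N := by omega
  have hM0' : (0 : ℝ) < M := by exact_mod_cast hM0
  have hN0' : (0 : ℝ) < N := by exact_mod_cast (by omega : 0 < N)
  rw [Finset.range_eq_Ico, ← Finset.sum_Ico_consecutive _ (Nat.zero_le M) hMN]
  have h1 : ∑ i ∈ Finset.Ico 0 M, max 0 (min 1 ((N : ℝ) / (i + 1) - 1)) ≤ M := by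
    refine (Finset.sum_le_card_nsmul _ _ 1 fun i _ => ?_).trans (by simp)
    exact max_le zero_le_one (min_le_left _ _)
  have h2 : ∑ i ∈ Finset.Ico M N, max 0 (min 1 ((N : ℝ) / (i + 1) - 1)) ≤
      N * (Real.log N - Real.log M) - (N - M) := by
    have h3 : ∀ i ∈ Finset.Ico M N, max 0 (min 1 ((N : ℝ) / (i + 1) - 1)) ≤
        N * ((1 : ℝ) / (i + 1)) - 1 := by
      intro i hi
      have hi' : ((i : ℝ) + 1) ≤ N := by exact_mod_cast (Finset.mem_Ico.1 hi).2
      have h4 : 1 ≤ (N : ℝ) / (i + 1) := by rwa [one_le_div (by positivity)]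
      rw [mul_one_div]
      exact max_le (by linarith) (min_le_right _ _)
    refine (Finset.sum_le_sum h3).trans ?_
    rw [Finset.sum_sub_distrib, ← Finset.mul_sum]
    simp only [Finset.sum_const, Nat.card_Ico, nsmul_eq_mul, mul_one, Nat.cast_sub hMN]
    have := mul_le_mul_of_nonneg_left (sum_Ico_one_div_le hM0 hMN) hN0'.le
    linarith
  have h5 : (N : ℝ) ≤ 2 * M + 1 := by exact_mod_cast (by omega : N ≤ 2 * M + 1)
  have h6 : 2 * (M : ℝ) ≤ N := by exact_mod_cast (by omega : 2 * M ≤ N)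
  have h7 := Real.log_le_sub_one_of_pos (show (0 : ℝ) < N / (2 * M) by positivity)
  rw [Real.log_div (by positivity) (by positivity),
    Real.log_mul (by norm_num) (by positivity)] at h7
  have h8 : (N : ℝ) * (N / (2 * M) - 1) ≤ 1 + (N - 2 * M) := by
    have hM1 : (1 : ℝ) ≤ M := by exact_mod_cast hM0
    rw [div_sub_one (by positivity), mul_div_assoc', div_le_iff₀ (by positivity)]
    nlinarith
  have h9 := mul_le_mul_of_nonneg_left h7 hN0'.le
  linarith

theorem sum_oddVonMangoldt_div_le_of_ge {N : ℕ} (hN : 160 ≤ N) :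
    ∑ d ∈ Finset.range (N + 1), oddVonMangoldt d / d ≤ Real.log N - Real.log 2 := by
  have hN' : (160 : ℝ) ≤ N := by exact_mod_cast hN
  have hN0 : (0 : ℝ) < N := by linarith
  set g : ℕ → ℝ := fun i => max 0 (min 1 ((N : ℝ) / (i + 1) - 1)) with hg
  have hanti : Antitone g := by
    intro i j hij
    have : (i : ℝ) ≤ j := by exact_mod_cast hij
    simp only [hg]
    gcongr
  have h1 := sum_range_mul_le_of_partial_sums_le (a := fun i => oddVonMangoldt (i + 1))
    (b := fun _ => 15 / 8 * Real.log 2) hanti N (le_max_left _ _) (by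
      intro k _
      have := sum_oddVonMangoldt_le k
      rw [Finset.sum_range_succ', oddVonMangoldt_of_even Even.zero, add_zero] at this
      simpa [mul_comm] using this)
  rw [← Finset.mul_sum] at h1
  have h2 := sum_oddVonMangoldt_mul_div_le (N := N) (by omega)
  have h3 : N * ∑ d ∈ Finset.range (N + 1), oddVonMangoldt d / d ≤
      ∑ d ∈ Finset.range (N + 1), oddVonMangoldt d * ((N / d : ℕ) : ℝ) +
        ∑ i ∈ Finset.range N, oddVonMangoldt (i + 1) * g i := by
    rw [Finset.sum_range_succ', Finset.sum_range_succ', oddVonMangoldt_of_even Even.zero]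
    simp only [zero_div, add_zero, zero_mul]
    rw [Finset.mul_sum, ← Finset.sum_add_distrib]
    refine Finset.sum_le_sum fun i hi => ?_
    have hi' : i + 1 ≤ N := Finset.mem_range.1 hi
    have h4 : (1 : ℝ) ≤ ((N / (i + 1) : ℕ) : ℝ) := by
      exact_mod_cast (Nat.one_le_div_iff (Nat.succ_pos i)).2 hi'
    have h5 : (N : ℝ) / (i + 1) ≤ ((N / (i + 1) : ℕ) : ℝ) + 1 := by
      rw [div_le_iff₀ (by positivity)]
      have := (Nat.lt_div_mul_add (a := N) (b := i + 1) (by positivity)).le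
      rw [← Nat.succ_mul] at this
      exact_mod_cast this
    have h6 : (N : ℝ) / (i + 1) - ((N / (i + 1) : ℕ) : ℝ) ≤ g i :=
      le_max_of_le_right (le_min (by linarith) (by linarith))
    have h7 : (N : ℝ) * (oddVonMangoldt (i + 1) / ((i + 1 : ℕ) : ℝ)) =
        oddVonMangoldt (i + 1) * (N / (i + 1)) := by push_cast; ring
    rw [h7, ← mul_add]
    exact mul_le_mul_of_nonneg_left (by linarith) (oddVonMangoldt_nonneg _)
  have hl := Real.log_two_gt_d9
  have hl' := Real.log_two_lt_d9
  have h4 := mul_le_mul_of_nonneg_left (sum_range_clamp_le (N := N) (by omega))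
    (by positivity : (0 : ℝ) ≤ 15 / 8 * Real.log 2)
  have h5 : Real.log N ≤ N / 128 - 1 + 7 * Real.log 2 := by
    have := Real.log_le_sub_one_of_pos (show (0 : ℝ) < N / 2 ^ 7 by positivity)
    rw [Real.log_div (by positivity) (by positivity), Real.log_pow] at this
    push_cast at this
    norm_num at this ⊢
    linarith
  have h6 : Real.log 2 * Real.log 2 ≤ 0.4805 := by nlinarith
  have h7 : N * ∑ d ∈ Finset.range (N + 1), oddVonMangoldt d / d ≤
      N * (Real.log N - Real.log 2) := by nlinarith
  exact le_of_mul_le_mul_left h7 hN0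

theorem sum_oddVonMangoldt_div_le {N : ℕ} (hN : 2 ≤ N) :
    ∑ d ∈ Finset.range (N + 1), oddVonMangoldt d / d ≤ Real.log N - Real.log 2 := by
  rcases le_or_gt 160 N with h | h
  · exact sum_oddVonMangoldt_div_le_of_ge h
  have hlog2 : 0 < Real.log 2 := Real.log_pos (by norm_num)
  rcases hN.eq_or_lt with rfl | hN3
  · simp [Finset.sum_range_succ, oddVonMangoldt]
  have h1 : ∑ d ∈ Finset.range (N + 1), oddVonMangoldt d / d ≤
      ∑ d ∈ Finset.range (N + 1), ((10000 * oddLogBound d / d + 1 : ℕ) : ℝ) *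
        (Real.log 2 / 640000) := by
    refine Finset.sum_le_sum fun d hd => ?_
    rcases Nat.eq_zero_or_pos d with rfl | hd0
    · simp [oddVonMangoldt]; positivity
    have h2 := oddVonMangoldt_le_oddLogBound (d := d) (by have := Finset.mem_range.1 hd; omega)
    have h3 : 10000 * (oddLogBound d : ℝ) ≤ ((10000 * oddLogBound d / d + 1 : ℕ) : ℝ) * d := by
      have := (Nat.lt_div_mul_add (a := 10000 * oddLogBound d) hd0).le
      rw [← Nat.succ_mul] at this
      exact_mod_cast this
    rw [div_le_iff₀ (by exact_mod_cast hd0)]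
    have h4 := mul_le_mul_of_nonneg_right h3 (by positivity : 0 ≤ Real.log 2 / 640000)
    linarith
  rw [← Finset.sum_mul] at h1
  have h2 : (∑ d ∈ Finset.range (N + 1), ((10000 * oddLogBound d / d + 1 : ℕ) : ℝ)) + 640000 ≤
      10000 * ((N ^ 64).log2 : ℝ) := by
    exact_mod_cast sum_oddLogBound_div_le N h hN3
  have h3 : ((N ^ 64).log2 : ℝ) * Real.log 2 ≤ 64 * Real.log N := by
    have h4 : 2 ^ (N ^ 64).log2 ≤ N ^ 64 := Nat.log2_self_le (by positivity)
    have h5 : (2 : ℝ) ^ (N ^ 64).log2 ≤ (N : ℝ) ^ 64 := by exact_mod_cast h4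
    have h6 := Real.log_le_log (by positivity) h5
    rw [Real.log_pow, Real.log_pow] at h6
    exact_mod_cast h6
  have h4 := mul_le_mul_of_nonneg_right h2 (by positivity : 0 ≤ Real.log 2 / 640000)
  linarith

theorem sum_one_div_mul_log_le_of_partial_sums_le {q : ℕ} (hq : 2 ≤ q) {a : ℕ → ℝ}
    (ha0 : ∀ d, 0 ≤ a d) (ha : ∀ d < q, a d = 0)
    (hsum : ∀ X ≥ q, ∑ d ∈ Finset.range (X + 1), a d ≤ Real.log X - Real.log q / 2)
    {S : Set ℕ} (hSa : ∀ m d, m * d ∈ S → 2 ≤ d → Λ d / d ≤ a d)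
    {A : Finset ℕ} (hA0 : ∀ b ∈ A, 0 < b) (hqA : ∀ b ∈ A, q ∣ b)
    (hAS : ∀ b ∈ A, ∀ m, q * m ∣ b → m ∈ S)
    (hA : ∀ b ∈ A, ∀ c ∈ A, b ≠ c → ¬ b ∣ c) :
    ∑ b ∈ A, 1 / ((b : ℝ) * Real.log b) ≤ 1 / ((q : ℝ) * Real.log q) := by
  have hq0 : 0 < q := by omega
  have hlogq : 0 < Real.log q := Real.log_pos (by exact_mod_cast hq)
  have hmul : ∀ b ∈ A, q * (b / q) = b := fun b hb => Nat.mul_div_cancel' (hqA b hb)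
  have hinj : Set.InjOn (fun b => b / q) A := by
    intro b hb c hc h
    rw [← hmul b hb, ← hmul c hc, show b / q = c / q from h]
  set w : ℕ → ℝ := fun m => 1 / (((q * m : ℕ) : ℝ) * Real.log ((q * m : ℕ) : ℝ)) with hw
  have key : ∑ b ∈ A.image (fun b => b / q), w b ≤ w 1 := by
    refine sum_le_of_chain_superharmonic (S := S)
      (fun m => by have := Real.log_natCast_nonneg (q * m); positivity) ?_ ?_ ?_ ?_
    · intro m _ hm N F hF hFS
      have hm0 : (0 : ℝ) < m := by exact_mod_cast hm
      have hq0' : (0 : ℝ) < q := by exact_mod_cast hq0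
      have hlm := Real.log_natCast_nonneg m
      have hterm : ∀ d ∈ F, Λ d / Real.log ((m * d : ℕ) : ℝ) * w (m * d) ≤ 1 / ((q : ℝ) * m) *
          (a d * (1 / ((Real.log q + Real.log m + Real.log d) * (Real.log m + Real.log d)))) := by
        intro d hd
        have hd2 := (Finset.mem_Icc.1 (hF hd)).1
        have hd0 : (0 : ℝ) < d := by exact_mod_cast (by omega : 0 < d)
        have hld : 0 < Real.log d := Real.log_pos (by exact_mod_cast hd2)
        have h1 := mul_le_mul_of_nonneg_left (mul_le_mul_of_nonneg_right
          (hSa m d (hFS d hd) hd2) (by positivity : 0 ≤ 1 /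
            ((Real.log q + Real.log m + Real.log d) * (Real.log m + Real.log d))))
          (by positivity : 0 ≤ 1 / ((q : ℝ) * m))
        refine le_trans (le_of_eq ?_) h1
        simp only [hw]
        push_cast
        rw [Real.log_mul hq0'.ne' (by positivity), Real.log_mul hm0.ne' hd0.ne', ← add_assoc]
        field_simp
      refine (Finset.sum_le_sum hterm).trans ?_
      rw [← Finset.mul_sum]
      have h2 : ∑ d ∈ F, a d *
          (1 / ((Real.log q + Real.log m + Real.log d) * (Real.log m + Real.log d))) ≤
          1 / (Real.log q + Real.log m) := by
        refine le_trans (Finset.sum_le_sum_of_subset_of_nonneg (t := Finset.range (N + 1)) ?_ ?_)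
          (sum_mul_div_log_le hq ha hsum hlm (N + 1))
        · intro d hd
          have := (Finset.mem_Icc.1 (hF hd)).2
          exact Finset.mem_range.2 (by omega)
        · intro d _ _
          have := Real.log_natCast_nonneg d
          have := ha0 d
          positivity
      refine (mul_le_mul_of_nonneg_left h2 (by positivity)).trans (le_of_eq ?_)
      simp only [hw]
      push_cast
      rw [Real.log_mul hq0'.ne' hm0.ne', one_div_mul_one_div]
    · intro m b hb hmb
      obtain ⟨c, hc, rfl⟩ := Finset.mem_image.1 hb
      refine hAS c hc m ?_
      rw [← hmul c hc]
      exact mul_dvd_mul_left q hmb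
    · intro b hb
      obtain ⟨c, hc, rfl⟩ := Finset.mem_image.1 hb
      exact Nat.div_pos (Nat.le_of_dvd (hA0 c hc) (hqA c hc)) hq0
    · intro x hx y hy hxy hdvd
      obtain ⟨b, hb, rfl⟩ := Finset.mem_image.1 hx
      obtain ⟨c, hc, rfl⟩ := Finset.mem_image.1 hy
      refine hA b hb c hc (by rintro rfl; exact hxy rfl) ?_
      rw [← hmul b hb, ← hmul c hc]
      exact mul_dvd_mul_left q hdvd
  rw [Finset.sum_image hinj] at key
  simp only [hw, mul_one] at key
  refine le_trans (le_of_eq (Finset.sum_congr rfl fun b hb => ?_)) key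
  rw [hmul b hb]

/-- The weights `Λ d / d` for odd `d` and `d = 2`. -/
noncomputable def squarefreeEvenWeight (d : ℕ) : ℝ :=
  oddVonMangoldt d / d + if d = 2 then Real.log 2 / 2 else 0

theorem squarefreeEvenWeight_nonneg (d : ℕ) : 0 ≤ squarefreeEvenWeight d := by
  have h := oddVonMangoldt_nonneg d
  have h2 : 0 ≤ Real.log 2 := Real.log_nonneg (by norm_num)
  unfold squarefreeEvenWeight
  split_ifs <;> positivity

theorem squarefreeEvenWeight_of_lt {d : ℕ} (hd : d < 2) : squarefreeEvenWeight d = 0 := by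
  interval_cases d <;> simp [squarefreeEvenWeight, oddVonMangoldt]

theorem le_squarefreeEvenWeight {d : ℕ} (hd : ¬ 4 ∣ d) : Λ d / d ≤ squarefreeEvenWeight d := by
  by_cases he : Even d
  · by_cases h0 : Λ d = 0
    · simpa [h0] using squarefreeEvenWeight_nonneg d
    obtain ⟨k, hk, rfl⟩ := exists_two_pow_of_even he h0
    obtain rfl : k = 1 := by
      by_contra hk1
      exact hd (pow_dvd_pow 2 (by omega : 2 ≤ k))
    simp [squarefreeEvenWeight, oddVonMangoldt, vonMangoldt_apply_prime Nat.prime_two]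
  · have h2 : d ≠ 2 := by rintro rfl; exact he even_two
    simp [squarefreeEvenWeight, oddVonMangoldt, he, h2]

theorem sum_squarefreeEvenWeight_le {X : ℕ} (hX : 2 ≤ X) :
    ∑ d ∈ Finset.range (X + 1), squarefreeEvenWeight d ≤
      Real.log X - Real.log (2 : ℕ) / 2 := by
  have h := sum_oddVonMangoldt_div_le hX
  simp only [squarefreeEvenWeight]
  rw [Finset.sum_add_distrib, Finset.sum_ite_eq' (Finset.range (X + 1)) 2,
    if_pos (Finset.mem_range.2 (by omega))]
  push_cast
  linarith

theorem le_sum_range_oddVonMangoldt_div {q : ℕ} (hq : q.Prime) (hq3 : 3 ≤ q) :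
    Real.log q / 2 - Real.log 2 ≤ ∑ d ∈ Finset.range q, oddVonMangoldt d / d := by
  have hnn : ∀ d ∈ Finset.range q, 0 ≤ oddVonMangoldt d / d := fun d _ =>
    div_nonneg (oddVonMangoldt_nonneg d) (Nat.cast_nonneg d)
  have hq0 : (0 : ℝ) < q := by exact_mod_cast hq.pos
  rcases lt_or_ge q 9 with h | h
  · have hle : Real.log q ≤ 2 * Real.log 2 + 2 * ((if q = 3 then 0 else Real.log 3) / 3) := by
      split_ifs with h3
      · subst h3
        have := Real.log_le_log (by norm_num) (show ((3 : ℕ) : ℝ) ≤ 2 ^ 2 by norm_num)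
        rw [Real.log_pow] at this
        push_cast at this ⊢
        linarith
      · have h8 : (q : ℝ) ≤ 8 := by exact_mod_cast (by omega : q ≤ 8)
        have h1 := Real.log_le_log hq0 h8
        have h2 := Real.log_le_log (by norm_num) (show (8 : ℝ) ^ 3 ≤ 2 ^ 6 * 3 ^ 2 by norm_num)
        rw [Real.log_mul (by norm_num) (by norm_num), Real.log_pow, Real.log_pow,
          Real.log_pow] at h2
        push_cast at h2
        linarith
    have hsum : (if q = 3 then 0 else Real.log 3) / 3 ≤
        ∑ d ∈ Finset.range q, oddVonMangoldt d / d := by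
      split_ifs with h3
      · simpa using Finset.sum_nonneg hnn
      · have := Finset.single_le_sum hnn (Finset.mem_range.2 (by omega : 3 < q))
        rwa [oddVonMangoldt, if_neg (by decide), vonMangoldt_apply_prime Nat.prime_three] at this
    linarith
  · have h10 : 10 ≤ q := by
      rcases h.eq_or_lt with rfl | h
      · norm_num at hq
      · exact h
    obtain ⟨n, rfl⟩ : ∃ n, q = n + 1 := ⟨q - 1, by omega⟩
    have h1 := sum_oddVonMangoldt_div_ge (N := n) (by omega)
    have hn : (9 : ℝ) ≤ n := by exact_mod_cast (by omega : 9 ≤ n)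
    have he : Real.exp 1 ^ 2 * ((n + 1 : ℕ) : ℝ) ≤ (n : ℝ) ^ 2 := by
      have := Real.exp_one_lt_d9
      have h3 : Real.exp 1 ^ 2 ≤ 7.4 := by nlinarith [Real.exp_pos 1]
      have h4 := mul_le_mul_of_nonneg_right h3 hq0.le
      push_cast at h4 ⊢
      nlinarith
    have h2 := Real.log_le_log (by positivity) he
    rw [Real.log_mul (by positivity) hq0.ne', Real.log_pow, Real.log_pow, Real.log_exp] at h2
    push_cast at h2 h1 ⊢
    linarith

/-- The weights `Λ d / d` for `d` with no prime factor below `q`. -/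
noncomputable def roughWeight (q d : ℕ) : ℝ := if q ≤ d.minFac then Λ d / d else 0

theorem roughWeight_nonneg (q d : ℕ) : 0 ≤ roughWeight q d := by
  unfold roughWeight
  split_ifs
  · exact div_nonneg vonMangoldt_nonneg (Nat.cast_nonneg d)
  · exact le_rfl

theorem roughWeight_of_lt {q d : ℕ} (hq : 3 ≤ q) (hd : d < q) : roughWeight q d = 0 := by
  refine if_neg fun h => ?_
  rcases Nat.eq_zero_or_pos d with rfl | h0
  · rw [Nat.minFac_zero] at h
    omega
  · have := Nat.minFac_le h0
    omega

theorem roughWeight_le {q : ℕ} (hq : 3 ≤ q) (d : ℕ) : roughWeight q d ≤ oddVonMangoldt d / d := by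
  unfold roughWeight
  split_ifs with h
  · rw [oddVonMangoldt, if_neg]
    intro he
    rw [Nat.minFac_eq_two_iff d |>.2 he.two_dvd] at h
    omega
  · exact div_nonneg (oddVonMangoldt_nonneg d) (Nat.cast_nonneg d)

theorem sum_roughWeight_le {q : ℕ} (hq : q.Prime) (hq3 : 3 ≤ q) {X : ℕ} (hX : q ≤ X) :
    ∑ d ∈ Finset.range (X + 1), roughWeight q d ≤ Real.log X - Real.log q / 2 := by
  have h1 := sum_oddVonMangoldt_div_le (N := X) (by omega)
  have h2 := le_sum_range_oddVonMangoldt_div hq hq3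
  rw [← Finset.sum_range_add_sum_Ico _ (by omega : q ≤ X + 1)] at h1 ⊢
  rw [Finset.sum_eq_zero fun d hd => roughWeight_of_lt hq3 (Finset.mem_range.1 hd)]
  have h3 : ∑ d ∈ Finset.Ico q (X + 1), roughWeight q d ≤
      ∑ d ∈ Finset.Ico q (X + 1), oddVonMangoldt d / d :=
    Finset.sum_le_sum fun d _ => roughWeight_le hq3 d
  linarith

theorem sum_one_div_mul_log_le_of_minFac_eq {q : ℕ} (hq : q.Prime) {A : Finset ℕ}
    (hA1 : ∀ b ∈ A, 1 < b) (hqA : ∀ b ∈ A, b.minFac = q) (h8 : ∀ b ∈ A, ¬ 8 ∣ b)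
    (hA : ∀ b ∈ A, ∀ c ∈ A, b ≠ c → ¬ b ∣ c) :
    ∑ b ∈ A, 1 / ((b : ℝ) * Real.log b) ≤ 1 / ((q : ℝ) * Real.log q) := by
  have hA0 : ∀ b ∈ A, 0 < b := fun b hb => zero_lt_one.trans (hA1 b hb)
  have hdvd : ∀ b ∈ A, q ∣ b := fun b hb => hqA b hb ▸ b.minFac_dvd
  rcases hq.two_le.eq_or_lt with rfl | hq3
  · refine sum_one_div_mul_log_le_of_partial_sums_le le_rfl squarefreeEvenWeight_nonneg
      (fun d => squarefreeEvenWeight_of_lt) (fun X => sum_squarefreeEvenWeight_le)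
      (S := {m | ¬ 4 ∣ m}) (fun m d hmd _ => le_squarefreeEvenWeight fun h => hmd (h.mul_left m))
      hA0 hdvd (fun b hb m hm h => h8 b hb ((mul_dvd_mul_left 2 h).trans hm)) hA
  · refine sum_one_div_mul_log_le_of_partial_sums_le hq.two_le (roughWeight_nonneg q)
      (fun d => roughWeight_of_lt hq3) (fun X => sum_roughWeight_le hq hq3)
      (S := {m | ∀ p, p.Prime → p ∣ m → q ≤ p}) (fun m d hmd hd => ?_) hA0 hdvd
      (fun b hb m hm p hp hpm => ?_) hA
    · rw [roughWeight, if_pos]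
      exact hmd _ (Nat.minFac_prime (by omega)) (d.minFac_dvd.mul_left m)
    · rw [← hqA b hb]
      exact Nat.minFac_le_of_dvd hp.two_le ((hpm.mul_left q).trans hm)

theorem summable_one_div_prime_mul_log :
    Summable fun p : {p : ℕ // p.Prime} => 1 / ((p : ℕ) * Real.log (p : ℕ)) := by
  have hlog2 : 0 < Real.log 2 := Real.log_pos (by norm_num)
  refine summable_of_sum_le (c := 2 * (1 / Real.log 2)) (fun p => ?_) fun s => ?_
  · have := Real.log_natCast_nonneg (p : ℕ)
    positivity
  set g : ℕ → ℝ := fun d => squarefreeEvenWeight d *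
    (1 / ((Real.log (2 : ℕ) + 0 + Real.log d) * (0 + Real.log d))) with hg
  have hterm : ∀ p ∈ s, 1 / (((p : ℕ) : ℝ) * Real.log (p : ℕ)) ≤ 2 * g p := by
    rintro ⟨p, hp⟩ -
    have hp0 : (0 : ℝ) < p := by exact_mod_cast hp.pos
    have hlp : Real.log 2 ≤ Real.log p :=
      Real.log_le_log (by norm_num) (by exact_mod_cast hp.two_le)
    have hlp0 : 0 < Real.log p := hlog2.trans_le hlp
    have h4 : ¬ 4 ∣ p := fun h => by
      have := (Nat.prime_dvd_prime_iff_eq Nat.prime_two hp).1 ((by norm_num : 2 ∣ 4).trans h)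
      subst this
      norm_num at h
    have hw := le_squarefreeEvenWeight h4
    rw [vonMangoldt_apply_prime hp] at hw
    simp only [hg, Nat.cast_ofNat, add_zero, zero_add]
    calc 1 / ((p : ℝ) * Real.log p)
        = 2 * (Real.log p / p * (1 / ((Real.log p + Real.log p) * Real.log p))) := by
          field_simp; norm_num
      _ ≤ _ := by
          have := squarefreeEvenWeight_nonneg p
          gcongr
  refine (Finset.sum_le_sum hterm).trans ?_
  rw [← Finset.mul_sum]
  refine mul_le_mul_of_nonneg_left ?_ (by norm_num)
  have hsum : ∑ d ∈ Finset.range (s.sup Subtype.val + 1), g d ≤ 1 / Real.log 2 := by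
    simpa only [hg, Nat.cast_ofNat, add_zero] using sum_mul_div_log_le le_rfl
      (fun d => squarefreeEvenWeight_of_lt) (fun X => sum_squarefreeEvenWeight_le) le_rfl
      (s.sup Subtype.val + 1)
  have himg : ∑ p ∈ s, g p = ∑ d ∈ s.image Subtype.val, g d :=
    (Finset.sum_image fun x _ y _ h => Subtype.ext h).symm
  rw [himg]
  refine (Finset.sum_le_sum_of_subset_of_nonneg (fun d hd => ?_) fun d _ _ => ?_).trans hsum
  · obtain ⟨p, hp, rfl⟩ := Finset.mem_image.1 hd
    exact Finset.mem_range.2 (Nat.lt_succ_of_le (Finset.le_sup (f := Subtype.val) hp))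
  · have := squarefreeEvenWeight_nonneg d
    have := Real.log_natCast_nonneg d
    have := Real.log_natCast_nonneg 2
    simp only [hg]
    positivity

theorem sum_one_div_mul_log_le_C {A : Finset ℕ} (hA1 : ∀ b ∈ A, 1 < b) (h8 : ∀ b ∈ A, ¬ 8 ∣ b)
    (hA : ∀ b ∈ A, ∀ c ∈ A, b ≠ c → ¬ b ∣ c) :
    ∑ b ∈ A, 1 / ((b : ℝ) * Real.log b) ≤ C := by
  have hprime : ∀ q ∈ A.image Nat.minFac, q.Prime := by
    intro q hq
    obtain ⟨b, hb, rfl⟩ := Finset.mem_image.1 hq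
    exact Nat.minFac_prime (hA1 b hb).ne'
  rw [← Finset.sum_fiberwise_of_maps_to (g := Nat.minFac) (t := A.image Nat.minFac)
    fun b hb => Finset.mem_image_of_mem _ hb]
  have h1 : ∀ q ∈ A.image Nat.minFac,
      ∑ b ∈ A.filter (fun b => b.minFac = q), 1 / ((b : ℝ) * Real.log b) ≤
        1 / ((q : ℝ) * Real.log q) := by
    intro q hq
    refine sum_one_div_mul_log_le_of_minFac_eq (hprime q hq) ?_ ?_ ?_ ?_
    · exact fun b hb => hA1 b (Finset.mem_filter.1 hb).1
    · exact fun b hb => (Finset.mem_filter.1 hb).2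
    · exact fun b hb => h8 b (Finset.mem_filter.1 hb).1
    · exact fun b hb c hc => hA b (Finset.mem_filter.1 hb).1 c (Finset.mem_filter.1 hc).1
  refine (Finset.sum_le_sum h1).trans ?_
  rw [← Finset.sum_subtype_of_mem (p := Nat.Prime) _ hprime]
  refine summable_one_div_prime_mul_log.sum_le_tsum _ fun p _ => ?_
  have := Real.log_natCast_nonneg (p : ℕ)
  positivity

end

theorem primitive_no_multiple_of_eight (A : Set ℕ) (hA : IsPrimitive A)
    (h8 : ∀ a ∈ A, ¬ (8 ∣ a)) :
    f A < C + 2.37e-7 := by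
  have h : f A ≤ C := by
    refine Real.tsum_le_of_sum_le (fun a => ?_) fun s => ?_
    · have := Real.log_natCast_nonneg (a : ℕ)
      positivity
    have hmem : ∀ b ∈ s.map (Function.Embedding.subtype _), b ∈ A := by
      intro b hb
      obtain ⟨a, -, rfl⟩ := Finset.mem_map.1 hb
      exact a.2
    have := sum_one_div_mul_log_le_C (A := s.map (Function.Embedding.subtype _))
      (fun b hb => hA.1 b (hmem b hb)) (fun b hb => h8 b (hmem b hb))
      (fun b hb c hc => hA.2 b (hmem b hb) c (hmem c hc))
    rwa [Finset.sum_map] at this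
  linarith [show (0 : ℝ) < 2.37e-7 by norm_num]
end

section
/- Let A be a primitive set such that every prime divisor of every element of A lies in the interval [3, exp(10^6)]. Then f(A) ≤ ∑_{p ∈ 𝒫(A)} 1/(p·log p), where 𝒫(A) is the set of primes dividing some member of A. -/
open scoped BigOperators

/-- The support `𝒫(A)` of a set `A`: the primes dividing some member of `A`. -/
def primeSupport (A : Set ℕ) : Set ℕ :=
  {p : ℕ | p.Prime ∧ ∃ a ∈ A, p ∣ a}

namespace PrimitiveSet

open Finset
open scoped ArithmeticFunction.vonMangoldt


/-- The Chebyshev sum `∑_{n ≤ N} Λ(n)`. -/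
noncomputable def psiSum (N : ℕ) : ℝ := ∑ n ∈ Icc 1 N, Λ n

/-- The Mertens sum `∑_{n ≤ N} Λ(n) / n`. -/
noncomputable def mertensSum (N : ℕ) : ℝ := ∑ n ∈ Icc 1 N, Λ n / n

theorem sum_vonMangoldt_mul_div {N M : ℕ} (h : M ≤ N) :
    ∑ d ∈ Icc 1 N, Λ d * ((M / d : ℕ) : ℝ) = Real.log (M.factorial) := by
  have hlog : Real.log (M.factorial) = ∑ n ∈ Icc 1 M, Real.log n := by
    clear h
    induction M with
    | zero => simp
    | succ M ih =>
      rw [sum_Icc_succ_top (by omega), ← ih, Nat.factorial_succ, Nat.cast_mul,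
        Real.log_mul (by positivity) (by positivity), add_comm]
  have hdiv (n : ℕ) (hn : n ∈ Icc 1 M) :
      Real.log n = ∑ d ∈ Icc 1 N, if d ∣ n then Λ d else 0 := by
    rw [← ArithmeticFunction.vonMangoldt_sum, ← sum_filter]
    refine sum_congr ?_ fun _ _ ↦ rfl
    ext d
    obtain ⟨h1, h2⟩ := mem_Icc.1 hn
    simp only [Nat.mem_divisors, mem_filter, mem_Icc]
    constructor
    · rintro ⟨hd, -⟩
      exact ⟨⟨Nat.pos_of_dvd_of_pos hd h1, (Nat.le_of_dvd h1 hd).trans (h2.trans h)⟩, hd⟩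
    · rintro ⟨-, hd⟩
      exact ⟨hd, by omega⟩
  rw [hlog, sum_congr rfl hdiv, sum_comm]
  refine sum_congr rfl fun d _ ↦ ?_
  rw [← sum_filter, sum_const, nsmul_eq_mul, mul_comm]
  congr 2
  rw [← Nat.Ioc_filter_dvd_card_eq_div]
  rfl

theorem log_factorial_le (N : ℕ) (hN : 1 ≤ N) :
    Real.log N.factorial ≤ N * Real.log N - N + Real.log N + 1 := by
  induction N, hN using Nat.le_induction with
  | base => simp
  | succ n hn ih =>
    have hn0 : (0 : ℝ) < n := by exact_mod_cast hn
    rw [Nat.factorial_succ, Nat.cast_mul, Real.log_mul (by positivity) (by positivity)]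
    push_cast
    have h1 := Real.one_sub_inv_le_log_of_pos (x := ((n : ℝ) + 1) / n) (by positivity)
    rw [Real.log_div (by positivity) (by positivity)] at h1
    have h2 : 1 - (((n : ℝ) + 1) / n)⁻¹ = 1 / (n + 1) := by field_simp; ring
    rw [h2, div_le_iff₀ (by positivity)] at h1
    nlinarith

theorem le_log_factorial (N : ℕ) :
    N * Real.log N - N ≤ Real.log N.factorial := by
  rcases Nat.eq_zero_or_pos N with rfl | hN
  · simp
  have h := Stirling.le_log_factorial_stirling hN.ne'
  have h1 : 0 ≤ Real.log N := Real.log_natCast_nonneg N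
  have h2 : 0 ≤ Real.log (2 * Real.pi) := Real.log_nonneg (by linarith [Real.pi_gt_three])
  linarith

theorem mul_log_sub_le_log_factorial_div (N a : ℕ) (ha : 1 ≤ a) (hN : 1 ≤ N) :
    (N / a : ℝ) * Real.log (N / a) - N / a - Real.log (N / a + 1) ≤
      Real.log (N / a).factorial := by
  set k := N / a with hk
  set x : ℝ := N / a with hx
  have ha0 : (0 : ℝ) < a := by exact_mod_cast ha
  have hx0 : 0 < x := by positivity
  have hkx : (k : ℝ) ≤ x := Nat.cast_div_le
  have hxk : x < k + 1 := by
    rw [hx, div_lt_iff₀ ha0]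
    exact_mod_cast (Nat.lt_mul_of_div_lt (Nat.lt_succ_self k) ha).trans_eq
      (by rw [Nat.succ_eq_add_one])
  have h1 := le_log_factorial (k + 1)
  rw [Nat.factorial_succ, Nat.cast_mul, Real.log_mul (by positivity) (by positivity)] at h1
  push_cast at h1
  have h2 : Real.log (k + 1) ≤ Real.log (x + 1) := Real.log_le_log (by positivity) (by linarith)
  have h3 := Real.one_sub_inv_le_log_of_pos (x := ((k : ℝ) + 1) / x) (by positivity)
  rw [Real.log_div (by positivity) (by positivity), inv_div] at h3
  have h5 : x * (1 - x / (k + 1)) ≤ x * (Real.log (k + 1) - Real.log x) :=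
    mul_le_mul_of_nonneg_left h3 hx0.le
  by_cases hk0 : k = 0
  · have : x * Real.log x ≤ 0 := by
      apply mul_nonpos_of_nonneg_of_nonpos hx0.le
      apply Real.log_nonpos hx0.le
      rw [hk0] at hxk; simpa using hxk.le
    have : 0 ≤ Real.log (x + 1) := Real.log_nonneg (by linarith)
    rw [hk0]; simp; linarith
  · have h7 : x * Real.log x - x ≤ (k + 1) * Real.log (k + 1) - (k + 1) := by
      have h8 := Real.log_le_sub_one_of_pos (x := x / (k + 1)) (by positivity)
      rw [Real.log_div (by positivity) (by positivity)] at h8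
      have hk1 : (1 : ℝ) ≤ k := by exact_mod_cast Nat.one_le_iff_ne_zero.2 hk0
      have h10 : 0 ≤ Real.log x := Real.log_nonneg (by linarith)
      have h11 : ((k : ℝ) + 1) * (Real.log x - Real.log (k + 1)) ≤ x - (k + 1) := by
        calc _ ≤ ((k : ℝ) + 1) * (x / (k + 1) - 1) := by gcongr
          _ = _ := by field_simp
      nlinarith
    linarith

theorem mul_mertensSum_le (N : ℕ) :
    N * mertensSum N ≤ Real.log N.factorial + psiSum N := by
  rw [← sum_vonMangoldt_mul_div le_rfl, mertensSum, psiSum, mul_sum, ← sum_add_distrib]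
  refine sum_le_sum fun d hd ↦ ?_
  have hd1 : (0 : ℝ) < d := by exact_mod_cast (mem_Icc.1 hd).1
  have h : (N : ℝ) / d ≤ (N / d : ℕ) + 1 := by
    rw [div_le_iff₀ hd1]
    exact_mod_cast (Nat.lt_mul_of_div_lt (Nat.lt_succ_self _) (mem_Icc.1 hd).1).le.trans_eq
      (by rw [Nat.succ_eq_add_one])
  calc N * (Λ d / d) = Λ d * (N / d) := by ring
    _ ≤ Λ d * ((N / d : ℕ) + 1) :=
      mul_le_mul_of_nonneg_left h ArithmeticFunction.vonMangoldt_nonneg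
    _ = _ := by ring

theorem log_factorial_le_mul_mertensSum (N : ℕ) :
    Real.log N.factorial ≤ N * mertensSum N := by
  rw [← sum_vonMangoldt_mul_div le_rfl, mertensSum, mul_sum]
  refine sum_le_sum fun d hd ↦ ?_
  calc Λ d * ((N / d : ℕ) : ℝ) ≤ Λ d * (N / d) :=
      mul_le_mul_of_nonneg_left Nat.cast_div_le ArithmeticFunction.vonMangoldt_nonneg
    _ = _ := by ring

theorem psiSum_le_log_factorial (N : ℕ) :
    psiSum N ≤ Real.log N.factorial - Real.log (N / 2).factorial - Real.log (N / 3).factorial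
      - Real.log (N / 7).factorial - Real.log (N / 42).factorial + psiSum (N / 42) := by
  have hpsi : psiSum (N / 42) = ∑ d ∈ Icc 1 N, Λ d * (if d ≤ N / 42 then 1 else 0) := by
    simp only [mul_ite, mul_one, mul_zero]
    rw [← sum_filter, psiSum]
    refine sum_congr ?_ fun _ _ ↦ rfl
    ext d
    simp only [mem_filter, mem_Icc]
    omega
  rw [hpsi, ← sum_vonMangoldt_mul_div le_rfl,
    ← sum_vonMangoldt_mul_div (Nat.div_le_self N 2),
    ← sum_vonMangoldt_mul_div (Nat.div_le_self N 3),
    ← sum_vonMangoldt_mul_div (Nat.div_le_self N 7),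
    ← sum_vonMangoldt_mul_div (Nat.div_le_self N 42),
    ← sum_sub_distrib, ← sum_sub_distrib, ← sum_sub_distrib, ← sum_sub_distrib, ← sum_add_distrib,
    psiSum]
  refine sum_le_sum fun d hd ↦ ?_
  obtain ⟨hd1, hd2⟩ := mem_Icc.1 hd
  have hn : 1 ≤ N / d := (Nat.one_le_div_iff hd1).2 hd2
  have hiff : d ≤ N / 42 ↔ 42 ≤ N / d := by
    rw [Nat.le_div_iff_mul_le (by norm_num), Nat.le_div_iff_mul_le hd1, mul_comm]
  simp only [hiff, Nat.div_div_eq_div_mul, mul_comm _ d]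
  simp only [← Nat.div_div_eq_div_mul]
  set n := N / d
  have key : 1 + n / 2 + n / 3 + n / 7 + n / 42 ≤ n + (if 42 ≤ n then 1 else 0) := by
    split_ifs <;> omega
  have key' : (1 : ℝ) + (n / 2 : ℕ) + (n / 3 : ℕ) + (n / 7 : ℕ) + (n / 42 : ℕ) ≤
      n + (if 42 ≤ n then 1 else 0) := by exact_mod_cast key
  have hL : 0 ≤ Λ d := ArithmeticFunction.vonMangoldt_nonneg
  nlinarith [mul_le_mul_of_nonneg_left key' hL]

/-- A prime factor of `n` below `47` if there is one, and `n` otherwise. -/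
def smallFactor (n : ℕ) : ℕ :=
  ([2, 3, 5, 7, 11, 13, 17, 19, 23, 29, 31, 37, 41, 43].find? (fun d => n % d == 0)).getD n

/-- For `n < 2048`, a number whose logarithm bounds `Λ n`. -/
def mangoldtBase (n : ℕ) : ℕ := if smallFactor n ^ 11 % n = 0 then smallFactor n else 1

/-- An integer lower bound for `32 * log n / log 2`. -/
def logLower (n : ℕ) : ℕ := Nat.log2 (n ^ 32)

/-- An integer upper bound for `32 * log n / log 2`. -/
def logUpper (n : ℕ) : ℕ := if n ≤ 2 then 32 * (n - 1) else Nat.log2 (n ^ 32) + 1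

/-- `g n`, written so that the kernel evaluates `n` to a numeral before entering `g`. -/
def forceNat (n : ℕ) (g : ℕ → Bool) : Bool :=
  match n with
  | 0 => g 0
  | m + 1 => g (m + 1)

theorem forceNat_eq (n : ℕ) (g : ℕ → Bool) : forceNat n g = g n := by
  cases n <;> rfl

/-- Checks upper bounds for `psiSum` and `mertensSum` on `[n, n + k)`, where `P` and `T` bound
the scaled values of these sums at `n - 1`. -/
def checkSums : ℕ → ℕ → ℕ → ℕ → Bool
  | 0, _, _, _ => true
  | k + 1, n, P, T =>
    forceNat (logUpper (mangoldtBase n)) fun l =>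
    forceNat (P + l) fun P' =>
    forceNat (T + (l * 1000000 / n + 1)) fun T' =>
    forceNat (n + 1) fun n' =>
    (decide (P' * 694 ≤ 36160 * n) &&
      decide (T' + 9600000 ≤ 1000000 * logLower n ∨ n = 1)) && checkSums k n' P' T'

theorem checkSums_eq_true : checkSums 2047 1 0 0 = true := by decide +kernel

theorem logLower_mul_log_two_le {n : ℕ} (hn : 1 ≤ n) :
    logLower n * Real.log 2 ≤ 32 * Real.log n := by
  have h : 2 ^ logLower n ≤ n ^ 32 := Nat.log2_self_le (by positivity)
  have h' : ((2 : ℝ) ^ logLower n) ≤ (n : ℝ) ^ 32 := by exact_mod_cast h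
  have := Real.log_le_log (by positivity) h'
  rw [Real.log_pow, Real.log_pow] at this
  exact_mod_cast this

theorem le_logUpper_mul_log_two {n : ℕ} (hn : 1 ≤ n) :
    32 * Real.log n ≤ logUpper n * Real.log 2 := by
  unfold logUpper
  split_ifs with h
  · interval_cases n <;> simp
  · have h : n ^ 32 < 2 ^ (Nat.log2 (n ^ 32) + 1) := Nat.lt_log2_self
    have h' : (n : ℝ) ^ 32 ≤ (2 : ℝ) ^ (Nat.log2 (n ^ 32) + 1) := by exact_mod_cast h.le
    have := Real.log_le_log (by positivity) h'
    rw [Real.log_pow, Real.log_pow] at this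
    exact_mod_cast this

theorem smallFactor_eq_or_prime (n : ℕ) :
    smallFactor n = n ∨ ((smallFactor n).Prime ∧ smallFactor n ∣ n) := by
  unfold smallFactor
  cases h : [2, 3, 5, 7, 11, 13, 17, 19, 23, 29, 31, 37, 41, 43].find? (fun d => n % d == 0) with
  | none => simp
  | some d =>
    right
    have h1 := List.mem_of_find?_eq_some h
    have h2 := List.find?_some h
    refine ⟨?_, Nat.dvd_of_mod_eq_zero (by simpa using h2)⟩
    simp only [List.mem_cons, List.not_mem_nil, or_false] at h1
    simp only [Option.getD_some]
    rcases h1 with h | h | h | h | h | h | h | h | h | h | h | h | h | h <;> subst h <;> norm_num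

theorem one_le_mangoldtBase {n : ℕ} (hn : 1 ≤ n) : 1 ≤ mangoldtBase n := by
  unfold mangoldtBase
  split_ifs
  · rcases smallFactor_eq_or_prime n with h | h
    · omega
    · exact h.1.one_le
  · rfl

theorem vonMangoldt_le_log_mangoldtBase {n : ℕ} (hn : 1 ≤ n) (hn' : n < 2048) :
    Λ n ≤ Real.log (mangoldtBase n) := by
  by_cases h0 : Λ n = 0
  · rw [h0]
    exact Real.log_natCast_nonneg _
  rcases smallFactor_eq_or_prime n with h | ⟨hp, hd⟩
  · have : mangoldtBase n = n := by
      rw [mangoldtBase, h, if_pos (Nat.mod_eq_zero_of_dvd (dvd_pow_self n (by norm_num)))]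
    rw [this]
    exact ArithmeticFunction.vonMangoldt_le_log
  · rw [← ne_eq, ArithmeticFunction.vonMangoldt_ne_zero_iff, isPrimePow_nat_iff] at h0
    obtain ⟨q, k, hq, hk, rfl⟩ := h0
    have hs : smallFactor (q ^ k) = q := (Nat.prime_dvd_prime_iff_eq hp hq).1 (hp.dvd_of_dvd_pow hd)
    have hk11 : k ≤ 11 := by
      by_contra! hk'
      have h1 : 2 ^ 11 ≤ 2 ^ k := Nat.pow_le_pow_right (by norm_num) hk'.le
      have h2 : 2 ^ k ≤ q ^ k := Nat.pow_le_pow_left hq.two_le k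
      omega
    have : mangoldtBase (q ^ k) = q := by
      rw [mangoldtBase, hs, if_pos (Nat.mod_eq_zero_of_dvd (pow_dvd_pow q hk11))]
    rw [this, ArithmeticFunction.vonMangoldt_apply_pow hk.ne',
      ArithmeticFunction.vonMangoldt_apply_prime hq]

theorem sums_le_of_checkSums (k : ℕ) : ∀ n P T : ℕ, checkSums k (n + 1) P T = true →
    n + k < 2048 → 32 * psiSum n ≤ P * Real.log 2 →
    32000000 * mertensSum n ≤ T * Real.log 2 →
    ∀ m, n < m → m ≤ n + k → psiSum m ≤ 1.13 * m ∧
      (2 ≤ m → mertensSum m ≤ Real.log m - 0.3 * Real.log 2) := by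
  induction k with
  | zero => intro n P T _ _ _ _ m h1 h2; omega
  | succ k ih =>
    intro n P T hc hn hP hT m hm hm'
    simp only [checkSums, forceNat_eq, Bool.and_eq_true, decide_eq_true_eq] at hc
    obtain ⟨⟨hc1, hc2⟩, hc3⟩ := hc
    set l := logUpper (mangoldtBase (n + 1)) with hl
    have hL : 32 * Λ (n + 1) ≤ l * Real.log 2 :=
      (mul_le_mul_of_nonneg_left (vonMangoldt_le_log_mangoldtBase (by omega) (by omega))
        (by norm_num)).trans (le_logUpper_mul_log_two (one_le_mangoldtBase (by omega)))
    have hlog2 : 0 < Real.log 2 := Real.log_pos (by norm_num)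
    have hn0 : (0 : ℝ) < (n + 1 : ℕ) := by positivity
    have hP' : 32 * psiSum (n + 1) ≤ (P + l : ℕ) * Real.log 2 := by
      rw [psiSum, sum_Icc_succ_top (by omega), ← psiSum]
      push_cast
      linarith
    have hT' : 32000000 * mertensSum (n + 1) ≤
        (T + (l * 1000000 / (n + 1) + 1) : ℕ) * Real.log 2 := by
      rw [mertensSum, sum_Icc_succ_top (by omega), ← mertensSum]
      have h1 : (l * 1000000 : ℝ) / (n + 1 : ℕ) ≤ (l * 1000000 / (n + 1) : ℕ) + 1 := by
        rw [div_le_iff₀ hn0]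
        exact_mod_cast (Nat.lt_mul_of_div_lt (Nat.lt_succ_self _) (by omega : 0 < n + 1)).le
      have h2 : 32000000 * (Λ (n + 1) / (n + 1 : ℕ)) ≤
          (l * 1000000 : ℝ) / (n + 1 : ℕ) * Real.log 2 := by
        rw [mul_div_assoc', div_mul_eq_mul_div]
        exact div_le_div_of_nonneg_right (by linarith) hn0.le
      have h3 := h2.trans (mul_le_mul_of_nonneg_right h1 hlog2.le)
      rw [mul_add]
      push_cast at h3 ⊢
      linarith
    rcases Nat.lt_or_ge (n + 1) m with h | h
    · exact ih (n + 1) _ _ hc3 (by omega) hP' hT' m h (by omega)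
    obtain rfl : m = n + 1 := by omega
    constructor
    · have h1 : (((P + l : ℕ) : ℝ)) * 694 ≤ 36160 * (n + 1 : ℕ) := by exact_mod_cast hc1
      have h2 := Real.log_two_lt_d9
      have h3 : (0 : ℝ) ≤ (P + l : ℕ) := by positivity
      nlinarith
    · intro h2
      have hc2' := hc2.resolve_right (by omega)
      have h1 : ((T + (l * 1000000 / (n + 1) + 1) : ℕ) : ℝ) + 9600000 ≤
          1000000 * logLower (n + 1) := by exact_mod_cast hc2'
      have h3 := mul_le_mul_of_nonneg_right h1 hlog2.le
      have h4 := logLower_mul_log_two_le (n := n + 1) (by omega)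
      linarith

theorem psiSum_le_of_lt {N : ℕ} (hN : N < 2048) : psiSum N ≤ 1.13 * N := by
  rcases Nat.eq_zero_or_pos N with rfl | h
  · simp [psiSum]
  · exact (sums_le_of_checkSums 2047 0 0 0 checkSums_eq_true (by norm_num) (by simp [psiSum])
      (by simp [mertensSum]) N h (by omega)).1

theorem mertensSum_le_of_lt {N : ℕ} (h2 : 2 ≤ N) (hN : N < 2048) :
    mertensSum N ≤ Real.log N - 0.3 * Real.log 2 :=
  (sums_le_of_checkSums 2047 0 0 0 checkSums_eq_true (by norm_num) (by simp [psiSum])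
      (by simp [mertensSum]) N (by omega) (by omega)).2 h2

theorem log_le_mul_log_two {n a b : ℕ} (hb : 0 < b) (hn : 0 < n) (h : n ^ b ≤ 2 ^ a) :
    Real.log n ≤ a / b * Real.log 2 := by
  have h' : (n : ℝ) ^ b ≤ (2 : ℝ) ^ a := by exact_mod_cast h
  have := Real.log_le_log (by positivity) h'
  rw [Real.log_pow, Real.log_pow] at this
  rw [div_mul_eq_mul_div, le_div_iff₀ (by positivity)]
  linarith

theorem mul_log_two_le_log {n a b : ℕ} (hb : 0 < b) (h : 2 ^ a ≤ n ^ b) :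
    a / b * Real.log 2 ≤ Real.log n := by
  have h' : (2 : ℝ) ^ a ≤ (n : ℝ) ^ b := by exact_mod_cast h
  have := Real.log_le_log (by positivity) h'
  rw [Real.log_pow, Real.log_pow] at this
  rw [div_mul_eq_mul_div, div_le_iff₀ (by positivity)]
  linarith

theorem log_three_le : Real.log 3 ≤ 65 / 41 * Real.log 2 := by
  exact_mod_cast log_le_mul_log_two (n := 3) (a := 65) (b := 41) (by norm_num) (by norm_num)
    (by norm_num)

theorem log_seven_le : Real.log 7 ≤ 73 / 26 * Real.log 2 := by
  exact_mod_cast log_le_mul_log_two (n := 7) (a := 73) (b := 26) (by norm_num) (by norm_num)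
    (by norm_num)

theorem le_log_three : 19 / 12 * Real.log 2 ≤ Real.log 3 := by
  exact_mod_cast mul_log_two_le_log (n := 3) (a := 19) (b := 12) (by norm_num) (by norm_num)

theorem le_log_five : 23 / 10 * Real.log 2 ≤ Real.log 5 := by
  exact_mod_cast mul_log_two_le_log (n := 5) (a := 23) (b := 10) (by norm_num) (by norm_num)

theorem log_le_of_le {N : ℕ} (hN : 2048 ≤ N) : Real.log N ≤ 6.625 + N / 2048 := by
  have hN0 : (0 : ℝ) < N := by positivity
  have h := Real.log_le_sub_one_of_pos (x := (N : ℝ) / 2048) (by positivity)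
  rw [Real.log_div (by positivity) (by norm_num), show (2048 : ℝ) = 2 ^ 11 by norm_num,
    Real.log_pow] at h
  have := Real.log_two_lt_d9
  push_cast at h
  linarith

theorem psiSum_le (N : ℕ) : psiSum N ≤ 1.13 * N := by
  induction N using Nat.strong_induction_on with
  | _ N ih =>
  rcases Nat.lt_or_ge N 2048 with h | h
  · exact psiSum_le_of_lt h
  have hN : (2048 : ℝ) ≤ N := by exact_mod_cast h
  have hfac (a : ℕ) (ha : 2 ≤ a) :
      N / a * (Real.log N - Real.log a) - N / a - Real.log N ≤ Real.log (N / a).factorial := by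
    have h1 := mul_log_sub_le_log_factorial_div N a (by omega) (by omega)
    have ha' : (2 : ℝ) ≤ a := by exact_mod_cast ha
    rw [Real.log_div (by positivity) (by positivity)] at h1
    have h2 : (N : ℝ) / a + 1 ≤ N := by
      have : (N : ℝ) / a ≤ N / 2 := by gcongr
      linarith
    have h3 := Real.log_le_log (by positivity) h2
    linarith
  have h2 := hfac 2 (by norm_num)
  have h3 := hfac 3 (by norm_num)
  have h7 := hfac 7 (by norm_num)
  have h42 := hfac 42 (by norm_num)
  have hpsi : psiSum (N / 42) ≤ 1.13 * (N / 42) :=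
    (ih (N / 42) (by omega)).trans (by
      have : ((N / 42 : ℕ) : ℝ) ≤ N / (42 : ℕ) := Nat.cast_div_le
      push_cast at this
      linarith)
  have hlog42 : Real.log 42 = Real.log 2 + Real.log 3 + Real.log 7 := by
    rw [← Real.log_mul (by norm_num) (by norm_num), ← Real.log_mul (by norm_num) (by norm_num)]
    norm_num
  push_cast at h2 h3 h7 h42
  rw [hlog42] at h42
  have hmain : psiSum N ≤ N * (22 / 42 * Real.log 2 + 15 / 42 * Real.log 3 + 7 / 42 * Real.log 7)
      + 5 * Real.log N + 1 + psiSum (N / 42) := by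
    have := psiSum_le_log_factorial N
    have := log_factorial_le N (by omega)
    linarith
  have hconst : 22 / 42 * Real.log 2 + 15 / 42 * Real.log 3 + 7 / 42 * Real.log 7 ≤ 1.08 := by
    linarith [log_three_le, log_seven_le, Real.log_two_lt_d9]
  have hconst' := mul_le_mul_of_nonneg_left hconst (by linarith : (0 : ℝ) ≤ N)
  have hlog := log_le_of_le h
  linarith

theorem mertensSum_le_of_le {N : ℕ} (hN : 2048 ≤ N) : mertensSum N ≤ Real.log N + 0.136 := by
  have hN' : (2048 : ℝ) ≤ N := by exact_mod_cast hN
  have h1 := mul_mertensSum_le N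
  have h2 := psiSum_le N
  have h3 := log_factorial_le N (by omega)
  have h4 := log_le_of_le hN
  refine le_of_mul_le_mul_left ?_ (by linarith : (0 : ℝ) < N)
  linarith

theorem log_sub_one_le_mertensSum {N : ℕ} (hN : 1 ≤ N) : Real.log N - 1 ≤ mertensSum N := by
  refine le_of_mul_le_mul_left ?_ (by positivity : (0 : ℝ) < N)
  linarith [le_log_factorial N, log_factorial_le_mul_mertensSum N]

/-- Every prime factor of `n` is at least `p`. -/
def IsRough (p n : ℕ) : Prop := ∀ r : ℕ, r.Prime → r ∣ n → p ≤ r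

open Classical in
/-- The von Mangoldt function restricted to `p`-rough numbers. -/
noncomputable def roughMangoldt (p n : ℕ) : ℝ := if IsRough p n then Λ n else 0

theorem roughMangoldt_nonneg (p n : ℕ) : 0 ≤ roughMangoldt p n := by
  unfold roughMangoldt
  split_ifs
  · exact ArithmeticFunction.vonMangoldt_nonneg
  · rfl

theorem sum_roughMangoldt_add_le {p N : ℕ} {S : Finset ℕ} (hS : S ⊆ Icc 1 N)
    (hr : ∀ n ∈ S, n ≠ 1 → ¬ IsRough p n) :
    ∑ n ∈ Icc 1 N, roughMangoldt p n / n + ∑ n ∈ S, Λ n / n ≤ mertensSum N := by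
  have h : ∑ n ∈ S, Λ n / n = ∑ n ∈ Icc 1 N, if n ∈ S then Λ n / n else 0 := by
    rw [← sum_filter]
    refine sum_congr ?_ fun _ _ ↦ rfl
    ext n
    simp only [mem_filter]
    exact ⟨fun h ↦ ⟨hS h, h⟩, fun h ↦ h.2⟩
  rw [h, ← sum_add_distrib, mertensSum]
  refine sum_le_sum fun n hn ↦ ?_
  have h0 : 0 ≤ Λ n / (n : ℝ) := div_nonneg ArithmeticFunction.vonMangoldt_nonneg (by positivity)
  by_cases hnS : n ∈ S
  · rw [if_pos hnS]
    by_cases h1 : n = 1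
    · simp [h1, roughMangoldt]
    · simp [roughMangoldt, hr n hnS h1]
  · rw [if_neg hnS, add_zero]
    unfold roughMangoldt
    split_ifs
    · rfl
    · simpa using h0

theorem sum_roughMangoldt_add_mertensSum_le {p N : ℕ} (hp : 1 ≤ p) (hN : p ≤ N) :
    ∑ n ∈ Icc 1 N, roughMangoldt p n / n + mertensSum (p - 1) ≤ mertensSum N := by
  refine sum_roughMangoldt_add_le (Icc_subset_Icc_right (by omega)) fun n hn h1 hr ↦ ?_
  have h2 := hr n.minFac (Nat.minFac_prime h1) n.minFac_dvd
  have h3 := Nat.minFac_le (mem_Icc.1 hn).1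
  have h4 := (mem_Icc.1 hn).2
  omega

theorem not_isRough_of_dvd {p q n : ℕ} (hq : q.Prime) (hqp : q < p) (h : q ∣ n) :
    ¬ IsRough p n := fun hr ↦ absurd (hr q hq h) (by omega)

theorem sum_two_powers :
    ∑ n ∈ ({2, 4, 8, 16, 32, 64, 128, 256, 512, 1024} : Finset ℕ), Λ n / (n : ℝ) =
      1023 / 1024 * Real.log 2 := by
  have h : ({2, 4, 8, 16, 32, 64, 128, 256, 512, 1024} : Finset ℕ) =
      (Icc 1 10).image (fun k ↦ 2 ^ k) := by decide
  rw [h, sum_image fun a _ b _ hab ↦ Nat.pow_right_injective le_rfl hab]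
  have h2 : ∀ k ∈ Icc 1 10, Λ (2 ^ k) / ((2 ^ k : ℕ) : ℝ) = Real.log 2 * (1 / 2 ^ k) := by
    intro k hk
    rw [ArithmeticFunction.vonMangoldt_apply_pow (by have := (mem_Icc.1 hk).1; omega),
      ArithmeticFunction.vonMangoldt_apply_prime Nat.prime_two]
    push_cast
    ring
  rw [sum_congr rfl h2, ← mul_sum, mul_comm]
  congr 1
  simp [sum_Icc_succ_top]
  norm_num

theorem vonMangoldt_nine : Λ 9 = Real.log 3 := by
  rw [show 9 = 3 ^ 2 by norm_num, ArithmeticFunction.vonMangoldt_apply_pow (by norm_num),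
    ArithmeticFunction.vonMangoldt_apply_prime Nat.prime_three]
  norm_num

theorem vonMangoldt_twentySeven : Λ 27 = Real.log 3 := by
  rw [show 27 = 3 ^ 3 by norm_num, ArithmeticFunction.vonMangoldt_apply_pow (by norm_num),
    ArithmeticFunction.vonMangoldt_apply_prime Nat.prime_three]
  norm_num

theorem sum_three_powers :
    ∑ n ∈ ({3, 9, 27} : Finset ℕ), Λ n / (n : ℝ) = 13 / 27 * Real.log 3 := by
  rw [sum_insert (by decide), sum_insert (by decide), sum_singleton, vonMangoldt_nine,
    vonMangoldt_twentySeven, ArithmeticFunction.vonMangoldt_apply_prime Nat.prime_three]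
  push_cast
  ring

theorem sum_roughMangoldt_le {p N : ℕ} (hp : p.Prime) (hp3 : 3 ≤ p) (hN : p ≤ N) :
    ∑ n ∈ Icc 1 N, roughMangoldt p n / n ≤ Real.log N - Real.log p / 2 := by
  have l2 := Real.log_two_lt_d9
  have l2' := Real.log_two_gt_d9
  have l3 := log_three_le
  have l3' := le_log_three
  have l5 := le_log_five
  have l7 := log_seven_le
  have hS := sum_roughMangoldt_add_mertensSum_le hp.one_le hN
  have hlow {b : ℕ} (hb : b * p ≤ (p - 1) * (p - 1)) (hb0 : 0 < b) :
      Real.log b + Real.log p ≤ 2 * mertensSum (p - 1) + 2 := by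
    have h1 := log_sub_one_le_mertensSum (N := p - 1) (by omega)
    have h2 : (b : ℝ) * p ≤ (p - 1 : ℕ) * (p - 1 : ℕ) := by exact_mod_cast hb
    have hp0 : (0 : ℝ) < p := by exact_mod_cast hp.pos
    have hp1 : (0 : ℝ) < (p - 1 : ℕ) := by exact_mod_cast (by omega : 0 < p - 1)
    have h3 := Real.log_le_log (by positivity) h2
    rw [Real.log_mul (by positivity) hp0.ne', Real.log_mul hp1.ne' hp1.ne'] at h3
    linarith
  rcases Nat.lt_or_ge N 2048 with h | h
  · have hT := mertensSum_le_of_lt (by omega) h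
    rcases Nat.lt_or_ge p 7 with h7 | h7
    · interval_cases p
      · have h2 : mertensSum 2 = Real.log 2 / 2 := by
          rw [mertensSum, sum_Icc_succ_top (by norm_num), Icc_self, sum_singleton]
          simp [ArithmeticFunction.vonMangoldt_apply_prime Nat.prime_two]
        norm_num at hS
        rw [h2] at hS
        push_cast
        linarith
      · norm_num at hp
      · have h4 := log_factorial_le_mul_mertensSum 4
        have h24 : Real.log ((Nat.factorial 4 : ℕ) : ℝ) = 3 * Real.log 2 + Real.log 3 := by
          rw [show Real.log 2 = Real.log ((2 : ℕ) : ℝ) by norm_num, ← Nat.cast_ofNat (n := 3),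
            ← Real.log_pow, ← Real.log_mul (by positivity) (by positivity)]
          norm_num [Nat.factorial]
        have l5' : Real.log 5 ≤ 7 / 3 * Real.log 2 := by
          exact_mod_cast log_le_mul_log_two (n := 5) (a := 7) (b := 3) (by norm_num)
            (by norm_num) (by norm_num)
        rw [h24] at h4
        norm_num at hS h4
        push_cast
        linarith
      · norm_num at hp
    · obtain ⟨k, rfl⟩ := Nat.exists_eq_add_of_le h7
      have h1 := hlow (b := 5) (by simp only [show 7 + k - 1 = 6 + k by omega]; nlinarith)
        (by norm_num)
      push_cast at h1 ⊢
      linarith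
  · have hT := mertensSum_le_of_le h
    have l11 : Real.log 11 ≤ 7 / 2 * Real.log 2 := by
      exact_mod_cast log_le_mul_log_two (n := 11) (a := 7) (b := 2) (by norm_num)
        (by norm_num) (by norm_num)
    have l11' : 17 / 5 * Real.log 2 ≤ Real.log 11 := by
      exact_mod_cast mul_log_two_le_log (n := 11) (a := 17) (b := 5) (by norm_num) (by norm_num)
    rcases Nat.lt_or_ge p 13 with h13 | h13
    · rcases Nat.lt_or_ge p 5 with h5 | h5
      · obtain rfl : p = 3 := by
          interval_cases p
          · rfl
          · norm_num at hp
        have h1 := sum_roughMangoldt_add_le (p := 3) (N := N)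
          (S := {2, 4, 8, 16, 32, 64, 128, 256, 512, 1024})
          (fun n hn ↦ by simp at hn; simp; omega)
          (fun n hn _ ↦ not_isRough_of_dvd Nat.prime_two (by norm_num) (by simp at hn; omega))
        rw [sum_two_powers] at h1
        push_cast
        linarith
      · have h1 := sum_roughMangoldt_add_le (p := p) (N := N)
          (S := {2, 4, 8, 16, 32, 64, 128, 256, 512, 1024} ∪ {3, 9, 27})
          (fun n hn ↦ by simp at hn; simp; omega)
          (fun n hn _ ↦ by
            rcases mem_union.1 hn with hn | hn
            · exact not_isRough_of_dvd Nat.prime_two (by omega) (by simp at hn; omega)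
            · exact not_isRough_of_dvd Nat.prime_three (by omega) (by simp at hn; omega))
        rw [sum_union (by decide), sum_two_powers, sum_three_powers] at h1
        rcases Nat.lt_or_ge p 8 with h8 | h8
        · have : Real.log p ≤ Real.log 7 :=
            Real.log_le_log (by positivity) (by exact_mod_cast (by omega : p ≤ 7))
          linarith
        · obtain rfl : p = 11 := by
            interval_cases p <;> first | rfl | norm_num at hp
          have h1 := sum_roughMangoldt_add_le (p := 11) (N := N)
            (S := {2, 4, 8, 16, 32, 64, 128, 256, 512, 1024} ∪ {3, 9, 27} ∪ {5})
            (fun n hn ↦ by simp at hn; simp; omega)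
            (fun n hn _ ↦ by
              rcases mem_union.1 hn with hn | hn
              · rcases mem_union.1 hn with hn | hn
                · exact not_isRough_of_dvd Nat.prime_two (by norm_num) (by simp at hn; omega)
                · exact not_isRough_of_dvd Nat.prime_three (by norm_num) (by simp at hn; omega)
              · exact not_isRough_of_dvd Nat.prime_five (by norm_num) (by simp at hn; omega))
          rw [sum_union (by decide), sum_union (by decide), sum_two_powers, sum_three_powers,
            sum_singleton, ArithmeticFunction.vonMangoldt_apply_prime Nat.prime_five] at h1
          push_cast at h1 ⊢
          linarith
    · obtain ⟨k, rfl⟩ := Nat.exists_eq_add_of_le h13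
      have h1 := hlow (b := 11) (by simp only [show 13 + k - 1 = 12 + k by omega]; nlinarith)
        (by norm_num)
      push_cast at h1 ⊢
      linarith

theorem roughMangoldt_eq_zero_of_lt {p n : ℕ} (hn : n < p) : roughMangoldt p n = 0 := by
  unfold roughMangoldt
  split_ifs with h
  · by_cases h1 : n = 1
    · simp [h1]
    rcases Nat.eq_zero_or_pos n with h0 | h0
    · simp [h0]
    have h2 := h n.minFac (Nat.minFac_prime h1) n.minFac_dvd
    have h3 := Nat.minFac_le h0
    omega
  · rfl

theorem sub_div_le_log_div_sub_log_div {a b L : ℝ} (hb : 0 < b) (hab : b ≤ a) (hL : 0 < L) :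
    (a - b) * (1 / (a * (a + L))) ≤ Real.log (a / (a + L)) / L - Real.log (b / (b + L)) / L := by
  have ha : 0 < a := hb.trans_le hab
  rw [← sub_div, ← Real.log_div (by positivity) (by positivity), le_div_iff₀ hL]
  refine le_trans ?_ (Real.one_sub_inv_le_log_of_pos (by positivity))
  have h : 1 - (a / (a + L) / (b / (b + L)))⁻¹ = L * (a - b) * (1 / (a * (b + L))) := by
    field_simp
    ring
  rw [h]
  calc (a - b) * (1 / (a * (a + L))) * L = L * (a - b) * (1 / (a * (a + L))) := by ring
    _ ≤ L * (a - b) * (1 / (a * (b + L))) := by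
      have : 0 ≤ a - b := sub_nonneg.2 hab
      gcongr

theorem half_mul_add_log_div_le {Y L : ℝ} (hY : 0 < Y) (hL : 0 < L) :
    L / 2 * (1 / (Y * (Y + L))) - Real.log (Y / (Y + L)) / L ≤ 1 / Y := by
  have ht : 0 < (Y + L) / Y := by positivity
  have h := Real.self_le_sinh_iff.2
    (Real.log_nonneg ((one_le_div hY).2 (by linarith : Y ≤ Y + L)))
  rw [Real.sinh_log ht] at h
  have h2 : Real.log (Y / (Y + L)) = - Real.log ((Y + L) / Y) := by
    rw [← Real.log_inv, inv_div]
  rw [h2, neg_div, sub_neg_eq_add, ← le_sub_iff_add_le', div_le_iff₀ hL]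
  refine h.trans_eq ?_
  field_simp
  ring

theorem sum_roughMangoldt_mul_le {p n Q : ℕ} (hp : p.Prime) (hp3 : 3 ≤ p) :
    ∑ q ∈ Icc 1 Q, roughMangoldt p q / q *
      (1 / ((Real.log n + Real.log q) * (Real.log n + Real.log q + Real.log p))) ≤
      1 / (Real.log n + Real.log p) := by
  set L := Real.log p
  set s := Real.log n
  have hL : 0 < L := Real.log_pos (by exact_mod_cast hp.one_lt)
  have hs : 0 ≤ s := Real.log_natCast_nonneg n
  set a : ℕ → ℝ := fun q ↦ s + Real.log q with ha
  set g : ℕ → ℝ := fun q ↦ 1 / (a q * (a q + L)) with hg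
  set G : ℕ → ℝ := fun q ↦ Real.log (a q / (a q + L)) / L with hG
  set C : ℕ → ℝ := fun N ↦ ∑ q ∈ Icc 1 N, roughMangoldt p q / q with hC
  have hapos {q : ℕ} (hq : p ≤ q) : 0 < a q :=
    add_pos_of_nonneg_of_pos hs (Real.log_pos (by exact_mod_cast hp.one_lt.trans_le hq))
  change ∑ q ∈ Icc 1 Q, roughMangoldt p q / q * g q ≤ 1 / (s + L)
  rcases Nat.lt_or_ge Q p with hQ | hQ
  · rw [sum_eq_zero]
    · positivity
    · intro q hq
      rw [roughMangoldt_eq_zero_of_lt (by have := (mem_Icc.1 hq).2; omega)]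
      simp
  have key : ∑ q ∈ Icc 1 Q, roughMangoldt p q / q * g q + (Real.log Q - L / 2 - C Q) * g Q ≤
      L / 2 * g p + G Q - G p := by
    induction Q, hQ using Nat.le_induction with
    | base =>
      have h : ∑ q ∈ Icc 1 p, roughMangoldt p q / q * g q = C p * g p := by
        rw [hC]
        simp only
        rw [sum_mul]
        refine sum_congr rfl fun q hq ↦ ?_
        rcases (mem_Icc.1 hq).2.lt_or_eq with h | rfl
        · rw [roughMangoldt_eq_zero_of_lt h]
          simp
        · rfl
      rw [h]
      apply le_of_eq
      change C p * g p + (L - L / 2 - C p) * g p = _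
      ring
    | succ Q hQ ih =>
      have hQ0 : (0 : ℝ) < Q := by exact_mod_cast hp.pos.trans_le hQ
      have hab : a Q ≤ a (Q + 1) := by
        simp only [ha]
        gcongr
        exact Nat.le_succ Q
      have hb := hapos hQ
      have hgmono : g (Q + 1) ≤ g Q := by
        simp only [hg]
        gcongr
      have hDC : 0 ≤ Real.log Q - L / 2 - C Q := sub_nonneg.2 (sum_roughMangoldt_le hp hp3 hQ)
      have hstep := sub_div_le_log_div_sub_log_div hb hab hL
      change (a (Q + 1) - a Q) * g (Q + 1) ≤ G (Q + 1) - G Q at hstep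
      have hadiff : a (Q + 1) - a Q = Real.log (Q + 1 : ℕ) - Real.log Q := by
        simp only [ha]
        ring
      rw [hadiff] at hstep
      have hCs : C (Q + 1) = C Q + roughMangoldt p (Q + 1) / (Q + 1 : ℕ) := by
        simp only [hC]
        rw [sum_Icc_succ_top (by omega)]
      rw [sum_Icc_succ_top (by omega), hCs]
      have := mul_le_mul_of_nonneg_left hgmono hDC
      linarith
  have hDC : 0 ≤ (Real.log Q - L / 2 - C Q) * g Q := by
    refine mul_nonneg (sub_nonneg.2 (sum_roughMangoldt_le hp hp3 hQ)) ?_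
    have := hapos hQ
    simp only [hg]
    positivity
  have hGQ : G Q ≤ 0 := by
    have := hapos hQ
    refine div_nonpos_of_nonpos_of_nonneg (Real.log_nonpos (by positivity) ?_) hL.le
    rw [div_le_one (by positivity)]
    linarith
  have hfin := half_mul_add_log_div_le (hapos le_rfl) hL
  change L / 2 * g p - G p ≤ 1 / (s + L) at hfin
  linarith

/-- The mass reaching `n` when mass `x m` is released at each `m ≤ K`, and mass at `N > 1` moves
to a divisor `N / q` in proportion `Λ q / log N`. -/
noncomputable def flow (K : ℕ) (x : ℕ → ℝ) (n : ℕ) : ℝ :=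
  x n + ∑ N ∈ (Ioc n K).attach,
    if n ∣ N.1 then flow K x N.1 * (Λ (N.1 / n) / Real.log N.1) else 0
termination_by K - n
decreasing_by
  have := mem_Ioc.1 N.2
  omega

theorem flow_eq (K : ℕ) (x : ℕ → ℝ) (n : ℕ) :
    flow K x n = x n + ∑ N ∈ Ioc n K,
      if n ∣ N then flow K x N * (Λ (N / n) / Real.log N) else 0 := by
  rw [flow, sum_attach (Ioc n K)
    (fun N ↦ if n ∣ N then flow K x N * (Λ (N / n) / Real.log N) else 0)]

theorem flow_eq_zero {K : ℕ} {x : ℕ → ℝ} (n : ℕ) (h : ∀ N, n ∣ N → x N = 0) :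
    flow K x n = 0 := by
  induction hk : K - n using Nat.strong_induction_on generalizing n with
  | _ k ih =>
  rw [flow_eq, h n dvd_rfl, zero_add]
  refine sum_eq_zero fun N hN ↦ ?_
  have := mem_Ioc.1 hN
  split_ifs with hd
  · rw [ih (K - N) (by omega) N (fun M hM ↦ h M (hd.trans hM)) rfl, zero_mul]
  · rfl

theorem sum_vonMangoldt_div_div_log {N : ℕ} (hN : 2 ≤ N) :
    ∑ n ∈ Ico 1 N, (if n ∣ N then Λ (N / n) / Real.log N else 0) = 1 := by
  have hlog : 0 < Real.log N := Real.log_pos (by exact_mod_cast hN)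
  have h := ArithmeticFunction.vonMangoldt_sum (n := N)
  rw [← Nat.sum_div_divisors N (fun d ↦ Λ d), ← Nat.insert_self_properDivisors (by omega),
    sum_insert (by simp), Nat.div_self (by omega), ArithmeticFunction.vonMangoldt_apply_one,
    zero_add] at h
  rw [← sum_filter, ← sum_div, div_eq_one_iff_eq hlog.ne', ← h]
  rfl

theorem flow_one {K : ℕ} (hK : 1 ≤ K) (x : ℕ → ℝ) :
    flow K x 1 = ∑ n ∈ Icc 1 K, x n := by
  have h1 : ∑ n ∈ Icc 1 K, flow K x n = ∑ n ∈ Icc 1 K, x n + ∑ N ∈ Ioc 1 K, flow K x N := by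
    rw [sum_congr rfl fun n _ ↦ flow_eq K x n, sum_add_distrib]
    congr 1
    rw [sum_comm' (t' := Ioc 1 K) (s' := fun N ↦ Ico 1 N)]
    · refine sum_congr rfl fun N hN ↦ ?_
      simp only [← mul_ite_zero]
      rw [← mul_sum, sum_vonMangoldt_div_div_log (by have := mem_Ioc.1 hN; omega), mul_one]
    · intro n N
      simp only [mem_Icc, mem_Ioc, mem_Ico]
      omega
  rw [← Ioc_insert_left hK, sum_insert (by simp)] at h1
  rw [← Ioc_insert_left hK]
  linarith

theorem sum_le_of_subinvariant {w : ℕ → ℝ} {R : ℕ → Prop}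
    (hR : ∀ m n, m ∣ n → R n → R m)
    (hsub : ∀ K n, 1 ≤ n → R n → ∀ S ⊆ Ioc n K, (∀ N ∈ S, n ∣ N ∧ R N) →
      ∑ N ∈ S, w N * (Λ (N / n) / Real.log N) ≤ w n)
    {M : Finset ℕ} (hM : ∀ m ∈ M, 1 ≤ m ∧ R m)
    (hanti : ∀ a ∈ M, ∀ b ∈ M, a ≠ b → ¬ a ∣ b) (hR1 : R 1) :
    ∑ m ∈ M, w m ≤ w 1 := by
  classical
  set K := M.sup id + 1 with hK
  have hMK : M ⊆ Icc 1 K := fun m hm ↦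
    mem_Icc.2 ⟨(hM m hm).1, (le_sup (f := id) hm).trans (Nat.le_succ _)⟩
  set x : ℕ → ℝ := fun n ↦ if n ∈ M then w n else 0 with hx
  have hsum : ∑ m ∈ M, w m = flow K x 1 := by
    rw [flow_one (by omega), hx, ← sum_filter, filter_mem_eq_inter, inter_eq_right.2 hMK]
  have hle : ∀ n, 1 ≤ n → R n → flow K x n ≤ w n := by
    intro n hn hRn
    induction hk : K - n using Nat.strong_induction_on generalizing n with
    | _ k ih =>
    rw [flow_eq]
    by_cases hnM : n ∈ M
    · rw [sum_eq_zero, add_zero, hx]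
      · simp [hnM]
      · intro N hN
        have hN' := mem_Ioc.1 hN
        split_ifs with hd
        · rw [flow_eq_zero N, zero_mul]
          intro m hm
          refine if_neg fun hmM ↦ hanti n hnM m hmM ?_ (hd.trans hm)
          have := Nat.le_of_dvd (hM m hmM).1 hm
          omega
        · rfl
    · have h0 : x n = 0 := if_neg hnM
      rw [h0, zero_add]
      refine le_trans ?_ (hsub K n hn hRn ((Ioc n K).filter fun N ↦ n ∣ N ∧ R N)
        (filter_subset _ _) (fun N hN ↦ (mem_filter.1 hN).2))
      rw [sum_filter]
      refine sum_le_sum fun N hN ↦ ?_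
      have hN' := mem_Ioc.1 hN
      have hc : 0 ≤ Λ (N / n) / Real.log N :=
        div_nonneg ArithmeticFunction.vonMangoldt_nonneg (Real.log_natCast_nonneg N)
      by_cases hd : n ∣ N
      · by_cases hRN : R N
        · rw [if_pos hd, if_pos ⟨hd, hRN⟩]
          exact mul_le_mul_of_nonneg_right (ih (K - N) (by omega) N (by omega) hRN rfl) hc
        · rw [if_pos hd, if_neg (fun h ↦ hRN h.2), flow_eq_zero N, zero_mul]
          exact fun m hm ↦ if_neg fun hmM ↦ hRN (hR N m hm (hM m hmM).2)
      · rw [if_neg hd, if_neg (fun h ↦ hd h.1)]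
  rw [hsum]
  exact hle 1 le_rfl hR1

theorem IsRough.of_dvd {p m n : ℕ} (h : IsRough p n) (hd : m ∣ n) : IsRough p m :=
  fun r hr hrm ↦ h r hr (hrm.trans hd)

theorem rough_weight_subinvariant {p : ℕ} (hp : p.Prime) (hp3 : 3 ≤ p) {K n : ℕ} (hn : 1 ≤ n)
    {S : Finset ℕ} (hS : S ⊆ Ioc n K) (hd : ∀ N ∈ S, n ∣ N ∧ IsRough p N) :
    ∑ N ∈ S, 1 / (N * (Real.log N + Real.log p)) * (Λ (N / n) / Real.log N) ≤
      1 / (n * (Real.log n + Real.log p)) := by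
  have hn0 : (0 : ℝ) < n := by exact_mod_cast hn
  have hlogp : 0 ≤ Real.log p := Real.log_natCast_nonneg p
  have hlogn : 0 ≤ Real.log n := Real.log_natCast_nonneg n
  have hinj : Set.InjOn (fun N ↦ N / n) S := by
    intro a ha b hb hab
    obtain ⟨c, rfl⟩ := (hd a ha).1
    obtain ⟨d, rfl⟩ := (hd b hb).1
    simp only [Nat.mul_div_cancel_left _ hn] at hab
    rw [hab]
  have hterm : ∀ N ∈ S, 1 / (N * (Real.log N + Real.log p)) * (Λ (N / n) / Real.log N) =
      1 / n * (roughMangoldt p (N / n) / (N / n : ℕ) * (1 / ((Real.log n + Real.log (N / n : ℕ)) *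
        (Real.log n + Real.log (N / n : ℕ) + Real.log p)))) := by
    intro N hN
    obtain ⟨⟨q, rfl⟩, hr⟩ := hd N hN
    have hq : q ≠ 0 := by
      rintro rfl
      simpa using (mem_Ioc.1 (hS hN)).1
    have hq0 : (0 : ℝ) < q := by positivity
    rw [Nat.mul_div_cancel_left _ hn, roughMangoldt, if_pos (hr.of_dvd (dvd_mul_left q n)),
      Nat.cast_mul, Real.log_mul hn0.ne' hq0.ne']
    simp only [div_eq_mul_inv, mul_inv, one_mul]
    ring
  rw [sum_congr rfl hterm, ← mul_sum, ← sum_image (f := fun q : ℕ ↦ roughMangoldt p q / (q : ℕ) *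
    (1 / ((Real.log n + Real.log q) * (Real.log n + Real.log q + Real.log p)))) hinj,
    one_div_mul_eq_div, ← one_div_mul_one_div]
  rw [div_eq_mul_one_div, mul_comm]
  refine mul_le_mul_of_nonneg_left ?_ (by positivity)
  refine le_trans (sum_le_sum_of_subset_of_nonneg (t := Icc 1 K) ?_ ?_)
    (sum_roughMangoldt_mul_le hp hp3)
  · intro q hq
    obtain ⟨N, hN, rfl⟩ := mem_image.1 hq
    have h1 := mem_Ioc.1 (hS hN)
    exact mem_Icc.2 ⟨(Nat.one_le_div_iff hn).2 h1.1.le, (Nat.div_le_self N n).trans h1.2⟩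
  · intro q _ _
    have := Real.log_natCast_nonneg q
    exact mul_nonneg (div_nonneg (roughMangoldt_nonneg p q) (by positivity)) (by positivity)

/-- Every odd prime is Erdős strong. -/
theorem sum_le_of_minFac_eq {p : ℕ} (hp : p.Prime) (hp3 : 3 ≤ p) {S : Finset ℕ}
    (hS : ∀ a ∈ S, 1 < a ∧ a.minFac = p)
    (hanti : ∀ a ∈ S, ∀ b ∈ S, a ≠ b → ¬ a ∣ b) :
    ∑ a ∈ S, 1 / ((a : ℝ) * Real.log a) ≤ 1 / (p * Real.log p) := by
  have hp0 : (0 : ℝ) < p := by exact_mod_cast hp.pos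
  have hmul : ∀ a ∈ S, p * (a / p) = a := fun a ha ↦
    Nat.mul_div_cancel' ((hS a ha).2 ▸ Nat.minFac_dvd a)
  have hpos : ∀ a ∈ S, 1 ≤ a / p := fun a ha ↦ by
    have h1 := hmul a ha
    have h2 := (hS a ha).1
    by_contra! h
    rw [Nat.lt_one_iff.1 h] at h1
    omega
  have hinj : Set.InjOn (fun a ↦ a / p) S := by
    intro a ha b hb hab
    rw [← hmul a ha, ← hmul b hb]
    exact congrArg _ hab
  have hmain := sum_le_of_subinvariant (w := fun n ↦ 1 / (n * (Real.log n + Real.log p)))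
    (R := IsRough p) (M := S.image (fun a ↦ a / p)) (fun m n hd h ↦ h.of_dvd hd)
    (fun K n hn _ T hT hd ↦ rough_weight_subinvariant hp hp3 hn hT hd)
    (by
      intro m hm
      obtain ⟨a, ha, rfl⟩ := mem_image.1 hm
      refine ⟨hpos a ha, fun r hr hra ↦ ?_⟩
      rw [← (hS a ha).2]
      exact Nat.minFac_le_of_dvd hr.two_le
        (hra.trans ⟨p, by rw [mul_comm]; exact (hmul a ha).symm⟩))
    (by
      intro m hm m' hm' hne hdvd
      obtain ⟨a, ha, rfl⟩ := mem_image.1 hm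
      obtain ⟨b, hb, rfl⟩ := mem_image.1 hm'
      refine hanti a ha b hb (fun h ↦ hne (by rw [h])) ?_
      rw [← hmul a ha, ← hmul b hb]
      exact mul_dvd_mul_left p hdvd)
    (fun r hr h ↦ absurd (Nat.dvd_one.1 h) hr.ne_one)
  rw [sum_image hinj] at hmain
  simp only [Nat.cast_one, Real.log_one, zero_add, one_mul] at hmain
  have hterm : ∀ a ∈ S, 1 / ((a : ℝ) * Real.log a) =
      1 / p * (1 / ((a / p : ℕ) * (Real.log (a / p : ℕ) + Real.log p))) := by
    intro a ha
    have h1 : (0 : ℝ) < (a / p : ℕ) := by exact_mod_cast hpos a ha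
    nth_rw 1 2 [← hmul a ha]
    rw [Nat.cast_mul, Real.log_mul hp0.ne' h1.ne', one_div_mul_one_div, mul_assoc, add_comm]
  rw [sum_congr rfl hterm, ← mul_sum, ← one_div_mul_one_div]
  exact mul_le_mul_of_nonneg_left hmain (by positivity)

end PrimitiveSet

theorem primitive_supported_on_interval (A : Set ℕ) (hA : IsPrimitive A)
    (hsupp : ∀ p ∈ primeSupport A, 3 ≤ p ∧ (p : ℝ) ≤ Real.exp (10 ^ 6)) :
    f A ≤ ∑' p : primeSupport A, 1 / ((p : ℕ) * Real.log (p : ℕ)) := by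
  classical
  have hfin : (primeSupport A).Finite := (Set.finite_Iic ⌊Real.exp (10 ^ 6)⌋₊).subset
    fun p hp ↦ Nat.le_floor (hsupp p hp).2
  have hrhs : ∑' p : primeSupport A, 1 / (((p : ℕ) : ℝ) * Real.log (p : ℕ)) =
      ∑ p ∈ hfin.toFinset, 1 / ((p : ℝ) * Real.log p) := by
    rw [← Finset.tsum_subtype' hfin.toFinset (fun p : ℕ ↦ 1 / ((p : ℝ) * Real.log p)),
      hfin.coe_toFinset]
  rw [hrhs]
  refine Real.tsum_le_of_sum_le (fun a ↦ ?_) fun s ↦ ?_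
  · have := Real.log_natCast_nonneg (a : ℕ)
    positivity
  set S := s.map (Function.Embedding.subtype (· ∈ A)) with hS
  have hsum : ∑ a ∈ s, 1 / (((a : ℕ) : ℝ) * Real.log (a : ℕ)) =
      ∑ a ∈ S, 1 / ((a : ℝ) * Real.log a) := by
    rw [hS, Finset.sum_map]
    rfl
  rw [hsum]
  have hSA : ∀ a ∈ S, a ∈ A := by
    intro a ha
    obtain ⟨b, -, rfl⟩ := Finset.mem_map.1 ha
    exact b.2
  have hmaps : ∀ a ∈ S, a.minFac ∈ hfin.toFinset := fun a ha ↦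
    hfin.mem_toFinset.2 ⟨Nat.minFac_prime (hA.1 a (hSA a ha)).ne', a, hSA a ha, a.minFac_dvd⟩
  rw [← Finset.sum_fiberwise_of_maps_to hmaps]
  refine Finset.sum_le_sum fun p hp ↦ ?_
  have hp' := hfin.mem_toFinset.1 hp
  refine PrimitiveSet.sum_le_of_minFac_eq hp'.1 (hsupp p hp').1 (fun a ha ↦ ?_)
    fun a ha b hb ↦ ?_
  · obtain ⟨h1, h2⟩ := Finset.mem_filter.1 ha
    exact ⟨hA.1 a (hSA a h1), h2⟩
  · exact hA.2 a (hSA a (Finset.mem_filter.1 ha).1) b (hSA b (Finset.mem_filter.1 hb).1)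
end

section
/- There is a positive constant c such that for every integer k ≥ 1, f(ℕ_k) := ∑_{n : Ω(n)=k} 1/(n·log n) ≥ c, where Ω(n) is the number of prime factors of n counted with multiplicity and ℕ_k = {n > 1 : Ω(n) = k}. -/
open scoped BigOperators

/-- `ℕ_k`: the set of integers with exactly `k` prime factors counted with
multiplicity (each such integer exceeds 1 when `k ≥ 1`). -/
def NN (k : ℕ) : Set ℕ :=
  {n : ℕ | 1 < n ∧ (Nat.primeFactorsList n).length = k}

open Set Filter Topology MeasureTheory ArithmeticFunction
open scoped ENNReal

/-- The positive integers with exactly `k` prime factors counted with multiplicity. -/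
def almostPrimes (k : ℕ) : Set ℕ := {n | n ≠ 0 ∧ cardFactors n = k}

/-- The real Dirichlet series `∑ p⁻ˢ` over the primes. -/
noncomputable def primeZetaSum (s : ℝ) : ℝ := ∑' p : Nat.Primes, (p : ℝ) ^ (-s)

/-- The Dirichlet series `∑ n⁻ˢ` over the integers with exactly `k` prime factors. -/
noncomputable def almostPrimeSum (k : ℕ) (s : ℝ) : ℝ≥0∞ :=
  ∑' n : almostPrimes k, ENNReal.ofReal ((n : ℝ) ^ (-s))

theorem NN_eq_almostPrimes {k : ℕ} (hk : 1 ≤ k) : NN k = almostPrimes k := by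
  ext n
  simp only [NN, almostPrimes, mem_ofPred_eq, cardFactors_apply]
  constructor
  · rintro ⟨h, h'⟩
    exact ⟨by omega, h'⟩
  · rintro ⟨h, h'⟩
    refine ⟨?_, h'⟩
    by_contra hn
    have : n = 1 := by omega
    subst this
    simp at h'
    omega

/-- Multiplication by a prime, as a map from `almostPrimes k` to `almostPrimes (k + 1)`. -/
def primeMul (k : ℕ) (x : Nat.Primes × almostPrimes k) : almostPrimes (k + 1) :=
  ⟨x.1 * x.2, mul_ne_zero x.1.2.ne_zero x.2.2.1, by
    rw [cardFactors_mul x.1.2.ne_zero x.2.2.1, cardFactors_apply_prime x.1.2, x.2.2.2, add_comm]⟩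

theorem primeMul_surjective (k : ℕ) : Function.Surjective (primeMul k) := by
  rintro ⟨n, hn, hk⟩
  have h1 : n ≠ 1 := by
    rintro rfl
    simp at hk
  obtain ⟨p, hp, m, rfl⟩ := Nat.exists_prime_and_dvd h1
  have hm : m ≠ 0 := right_ne_zero_of_mul hn
  rw [cardFactors_mul hp.ne_zero hm, cardFactors_apply_prime hp] at hk
  exact ⟨(⟨p, hp⟩, ⟨m, hm, by omega⟩), rfl⟩

theorem encard_primeMul_fiber_le (k : ℕ) (n : almostPrimes (k + 1)) :
    ENat.card {x // primeMul k x = n} ≤ (k + 1 : ℕ) := by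
  have key : ∀ x : {x // primeMul k x = n}, (x.1.1 : ℕ) ∈ (n : ℕ).primeFactors := by
    rintro ⟨x, hx⟩
    rw [Nat.mem_primeFactors]
    exact ⟨x.1.2, ⟨x.2, (congrArg Subtype.val hx).symm⟩, n.2.1⟩
  have hinj : Function.Injective
      (fun x : {x // primeMul k x = n} => (⟨x.1.1, key x⟩ : (n : ℕ).primeFactors)) := by
    rintro ⟨⟨p, m⟩, hx⟩ ⟨⟨q, l⟩, hy⟩ h
    have hpq : p = q := Subtype.ext (by simpa using h)
    subst hpq
    have h2 : (p : ℕ) * m = p * l := congrArg Subtype.val (hx.trans hy.symm)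
    have h3 : m = l := Subtype.ext (Nat.eq_of_mul_eq_mul_left p.2.pos h2)
    subst h3
    rfl
  refine (ENat.card_le_card_of_injective hinj).trans ?_
  have h4 : (n : ℕ).primeFactors.card ≤ k + 1 := by
    have h5 : (n : ℕ).primeFactors.card ≤ cardFactors (n : ℕ) := by
      rw [cardFactors_apply]
      exact List.toFinset_card_le _
    rwa [n.2.2] at h5
  rw [ENat.card_eq_coe_fintype_card, Fintype.card_coe]
  exact_mod_cast h4

theorem tsum_prod_eq_tsum_primeMul (k : ℕ) (s : ℝ) :
    (∑' p : Nat.Primes, ENNReal.ofReal ((p : ℝ) ^ (-s))) * almostPrimeSum k s =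
      ∑' x, ENNReal.ofReal (((primeMul k x : ℕ) : ℝ) ^ (-s)) := by
  rw [ENNReal.tsum_prod', ← ENNReal.tsum_mul_right]
  refine tsum_congr fun p => ?_
  rw [almostPrimeSum, ← ENNReal.tsum_mul_left]
  refine tsum_congr fun m => ?_
  rw [← ENNReal.ofReal_mul (by positivity), ← Real.mul_rpow (by positivity) (by positivity)]
  simp [primeMul]

theorem almostPrimeSum_succ_le (k : ℕ) (s : ℝ) :
    almostPrimeSum (k + 1) s ≤
      (∑' p : Nat.Primes, ENNReal.ofReal ((p : ℝ) ^ (-s))) * almostPrimeSum k s := by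
  rw [tsum_prod_eq_tsum_primeMul]
  exact ENNReal.tsum_le_tsum_comp_of_surjective (primeMul_surjective k)
    fun n : almostPrimes (k + 1) => ENNReal.ofReal ((n : ℝ) ^ (-s))

theorem le_almostPrimeSum_succ (k : ℕ) (s : ℝ) :
    (∑' p : Nat.Primes, ENNReal.ofReal ((p : ℝ) ^ (-s))) * almostPrimeSum k s ≤
      (k + 1 : ℕ) * almostPrimeSum (k + 1) s := by
  rw [tsum_prod_eq_tsum_primeMul, ← (Equiv.sigmaFiberEquiv (primeMul k)).tsum_eq,
    ENNReal.tsum_sigma', almostPrimeSum, ← ENNReal.tsum_mul_left]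
  refine ENNReal.tsum_le_tsum fun n => ?_
  have : ∀ x : {x // primeMul k x = n},
      ENNReal.ofReal (((primeMul k (Equiv.sigmaFiberEquiv (primeMul k) ⟨n, x⟩) : ℕ) : ℝ) ^ (-s)) =
        ENNReal.ofReal ((n : ℝ) ^ (-s)) := by
    rintro ⟨x, rfl⟩
    rfl
  rw [tsum_congr this, ENNReal.tsum_const]
  gcongr
  exact_mod_cast encard_primeMul_fiber_le k n

theorem almostPrimeSum_zero (s : ℝ) : almostPrimeSum 0 s = 1 := by
  have h : almostPrimes 0 = {1} := by
    ext n
    simp only [almostPrimes, mem_ofPred_eq, mem_singleton_iff, cardFactors_eq_zero_iff_eq_zero_or_one]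
    omega
  rw [almostPrimeSum, h, tsum_singleton 1 fun n : ℕ => ENNReal.ofReal ((n : ℝ) ^ (-s))]
  simp

theorem almostPrimeSum_le_pow (k : ℕ) (s : ℝ) :
    almostPrimeSum k s ≤ (∑' p : Nat.Primes, ENNReal.ofReal ((p : ℝ) ^ (-s))) ^ k := by
  induction k with
  | zero => simp [almostPrimeSum_zero]
  | succ k ih =>
    rw [pow_succ']
    exact (almostPrimeSum_succ_le k s).trans (by gcongr)

theorem pow_le_factorial_mul_almostPrimeSum (k : ℕ) (s : ℝ) :
    (∑' p : Nat.Primes, ENNReal.ofReal ((p : ℝ) ^ (-s))) ^ k ≤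
      (k.factorial : ℝ≥0∞) * almostPrimeSum k s := by
  induction k with
  | zero => simp [almostPrimeSum_zero]
  | succ k ih =>
    rw [pow_succ', Nat.factorial_succ]
    refine (mul_le_mul_right ih _).trans ?_
    rw [mul_left_comm, Nat.cast_mul, mul_comm ((k + 1 : ℕ) : ℝ≥0∞), mul_assoc]
    exact mul_le_mul_right (le_almostPrimeSum_succ k s) _

/-- The completely multiplicative function `n ↦ n⁻ˢ` for real `s ≠ 0`. -/
noncomputable def rpowNegHom {s : ℝ} (hs : s ≠ 0) : ℕ →*₀ ℝ where
  toFun n := (n : ℝ) ^ (-s)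
  map_zero' := by simp [Real.zero_rpow, hs]
  map_one' := by simp
  map_mul' m n := by
    simpa only [Nat.cast_mul] using Real.mul_rpow m.cast_nonneg n.cast_nonneg

theorem summable_primes_rpow_neg {s : ℝ} (hs : 1 < s) :
    Summable fun p : Nat.Primes => (p : ℝ) ^ (-s) :=
  (Real.summable_nat_rpow.2 (by linarith : -s < -1)).subtype _

theorem ofReal_primeZetaSum {s : ℝ} (hs : 1 < s) :
    ENNReal.ofReal (primeZetaSum s) = ∑' p : Nat.Primes, ENNReal.ofReal ((p : ℝ) ^ (-s)) :=
  ENNReal.ofReal_tsum_of_nonneg (fun _ => by positivity) (summable_primes_rpow_neg hs)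

theorem hasProd_one_sub_rpow_neg_inv {s : ℝ} (hs : 1 < s) :
    HasProd (fun p : Nat.Primes => (1 - (p : ℝ) ^ (-s))⁻¹) (∑' n : ℕ, (n : ℝ) ^ (-s)) := by
  have h := EulerProduct.eulerProduct_completely_multiplicative_hasProd
    (f := rpowNegHom (by linarith : s ≠ 0)) ?_
  · exact h
  · refine (Real.summable_nat_rpow.2 (by linarith : -s < -1)).congr fun n => ?_
    exact (Real.norm_of_nonneg (by positivity)).symm

theorem prime_rpow_neg_le_half {s : ℝ} (hs : 1 < s) (p : Nat.Primes) :
    (p : ℝ) ^ (-s) ≤ 1 / 2 := by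
  have hp : (2 : ℝ) ≤ p := by exact_mod_cast p.2.two_le
  calc (p : ℝ) ^ (-s) ≤ (p : ℝ) ^ (-1 : ℝ) :=
        Real.rpow_le_rpow_of_exponent_le (by linarith) (by linarith)
    _ = 1 / p := by rw [Real.rpow_neg_one, one_div]
    _ ≤ 1 / 2 := by gcongr

theorem exp_primeZetaSum_le {s : ℝ} (hs : 1 < s) :
    Real.exp (primeZetaSum s) ≤ ∑' n : ℕ, (n : ℝ) ^ (-s) := by
  have h : HasProd (fun p : Nat.Primes => Real.exp ((p : ℝ) ^ (-s))) (Real.exp (primeZetaSum s)) :=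
    (summable_primes_rpow_neg hs).hasSum.rexp
  refine le_of_tendsto_of_tendsto' h (hasProd_one_sub_rpow_neg_inv hs) fun F => ?_
  refine Finset.prod_le_prod (fun _ _ => by positivity) fun p _ => ?_
  have hp := prime_rpow_neg_le_half hs p
  rw [le_inv_comm₀ (by positivity) (by linarith), ← Real.exp_neg]
  linarith [Real.add_one_le_exp (-(p : ℝ) ^ (-s))]

theorem one_sub_inv_le_exp {x : ℝ} (hx : x ≤ 1 / 2) :
    (1 - x)⁻¹ ≤ Real.exp (x + 2 * x ^ 2) := by
  rw [inv_le_iff_one_le_mul₀ (by linarith)]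
  have := Real.add_one_le_exp (x + 2 * x ^ 2)
  nlinarith [mul_nonneg (sq_nonneg x) (by linarith : 0 ≤ 1 - 2 * x)]

theorem tsum_rpow_neg_le_exp {s : ℝ} (hs : 1 < s) :
    ∑' n : ℕ, (n : ℝ) ^ (-s) ≤
      Real.exp (primeZetaSum s + 2 * ∑' n : ℕ, (n : ℝ) ^ (-2 : ℝ)) := by
  refine le_of_tendsto' (hasProd_one_sub_rpow_neg_inv hs) fun F => ?_
  have h1 : ∀ p : Nat.Primes, (1 - (p : ℝ) ^ (-s))⁻¹ ≤
      Real.exp ((p : ℝ) ^ (-s) + 2 * (p : ℝ) ^ (-2 : ℝ)) := by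
    intro p
    refine (one_sub_inv_le_exp (prime_rpow_neg_le_half hs p)).trans ?_
    gcongr
    have hp : (1 : ℝ) ≤ p := by exact_mod_cast p.2.one_le
    rw [← Real.rpow_natCast, ← Real.rpow_mul (by positivity)]
    exact Real.rpow_le_rpow_of_exponent_le hp (by push_cast; linarith)
  have h2 : Summable fun n : ℕ => (n : ℝ) ^ (-2 : ℝ) := Real.summable_nat_rpow.2 (by norm_num)
  calc ∏ p ∈ F, (1 - (p : ℝ) ^ (-s))⁻¹
      ≤ ∏ p ∈ F, Real.exp ((p : ℝ) ^ (-s) + 2 * (p : ℝ) ^ (-2 : ℝ)) :=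
        Finset.prod_le_prod
          (fun p _ => inv_nonneg.2 (by linarith [prime_rpow_neg_le_half hs p])) fun p _ => h1 p
    _ = Real.exp (∑ p ∈ F, (p : ℝ) ^ (-s) + 2 * ∑ p ∈ F, (p : ℝ) ^ (-2 : ℝ)) := by
        rw [← Real.exp_sum, Finset.sum_add_distrib, Finset.mul_sum]
    _ ≤ _ := by
        gcongr
        · exact (summable_primes_rpow_neg hs).sum_le_tsum F fun _ _ => by positivity
        · have h3 : Summable fun p : Nat.Primes => (p : ℝ) ^ (-2 : ℝ) := h2.subtype _
          exact (h3.sum_le_tsum F fun _ _ => by positivity).trans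
            (h2.tsum_subtype_le _ {p | Nat.Prime p} fun _ => by positivity)

theorem tsum_rpow_neg_eq {s : ℝ} (hs : 1 < s) :
    ∑' n : ℕ, (n : ℝ) ^ (-s) = ∑' n : ℕ, 1 / (n + 1 : ℝ) ^ s := by
  rw [(Real.summable_nat_rpow.2 (by linarith : -s < -1)).tsum_eq_zero_add]
  rw [Nat.cast_zero, Real.zero_rpow (by linarith), zero_add]
  refine tsum_congr fun n => ?_
  rw [Real.rpow_neg (by positivity), one_div]
  push_cast
  rfl

theorem tsum_rpow_neg_le {s : ℝ} (hs : 1 < s) :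
    ∑' n : ℕ, (n : ℝ) ^ (-s) ≤ 1 + 1 / (s - 1) := by
  have h := ZetaAsymptotics.zeta_limit_aux1 hs
  have h0 : 0 ≤ ZetaAsymptotics.termTSum s := tsum_nonneg fun n => ZetaAsymptotics.term_nonneg _ _
  rw [tsum_rpow_neg_eq hs]
  nlinarith

theorem sub_rpow_neg_le {t x : ℝ} (ht : 0 < t) (hx : 0 < x) :
    x ^ (-t) - (x + 1) ^ (-t) ≤ t * x ^ (-(1 + t)) := by
  have h1 : (x + 1) ^ (-t) = x ^ (-t) * (1 + x⁻¹) ^ (-t) := by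
    rw [← Real.mul_rpow (by positivity) (by positivity), mul_add, mul_inv_cancel₀ hx.ne', mul_one]
  have h2 : 1 - t * x⁻¹ ≤ (1 + x⁻¹) ^ (-t) := by
    rw [Real.rpow_def_of_pos (by positivity)]
    have h3 := Real.log_le_sub_one_of_pos (by positivity : 0 < 1 + x⁻¹)
    have h4 := Real.add_one_le_exp (Real.log (1 + x⁻¹) * -t)
    nlinarith
  have h5 : x ^ (-(1 + t)) = x ^ (-t) * x⁻¹ := by
    rw [← Real.rpow_neg_one x, ← Real.rpow_add hx]
    ring_nf
  rw [h1, h5]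
  nlinarith [Real.rpow_pos_of_pos hx (-t)]

theorem one_div_le_tsum_rpow_neg {s : ℝ} (hs : 1 < s) :
    1 / (s - 1) ≤ ∑' n : ℕ, (n : ℝ) ^ (-s) := by
  have ht : 0 < s - 1 := by linarith
  have hsum : Summable fun n : ℕ => (n : ℝ) ^ (-s) :=
    Real.summable_nat_rpow.2 (by linarith : -s < -1)
  have key : ∀ N : ℕ, 1 - ((N : ℝ) + 1) ^ (-(s - 1)) ≤ (s - 1) * ∑' n : ℕ, (n : ℝ) ^ (-s) := by
    intro N
    have h1 : 1 - ((N : ℝ) + 1) ^ (-(s - 1)) ≤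
        (s - 1) * ∑ n ∈ Finset.range N, ((n + 1 : ℕ) : ℝ) ^ (-s) := by
      induction N with
      | zero => simp
      | succ N ih =>
        rw [Finset.sum_range_succ, mul_add]
        have := sub_rpow_neg_le ht (by positivity : (0 : ℝ) < N + 1)
        rw [show 1 + (s - 1) = s by ring] at this
        push_cast at *
        linarith
    refine h1.trans ?_
    gcongr
    rw [hsum.tsum_eq_zero_add]
    have h2 := ((summable_nat_add_iff 1).2 hsum).sum_le_tsum (Finset.range N)
      fun _ _ => by positivity
    have h3 : (0 : ℝ) ≤ ((0 : ℕ) : ℝ) ^ (-s) := by positivity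
    linarith
  have hlim : Tendsto (fun N : ℕ => 1 - ((N : ℝ) + 1) ^ (-(s - 1))) atTop (𝓝 (1 - 0)) :=
    ((tendsto_rpow_neg_atTop ht).comp
      (tendsto_natCast_atTop_atTop.atTop_add tendsto_const_nhds)).const_sub 1
  rw [div_le_iff₀ ht, mul_comm]
  simpa using le_of_tendsto' hlim key

theorem le_primeZetaSum (u : ℝ) :
    u - 2 * ∑' n : ℕ, (n : ℝ) ^ (-2 : ℝ) ≤ primeZetaSum (1 + Real.exp (-u)) := by
  have hs : 1 < 1 + Real.exp (-u) := by linarith [Real.exp_pos (-u)]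
  have h := (one_div_le_tsum_rpow_neg hs).trans (tsum_rpow_neg_le_exp hs)
  rw [add_sub_cancel_left, one_div, ← Real.exp_neg, neg_neg, Real.exp_le_exp] at h
  linarith

theorem exp_primeZetaSum_half_le {u : ℝ} (hu : 0 ≤ u) :
    Real.exp (primeZetaSum (1 + Real.exp (-u)) / 2) ≤ 2 * Real.exp (u / 2) := by
  have hs : 1 < 1 + Real.exp (-u) := by linarith [Real.exp_pos (-u)]
  have h := (exp_primeZetaSum_le hs).trans (tsum_rpow_neg_le hs)
  rw [add_sub_cancel_left, one_div, ← Real.exp_neg, neg_neg] at h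
  refine abs_le_of_sq_le_sq' ?_ (by positivity) |>.2
  rw [mul_pow, ← Real.exp_nat_mul, ← Real.exp_nat_mul]
  push_cast
  rw [mul_div_cancel₀ _ two_ne_zero, mul_div_cancel₀ _ two_ne_zero]
  linarith [Real.one_le_exp hu]

theorem primeZetaSum_nonneg (s : ℝ) : 0 ≤ primeZetaSum s := tsum_nonneg fun _ => by positivity

theorem pow_le_factorial_mul_exp {x : ℝ} (hx : 0 ≤ x) (k : ℕ) :
    x ^ k ≤ k.factorial * 2 ^ k * Real.exp (x / 2) := by
  have h := Real.pow_div_factorial_le_exp (x / 2) (by positivity) k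
  rw [div_le_iff₀ (by positivity), div_pow, div_le_iff₀ (by positivity)] at h
  linarith

theorem lintegral_rpow_neg_mul_exp {n : ℕ} (hn : 2 ≤ n) :
    ∫⁻ u in Ioi (0 : ℝ),
        ENNReal.ofReal ((n : ℝ) ^ (-(1 + Real.exp (-u)))) * ENNReal.ofReal (Real.exp (-u)) =
      ENNReal.ofReal (1 / (n * Real.log n) * (1 - (n : ℝ)⁻¹)) := by
  have hn0 : (0 : ℝ) < n := by positivity
  have hlog : 0 < Real.log n := Real.log_pos (by exact_mod_cast hn)
  have hderiv : ∀ u ∈ Ici (0 : ℝ),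
      HasDerivAt (fun u => 1 / (n * Real.log n) * (n : ℝ) ^ (-Real.exp (-u)))
        ((n : ℝ) ^ (-(1 + Real.exp (-u))) * Real.exp (-u)) u := by
    intro u _
    have h := (((hasDerivAt_neg u).exp.neg).const_rpow hn0).const_mul (1 / (n * Real.log n))
    refine h.congr_deriv ?_
    simp only [Pi.neg_apply]
    rw [neg_add, Real.rpow_add hn0, Real.rpow_neg_one]
    field_simp
  have hpos : ∀ u ∈ Ioi (0 : ℝ), 0 ≤ (n : ℝ) ^ (-(1 + Real.exp (-u))) * Real.exp (-u) :=
    fun u _ => by positivity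
  have hlim : Tendsto (fun u => 1 / (n * Real.log n) * (n : ℝ) ^ (-Real.exp (-u))) atTop
      (𝓝 (1 / (n * Real.log n) * (n : ℝ) ^ (-0 : ℝ))) := by
    refine Tendsto.const_mul _ ?_
    exact (Real.continuous_const_rpow hn0.ne').continuousAt.tendsto.comp
      Real.tendsto_exp_neg_atTop_nhds_zero.neg
  have hint := integrableOn_Ioi_deriv_of_nonneg' hderiv hpos hlim
  have hval := integral_Ioi_of_hasDerivAt_of_nonneg' hderiv hpos hlim
  simp_rw [← ENNReal.ofReal_mul (Real.rpow_nonneg hn0.le _)]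
  rw [← ofReal_integral_eq_lintegral_ofReal hint
    (ae_of_all _ fun u => by positivity), hval]
  congr 1
  simp [Real.rpow_neg_one]
  ring

theorem tsum_lintegral_eq {k : ℕ} :
    ∑' n : almostPrimes k, ∫⁻ u in Ioi (0 : ℝ),
        ENNReal.ofReal ((n : ℝ) ^ (-(1 + Real.exp (-u)))) * ENNReal.ofReal (Real.exp (-u)) =
      ∫⁻ u in Ioi (0 : ℝ),
        almostPrimeSum k (1 + Real.exp (-u)) * ENNReal.ofReal (Real.exp (-u)) := by
  rw [← lintegral_tsum fun n => by fun_prop]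
  simp_rw [almostPrimeSum, ENNReal.tsum_mul_right]

theorem lintegral_almostPrimeSum_ne_top (k : ℕ) :
    ∫⁻ u in Ioi (0 : ℝ),
      almostPrimeSum k (1 + Real.exp (-u)) * ENNReal.ofReal (Real.exp (-u)) ≠ ∞ := by
  have hint : IntegrableOn
      (fun u => k.factorial * 2 ^ k * 2 * Real.exp (-(1 / 2) * u)) (Ioi (0 : ℝ)) :=
    (exp_neg_integrableOn_Ioi 0 (by norm_num : (0 : ℝ) < 1 / 2)).const_mul _
  refine ne_top_of_le_ne_top hint.lintegral_lt_top.ne ?_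
  refine setLIntegral_mono' measurableSet_Ioi fun u hu => ?_
  have hs : 1 < 1 + Real.exp (-u) := by linarith [Real.exp_pos (-u)]
  have h0 := primeZetaSum_nonneg (1 + Real.exp (-u))
  refine (mul_le_mul_left (almostPrimeSum_le_pow k _) _).trans ?_
  rw [← ofReal_primeZetaSum hs, ← ENNReal.ofReal_pow h0, ← ENNReal.ofReal_mul (by positivity)]
  refine ENNReal.ofReal_le_ofReal ?_
  have h1 : Real.exp (-(1 / 2) * u) = Real.exp (u / 2) * Real.exp (-u) := by
    rw [← Real.exp_add]
    ring_nf
  calc primeZetaSum (1 + Real.exp (-u)) ^ k * Real.exp (-u)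
      ≤ k.factorial * 2 ^ k * (2 * Real.exp (u / 2)) * Real.exp (-u) := by
        gcongr
        exact (pow_le_factorial_mul_exp h0 k).trans
          (by gcongr; exact exp_primeZetaSum_half_le (mem_Ioi.1 hu).le)
    _ = _ := by rw [h1]; ring

theorem lintegral_pow_mul_exp_neg (k : ℕ) :
    ∫⁻ v in Ioi (0 : ℝ), ENNReal.ofReal (v ^ k * Real.exp (-v)) = k.factorial := by
  have hk : (0 : ℝ) < k + 1 := by positivity
  have h : ∀ v ∈ Ioi (0 : ℝ), Real.exp (-v) * v ^ ((k : ℝ) + 1 - 1) = v ^ k * Real.exp (-v) := by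
    intro v _
    rw [add_sub_cancel_right, Real.rpow_natCast, mul_comm]
  have hint := (Real.GammaIntegral_convergent hk).congr_fun h measurableSet_Ioi
  rw [← ofReal_integral_eq_lintegral_ofReal hint, ← setIntegral_congr_fun measurableSet_Ioi h,
    ← Real.Gamma_eq_integral hk, Real.Gamma_nat_eq_factorial, ENNReal.ofReal_natCast]
  filter_upwards [ae_restrict_mem measurableSet_Ioi] with v hv
  have : 0 < v := hv
  positivity

theorem exp_neg_le_lintegral_almostPrimeSum (k : ℕ) :
    ENNReal.ofReal (Real.exp (-(2 * ∑' n : ℕ, (n : ℝ) ^ (-2 : ℝ)))) ≤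
      ∫⁻ u in Ioi (0 : ℝ),
        almostPrimeSum k (1 + Real.exp (-u)) * ENNReal.ofReal (Real.exp (-u)) := by
  set C := 2 * ∑' n : ℕ, (n : ℝ) ^ (-2 : ℝ)
  have hC0 : 0 ≤ C := mul_nonneg two_pos.le (tsum_nonneg fun _ => by positivity)
  have hk0 : (k.factorial : ℝ≥0∞) ≠ 0 := by exact_mod_cast k.factorial_ne_zero
  rw [← ENNReal.mul_le_mul_iff_right hk0 (ENNReal.natCast_ne_top _),
    ← lintegral_const_mul' _ _ (ENNReal.natCast_ne_top _), ← lintegral_pow_mul_exp_neg,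
    ← lintegral_mul_const' _ _ ENNReal.ofReal_ne_top, lintegral_pow_mul_exp_neg,
    ← lintegral_indicator measurableSet_Ioi, ← lintegral_indicator measurableSet_Ioi,
    ← lintegral_add_right_eq_self (indicator (Ioi 0) fun u => (k.factorial : ℝ≥0∞) * _) C]
  refine lintegral_mono fun v => ?_
  by_cases hv : v ∈ Ioi (0 : ℝ)
  swap
  · rw [indicator_of_notMem hv]
    exact zero_le
  have hv0 : 0 < v := hv
  have hvC : v + C ∈ Ioi (0 : ℝ) := add_pos_of_pos_of_nonneg hv0 hC0
  rw [indicator_of_mem hv, indicator_of_mem hvC, ← mul_assoc]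
  have hs : 1 < 1 + Real.exp (-(v + C)) := by linarith [Real.exp_pos (-(v + C))]
  refine le_trans ?_ (mul_le_mul_left (pow_le_factorial_mul_almostPrimeSum k _) _)
  rw [← ofReal_primeZetaSum hs, ← ENNReal.ofReal_pow (primeZetaSum_nonneg _),
    ← ENNReal.ofReal_mul (pow_nonneg (primeZetaSum_nonneg _) _), ← ENNReal.ofReal_mul (by positivity),
    mul_assoc, ← Real.exp_add, ← neg_add]
  refine ENNReal.ofReal_le_ofReal ?_
  gcongr
  have := le_primeZetaSum (v + C)
  linarith

theorem two_le_of_mem_almostPrimes {k n : ℕ} (hk : 1 ≤ k) (hn : n ∈ almostPrimes k) : 2 ≤ n := by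
  rw [← NN_eq_almostPrimes hk] at hn
  exact hn.1

theorem tsum_ofReal_one_div_mul_log_ne_top {k : ℕ} (hk : 1 ≤ k) :
    ∑' n : almostPrimes k, ENNReal.ofReal (1 / ((n : ℕ) * Real.log (n : ℕ))) ≠ ∞ := by
  refine ne_top_of_le_ne_top
    (ENNReal.mul_ne_top ENNReal.ofNat_ne_top (lintegral_almostPrimeSum_ne_top k) :
      2 * _ ≠ ∞) ?_
  rw [← tsum_lintegral_eq, ← ENNReal.tsum_mul_left]
  refine ENNReal.tsum_le_tsum fun n => ?_
  have hn := two_le_of_mem_almostPrimes hk n.2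
  have hn' : (2 : ℝ) ≤ (n : ℕ) := by exact_mod_cast hn
  have hlog : 0 < Real.log (n : ℕ) := Real.log_pos (by linarith)
  rw [lintegral_rpow_neg_mul_exp hn, ← ENNReal.ofReal_ofNat, ← ENNReal.ofReal_mul two_pos.le]
  refine ENNReal.ofReal_le_ofReal ?_
  have h1 : ((n : ℕ) : ℝ)⁻¹ ≤ 2⁻¹ := by gcongr
  have h2 : 0 ≤ 1 / (((n : ℕ) : ℝ) * Real.log (n : ℕ)) := by positivity
  nlinarith

theorem lintegral_almostPrimeSum_le_tsum {k : ℕ} (hk : 1 ≤ k) :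
    ∫⁻ u in Ioi (0 : ℝ),
        almostPrimeSum k (1 + Real.exp (-u)) * ENNReal.ofReal (Real.exp (-u)) ≤
      ∑' n : almostPrimes k, ENNReal.ofReal (1 / ((n : ℕ) * Real.log (n : ℕ))) := by
  rw [← tsum_lintegral_eq]
  refine ENNReal.tsum_le_tsum fun n => ?_
  rw [lintegral_rpow_neg_mul_exp (two_le_of_mem_almostPrimes hk n.2)]
  refine ENNReal.ofReal_le_ofReal (mul_le_of_le_one_right ?_ ?_)
  · positivity
  · linarith [inv_nonneg.2 (Nat.cast_nonneg (α := ℝ) (n : ℕ))]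

theorem f_NN_uniform_lower_bound :
    ∃ c : ℝ, 0 < c ∧ ∀ k : ℕ, 1 ≤ k → c ≤ f (NN k) := by
  refine ⟨Real.exp (-(2 * ∑' n : ℕ, (n : ℝ) ^ (-2 : ℝ))), Real.exp_pos _, fun k hk => ?_⟩
  have h := (exp_neg_le_lintegral_almostPrimeSum k).trans (lintegral_almostPrimeSum_le_tsum hk)
  have hf : f (NN k) =
      (∑' n : almostPrimes k, ENNReal.ofReal (1 / ((n : ℕ) * Real.log (n : ℕ)))).toReal := by
    rw [NN_eq_almostPrimes hk, f, ENNReal.tsum_toReal_eq fun _ => ENNReal.ofReal_ne_top]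
    exact tsum_congr fun n => (ENNReal.toReal_ofReal (by positivity)).symm
  rw [hf]
  exact (ENNReal.ofReal_le_iff_le_toReal (tsum_ofReal_one_div_mul_log_ne_top hk)).1 h
end
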